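/- arXiv:1307.3669 — 5 statements merged into one kernel-verified Lean document; each statement's English description precedes it below -/
import Mathlib

section
/- (de Montessus de Ballore's theorem) Let f be analytic at 0 and meromorphic in the disk |z| < τ with exactly ν poles there (counted with multiplicity), none at 0. Then for all sufficiently large n, the Padé approximant R_{n,ν} = [n/ν] of f exists and is unique, has exactly ν finite poles, these ν poles converge (with multiplicity) to the ν poles of f in |z| < τ as n → ∞, and the sequence R_{n,ν} converges to f uniformly on every compact subset of the domain D obtained from {|z| < τ} by deleting the poles of f. -/
open Filter Polynomial

/-- Taylor series at the origin, as a formal power series. -/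
noncomputable def taylorPS (f : ℂ → ℂ) : PowerSeries ℂ :=
  PowerSeries.mk fun k => iteratedDeriv k f 0 / (k.factorial : ℂ)

lemma taylorPS_mul {f g : ℂ → ℂ} (hf : AnalyticAt ℂ f 0) (hg : AnalyticAt ℂ g 0) :
    taylorPS (fun z => f z * g z) = taylorPS f * taylorPS g := by
  ext k
  rw [PowerSeries.coeff_mul]
  simp only [taylorPS, PowerSeries.coeff_mk]
  rw [iteratedDeriv_fun_mul hf.contDiffAt hg.contDiffAt, Finset.sum_div,
    Finset.Nat.sum_antidiagonal_eq_sum_range_succ_mk]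
  refine Finset.sum_congr rfl fun i hi => ?_
  have hik : i ≤ k := by simpa [Nat.lt_succ_iff] using hi
  have h := Nat.choose_mul_factorial_mul_factorial hik
  have h' : (k.choose i : ℂ) * i.factorial * (k - i).factorial = k.factorial := by exact_mod_cast h
  have h1 : (i.factorial : ℂ) ≠ 0 := by exact_mod_cast i.factorial_ne_zero
  have h2 : ((k-i).factorial : ℂ) ≠ 0 := by exact_mod_cast (k-i).factorial_ne_zero
  have h3 : (k.factorial : ℂ) ≠ 0 := by exact_mod_cast k.factorial_ne_zero
  rw [← h'] at h3 ⊢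
  have h4 : (k.choose i : ℂ) ≠ 0 := by
    intro h; simp [h] at h3
  field_simp

lemma taylorPS_sub {f g : ℂ → ℂ} (hf : AnalyticAt ℂ f 0) (hg : AnalyticAt ℂ g 0) :
    taylorPS (fun z => f z - g z) = taylorPS f - taylorPS g := by
  ext k
  simp only [taylorPS, PowerSeries.coeff_mk, map_sub]
  rw [iteratedDeriv_fun_sub hf.contDiffAt hg.contDiffAt, sub_div]

lemma taylorPS_poly (Q : ℂ[X]) : taylorPS (fun z => Q.eval z) = (Q : PowerSeries ℂ) := by
  have key : ∀ (k : ℕ), iteratedDeriv k (fun z => Q.eval z) = fun z => (derivative^[k] Q).eval z := by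
    intro k
    induction k with
    | zero => simp
    | succ k ih =>
      rw [iteratedDeriv_succ, ih, Function.iterate_succ_apply']
      ext z
      exact Polynomial.deriv _
  ext k
  simp only [taylorPS, PowerSeries.coeff_mk, key, Polynomial.coeff_coe]
  rw [← Polynomial.coeff_zero_eq_eval_zero, Polynomial.coeff_iterate_derivative]
  have h3 : (k.factorial : ℂ) ≠ 0 := by exact_mod_cast k.factorial_ne_zero
  simp [Nat.descFactorial_self]
  field_simp

lemma pade_iff {f g : ℂ → ℂ} (q P Q : ℂ[X]) (hg : AnalyticAt ℂ g 0)
    (hfg : ∀ᶠ z in nhds 0, f z = g z / q.eval z) (hq : q.eval 0 ≠ 0) (hQ : Q.eval 0 ≠ 0) (m : ℕ) :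
    (∀ k ≤ m, iteratedDeriv k (fun z => f z - P.eval z / Q.eval z) 0 = 0) ↔
    (∀ k ≤ m, PowerSeries.coeff k ((Q : PowerSeries ℂ) * taylorPS g) = (q * P).coeff k) := by
  have aP : ∀ R : ℂ[X], AnalyticAt ℂ (fun z => R.eval z) 0 := fun R =>
    (Differentiable.analyticAt R.differentiable 0)
  have e1 : (fun z => f z - P.eval z / Q.eval z) =ᶠ[nhds 0]
      (fun z => (Q.eval z * g z - q.eval z * P.eval z)) * (fun z => (q.eval z * Q.eval z)⁻¹) := by
    have h1 : ∀ᶠ z in nhds (0:ℂ), q.eval z ≠ 0 := q.continuous.continuousAt.eventually_ne hq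
    have h2 : ∀ᶠ z in nhds (0:ℂ), Q.eval z ≠ 0 := Q.continuous.continuousAt.eventually_ne hQ
    filter_upwards [hfg, h1, h2] with z hz h1 h2
    simp only [Pi.mul_apply]
    rw [hz]; field_simp
  have aE : AnalyticAt ℂ (fun z => (Q.eval z * g z - q.eval z * P.eval z)) 0 :=
    ((aP Q).mul hg).sub ((aP q).mul (aP P))
  have aU : AnalyticAt ℂ (fun z => (q.eval z * Q.eval z)⁻¹) 0 :=
    ((aP q).mul (aP Q)).inv (mul_ne_zero hq hQ)
  have aF := (aE.mul aU).congr e1.symm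
  have oU : analyticOrderAt (fun z => (q.eval z * Q.eval z)⁻¹) 0 = 0 :=
    aU.analyticOrderAt_eq_zero.2 (inv_ne_zero (mul_ne_zero hq hQ))
  have l1 := natCast_le_analyticOrderAt_iff_iteratedDeriv_eq_zero (n := m+1) aF
  have l2 := natCast_le_analyticOrderAt_iff_iteratedDeriv_eq_zero (n := m+1) aE
  rw [analyticOrderAt_congr e1, analyticOrderAt_mul aE aU, oU, add_zero] at l1
  simp only [Nat.lt_succ_iff] at l1 l2
  rw [← l1, l2]
  have hT : taylorPS (fun z => (Q.eval z * g z - q.eval z * P.eval z)) =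
      (Q : PowerSeries ℂ) * taylorPS g - ((q * P : ℂ[X]) : PowerSeries ℂ) := by
    rw [taylorPS_sub ((aP Q).fun_mul hg) ((aP q).fun_mul (aP P)), taylorPS_mul (aP Q) hg,
      taylorPS_mul (aP q) (aP P)]
    simp [taylorPS_poly]
  refine forall₂_congr fun k hk => ?_
  rw [← sub_eq_zero (b := (q*P).coeff k), ← Polynomial.coeff_coe, ← map_sub, ← hT]
  have h3 : (k.factorial : ℂ) ≠ 0 := by exact_mod_cast k.factorial_ne_zero
  simp [taylorPS, h3]

lemma taylor_unif {g : ℂ → ℂ} {τ : ℝ} (hg : AnalyticOnNhd ℂ g (Metric.ball 0 τ)) :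
    TendstoLocallyUniformlyOn (fun n z => ((taylorPS g).trunc n).eval z) g atTop
      (Metric.ball 0 τ) := by
  have hd := hg.differentiableOn
  have hs : ∀ z ∈ Metric.ball (0:ℂ) τ,
      HasSum (fun k => PowerSeries.coeff k (taylorPS g) * z ^ k) (g z) := by
    intro z hz
    have h := Complex.hasSum_taylorSeries_on_ball hd hz
    have e : (fun k => PowerSeries.coeff k (taylorPS g) * z ^ k) =
        fun k : ℕ => (k.factorial : ℂ)⁻¹ • (z - 0) ^ k • iteratedDeriv k g 0 := by
      funext k
      simp only [taylorPS, PowerSeries.coeff_mk, sub_zero, smul_eq_mul]; ring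
    rw [e]
    exact h
  rw [tendstoLocallyUniformlyOn_iff_forall_isCompact Metric.isOpen_ball]
  intro K hK hKc
  rcases K.eq_empty_or_nonempty with rfl | hne
  · exact tendstoUniformlyOn_empty
  obtain ⟨w, hw, hmax⟩ := hKc.exists_isMaxOn hne continuous_norm.continuousOn
  have h := tendstoUniformlyOn_tsum_nat (s := K)
    (f := fun k z => PowerSeries.coeff k (taylorPS g) * z ^ k)
    (summable_norm_iff.2 (hs w (hK hw)).summable) (by
      intro n x hx
      rw [norm_mul, norm_mul, norm_pow, norm_pow]
      gcongr
      exact hmax hx)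
  refine (h.congr_right fun z hz => (hs z (hK hz)).tsum_eq).congr (Eventually.of_forall fun n z hz => ?_)
  simpa only [eval, RingHom.id_apply] using (PowerSeries.eval₂_trunc_eq_sum_range z (RingHom.id ℂ) n (taylorPS g)).symm

lemma const_unif {c : ℕ → ℂ} {a : ℂ} (h : Tendsto c atTop (nhds a)) (s : Set ℂ) :
    TendstoLocallyUniformlyOn (fun n (_ : ℂ) => c n) (fun _ => a) atTop s := by
  refine TendstoUniformlyOn.tendstoLocallyUniformlyOn ?_
  rw [Metric.tendstoUniformlyOn_iff]
  intro ε hε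
  filter_upwards [Metric.tendsto_nhds.1 h ε hε] with n hn x _
  rwa [dist_comm]

lemma self_unif (f : ℂ → ℂ) (s : Set ℂ) :
    TendstoLocallyUniformlyOn (fun _ : ℕ => f) f atTop s := by
  refine TendstoUniformlyOn.tendstoLocallyUniformlyOn ?_
  rw [Metric.tendstoUniformlyOn_iff]
  intro ε hε
  exact Eventually.of_forall fun n x _ => by simpa using hε

lemma unif_sum (t : Finset ℕ) (F : ℕ → ℕ → ℂ → ℂ) (f : ℕ → ℂ → ℂ) (s : Set ℂ)
    (h : ∀ i ∈ t, TendstoLocallyUniformlyOn (fun n z => F n i z) (f i) atTop s) :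
    TendstoLocallyUniformlyOn (fun n z => ∑ i ∈ t, F n i z) (fun z => ∑ i ∈ t, f i z) atTop s := by
  induction t using Finset.induction_on with
  | empty => simpa using self_unif (fun _ => 0) s
  | insert a t ha ih =>
    simp only [Finset.sum_insert ha]
    exact (h a (by simp)).fun_add (ih fun i hi => h i (by simp [hi]))

/-- The linearized Padé equations, multiplied by the pole polynomial `q`. -/
structure IsSol (G : PowerSeries ℂ) (q : ℂ[X]) (ν n : ℕ) (Q P : ℂ[X]) : Prop where
  degP : P.natDegree ≤ n
  degQ : Q.natDegree ≤ ν
  eqn : ∀ k ≤ n + ν, PowerSeries.coeff k ((Q : PowerSeries ℂ) * G) = (q * P).coeff k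

lemma IsSol.smul {G : PowerSeries ℂ} {q : ℂ[X]} {ν n : ℕ} {Q P : ℂ[X]}
    (h : IsSol G q ν n Q P) (c : ℂ) : IsSol G q ν n (C c * Q) (C c * P) := by
  refine ⟨(natDegree_C_mul_le _ _).trans h.degP, (natDegree_C_mul_le _ _).trans h.degQ, ?_⟩
  intro k hk
  have := h.eqn k hk
  rw [mul_left_comm, coeff_C_mul, Polynomial.coe_mul, mul_assoc, Polynomial.coe_C,
    PowerSeries.coeff_C_mul, this]

lemma IsSol.sub {G : PowerSeries ℂ} {q : ℂ[X]} {ν n : ℕ} {Q P Q' P' : ℂ[X]}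
    (h : IsSol G q ν n Q P) (h' : IsSol G q ν n Q' P') : IsSol G q ν n (Q - Q') (P - P') := by
  refine ⟨(natDegree_sub_le _ _).trans (max_le h.degP h'.degP),
    (natDegree_sub_le _ _).trans (max_le h.degQ h'.degQ), ?_⟩
  intro k hk
  rw [mul_sub, Polynomial.coe_sub, sub_mul, map_sub, coeff_sub, h.eqn k hk, h'.eqn k hk]

lemma IsSol.formula {G : PowerSeries ℂ} {q : ℂ[X]} {ν n : ℕ} {Q P : ℂ[X]}
    (h : IsSol G q ν n Q P) (hq : q.natDegree ≤ ν) :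
    q * P = ∑ i ∈ Finset.range (ν + 1), C (Q.coeff i) * (X ^ i * G.trunc (n + ν + 1 - i)) := by
  ext k
  simp only [finsetSum_coeff, coeff_C_mul, coeff_X_pow_mul', PowerSeries.coeff_trunc]
  by_cases hk : k ≤ n + ν
  · rw [← h.eqn k hk]
    conv_lhs => rw [Q.as_sum_range_C_mul_X_pow' (Nat.lt_succ_of_le h.degQ)]
    rw [← Polynomial.coeToPowerSeries.ringHom_apply, map_sum, Finset.sum_mul, map_sum]
    refine Finset.sum_congr rfl fun i hi => ?_
    simp only [Polynomial.coeToPowerSeries.ringHom_apply, Polynomial.coe_mul, Polynomial.coe_C,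
      Polynomial.coe_pow, Polynomial.coe_X, mul_assoc, PowerSeries.coeff_C_mul,
      PowerSeries.coeff_X_pow_mul']
    by_cases hik : i ≤ k
    · have : k - i < n + ν + 1 - i := by omega
      simp [hik, this]
    · simp [hik]
  · rw [coeff_eq_zero_of_natDegree_lt, eq_comm]
    · refine Finset.sum_eq_zero fun i hi => ?_
      by_cases hik : i ≤ k
      · have : ¬ (k - i < n + ν + 1 - i) := by omega
        simp [this]
      · simp [hik]
    · have := natDegree_mul_le (p := q) (q := P)
      have := h.degP
      omega

lemma IsSol.unique {G : PowerSeries ℂ} {q : ℂ[X]} {ν n : ℕ} {Q P P' : ℂ[X]}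
    (h : IsSol G q ν n Q P) (h' : IsSol G q ν n Q P') (hq : q.natDegree ≤ ν) (hq0 : q ≠ 0) :
    P = P' :=
  mul_left_cancel₀ hq0 ((h.formula hq).trans (h'.formula hq).symm)

lemma poly_unif (ν : ℕ) (Q : ℕ → ℂ[X]) (Q0 : ℂ[X])
    (hR : ∀ n, (Q n).natDegree ≤ ν) (hR0 : Q0.natDegree ≤ ν)
    (hc : ∀ j, Tendsto (fun n => (Q n).coeff j) atTop (nhds (Q0.coeff j))) (s : Set ℂ) :
    TendstoLocallyUniformlyOn (fun n z => (Q n).eval z) (fun z => Q0.eval z) atTop s := by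
  have e0 := fun z : ℂ => eval_eq_sum_range' (Nat.lt_succ_of_le hR0) z
  have e := fun n (z : ℂ) => eval_eq_sum_range' (Nat.lt_succ_of_le (hR n)) z
  simp_rw [e0, e]
  refine unif_sum _ _ _ _ fun i _ => ?_
  exact (const_unif (hc i) s).fun_mul₀ (self_unif (fun z : ℂ => z ^ i) s) (by fun_prop) (by fun_prop)

lemma sol_unif {g : ℂ → ℂ} {τ : ℝ} (hg : AnalyticOnNhd ℂ g (Metric.ball 0 τ))
    {q : ℂ[X]} {ν : ℕ} (hq : q.natDegree ≤ ν) (n : ℕ → ℕ) (hn : Tendsto n atTop atTop)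
    (Q P : ℕ → ℂ[X]) (Q0 : ℂ[X]) (h : ∀ k, IsSol (taylorPS g) q ν (n k) (Q k) (P k))
    (hR0 : Q0.natDegree ≤ ν)
    (hc : ∀ j, Tendsto (fun n => (Q n).coeff j) atTop (nhds (Q0.coeff j))) :
    TendstoLocallyUniformlyOn (fun k z => (q * P k).eval z) (fun z => Q0.eval z * g z) atTop
      (Metric.ball 0 τ) := by
  have e0 := fun z : ℂ => eval_eq_sum_range' (Nat.lt_succ_of_le hR0) z
  have e1 : ∀ k z, (q * P k).eval z = ∑ i ∈ Finset.range (ν+1),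
      (Q k).coeff i * (z ^ i * ((taylorPS g).trunc (n k + ν + 1 - i)).eval z) := by
    intro k z
    rw [(h k).formula hq, eval_finsetSum]
    simp
  have e2 : ∀ z, Q0.eval z * g z = ∑ i ∈ Finset.range (ν+1), Q0.coeff i * (z ^ i * g z) := by
    intro z
    rw [e0, Finset.sum_mul]
    exact Finset.sum_congr rfl fun _ _ => by ring
  simp_rw [e1, e2]
  have cg := hg.continuousOn
  refine unif_sum _ _ _ _ fun i hi => ?_
  refine (const_unif (hc i) _).fun_mul₀ ((self_unif (fun z : ℂ => z ^ i) _).fun_mul₀ ?_ (by fun_prop) cg)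
    (by fun_prop) ((by fun_prop : Continuous fun z : ℂ => z ^ i).continuousOn.mul cg)
  have ht : Tendsto (fun k => n k + ν + 1 - i) atTop atTop := by
    refine tendsto_atTop_mono (fun k => ?_) hn
    simp at hi; omega
  intro u hu x hx
  obtain ⟨t, ht', hev⟩ := taylor_unif hg u hu x hx
  exact ⟨t, ht', ht.eventually hev⟩

lemma dvd_of_eqOn {ι : Type*} [DecidableEq ι] {g H : ℂ → ℂ} {τ : ℝ} (hgc : ContinuousOn g (Metric.ball 0 τ))
    (hH : ContinuousOn H (Metric.ball 0 τ)) (α : ι → ℂ) (hα : ∀ i, α i ∈ Metric.ball (0:ℂ) τ)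
    (hgα : ∀ i, g (α i) ≠ 0) (s : Finset ι) : ∀ (Q : ℂ[X]),
    (∀ z ∈ Metric.ball (0:ℂ) τ, (∏ i ∈ s, (X - C (α i))).eval z * H z = Q.eval z * g z) →
    (∏ i ∈ s, (X - C (α i))) ∣ Q := by
  induction s using Finset.induction_on with
  | empty => intro Q _; simp
  | insert a s ha ih =>
    intro Q h
    have h1 := h (α a) (hα a)
    rw [Finset.prod_insert ha] at h1 ⊢
    have hr : Q.IsRoot (α a) := by
      simp only [eval_mul, eval_sub, eval_X, eval_C, sub_self, zero_mul] at h1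
      exact (mul_eq_zero.1 h1.symm).resolve_right (hgα a)
    obtain ⟨Q', rfl⟩ := dvd_iff_isRoot.2 hr
    refine mul_dvd_mul_left _ (ih Q' ?_)
    have off : ∀ z ∈ Metric.ball (0:ℂ) τ, z ≠ α a →
        (∏ i ∈ s, (X - C (α i))).eval z * H z = Q'.eval z * g z := by
      intro z hz hne
      have h2 := h z hz
      rw [Finset.prod_insert ha] at h2
      simp only [eval_mul, eval_sub, eval_X, eval_C, mul_assoc] at h2
      exact mul_left_cancel₀ (sub_ne_zero.2 hne) h2
    intro z hz
    by_cases hne : z = α a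
    · subst hne
      have hb := Metric.isOpen_ball.mem_nhds hz
      have c1 : ContinuousAt (fun z => (∏ i ∈ s, (X - C (α i))).eval z * H z) (α a) :=
        (Polynomial.continuousAt _).mul (hH.continuousAt hb)
      have c2 : ContinuousAt (fun z => Q'.eval z * g z) (α a) :=
        (Polynomial.continuousAt _).mul (hgc.continuousAt hb)
      have t1 := c1.tendsto.mono_left (nhdsWithin_le_nhds (s := {α a}ᶜ))
      have t2 := c2.tendsto.mono_left (nhdsWithin_le_nhds (s := {α a}ᶜ))
      refine tendsto_nhds_unique_of_eventuallyEq t1 t2 ?_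
      filter_upwards [self_mem_nhdsWithin, mem_nhdsWithin_of_mem_nhds hb] with w hw hwb
      exact off w hwb hw
    · exact off z hz hne

lemma key_limit {g : ℂ → ℂ} {τ : ℝ} (hτ : 0 < τ) (hg : AnalyticOnNhd ℂ g (Metric.ball 0 τ))
    {ν : ℕ} (α : Fin ν → ℂ) (hα : ∀ i, α i ∈ Metric.ball (0:ℂ) τ)
    (n : ℕ → ℕ) (hn : Tendsto n atTop atTop)
    (Q P : ℕ → ℂ[X]) (Q0 : ℂ[X])
    (h : ∀ k, IsSol (taylorPS g) (∏ i, (X - C (α i))) ν (n k) (Q k) (P k))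
    (hR0 : Q0.natDegree ≤ ν)
    (hc : ∀ j, Tendsto (fun n => (Q n).coeff j) atTop (nhds (Q0.coeff j))) :
    ∃ H : ℂ → ℂ, ContinuousOn H (Metric.ball 0 τ) ∧
      TendstoLocallyUniformlyOn (fun k z => (P k).eval z) H atTop (Metric.ball 0 τ) ∧
      ∀ z ∈ Metric.ball (0:ℂ) τ, (∏ i, (X - C (α i))).eval z * H z = Q0.eval z * g z := by
  set q : ℂ[X] := ∏ i, (X - C (α i)) with hqdef
  have hqd : q.natDegree ≤ ν := by
    rw [hqdef, natDegree_finsetProd_X_sub_C_eq_card]; simp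
  have hu := sol_unif hg hqd n hn Q P Q0 h hR0 hc
  have hcau : ∀ r < τ, UniformCauchySeqOn (fun k z => (P k).eval z) atTop (Metric.closedBall 0 r) := by
    intro r hr
    -- enlarge the radius
    obtain ⟨ρ, hρτ, hρ0, hrρ, hαρ⟩ : ∃ ρ < τ, 0 < ρ ∧ r ≤ ρ ∧ ∀ i, ‖α i‖ < ρ := by
      have h1 : ∀ᶠ ρ in nhdsWithin τ (Set.Iio τ), ρ < τ := self_mem_nhdsWithin
      have h2 : ∀ᶠ ρ in nhdsWithin τ (Set.Iio τ), 0 < ρ :=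
        mem_nhdsWithin_of_mem_nhds (Ioi_mem_nhds hτ)
      have h3 : ∀ᶠ ρ in nhdsWithin τ (Set.Iio τ), r < ρ :=
        mem_nhdsWithin_of_mem_nhds (Ioi_mem_nhds hr)
      have h4 : ∀ᶠ ρ in nhdsWithin τ (Set.Iio τ), ∀ i, ‖α i‖ < ρ :=
        eventually_all.2 fun i =>
          mem_nhdsWithin_of_mem_nhds (Ioi_mem_nhds (by simpa using hα i))
      obtain ⟨ρ, a, b, c, d⟩ := (h1.and (h2.and (h3.and h4))).exists
      exact ⟨ρ, a, b, c.le, d⟩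
    refine UniformCauchySeqOn.mono (s := Metric.closedBall 0 ρ) ?_ (Metric.closedBall_subset_closedBall hrρ)
    -- lower bound for q on the sphere
    obtain ⟨δ, hδ, hδq⟩ : ∃ δ > 0, ∀ z ∈ Metric.sphere (0:ℂ) ρ, δ ≤ ‖q.eval z‖ := by
      obtain ⟨w, hw, hmin⟩ := (isCompact_sphere (0:ℂ) ρ).exists_isMinOn
        (NormedSpace.sphere_nonempty.2 hρ0.le) (f := fun z => ‖q.eval z‖)
        (q.continuous.norm.continuousOn)
      refine ⟨‖q.eval w‖, norm_pos_iff.2 ?_, fun z hz => hmin hz⟩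
      rw [hqdef, eval_prod]
      refine Finset.prod_ne_zero_iff.2 fun i _ => ?_
      simp only [eval_sub, eval_X, eval_C]
      intro h0
      have := hαρ i
      rw [← sub_eq_zero.1 h0] at this
      simp at hw
      linarith
    have huc := ((tendstoLocallyUniformlyOn_iff_forall_isCompact Metric.isOpen_ball).1 hu
      (Metric.closedBall 0 ρ) (Metric.closedBall_subset_ball hρτ)
      (isCompact_closedBall _ _)).uniformCauchySeqOn
    rw [Metric.uniformCauchySeqOn_iff] at huc ⊢
    intro ε hε
    obtain ⟨N, hN⟩ := huc (δ * (ε / 2)) (by positivity)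
    refine ⟨N, fun m hm k hk z hz => ?_⟩
    have hb : ‖(P m - P k).eval z‖ ≤ ε / 2 := by
      refine Complex.norm_le_of_forall_mem_frontier_norm_le (U := Metric.ball 0 ρ)
        (f := fun z => (P m - P k).eval z) Metric.isBounded_ball
        (Polynomial.differentiable _).diffContOnCl ?_ (by rwa [closure_ball _ hρ0.ne'])
      intro w hw
      rw [frontier_ball _ hρ0.ne'] at hw
      have h1 := hN m hm k hk w (Metric.sphere_subset_closedBall hw)
      rw [dist_eq_norm, ← eval_sub, ← mul_sub, eval_mul, norm_mul] at h1
      have h2 := hδq w hw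
      have h3 : δ * ‖(P m - P k).eval w‖ < δ * (ε / 2) :=
        lt_of_le_of_lt (mul_le_mul_of_nonneg_right h2 (norm_nonneg _)) h1
      exact (lt_of_mul_lt_mul_left h3 hδ.le).le
    rw [dist_eq_norm, ← eval_sub]
    linarith
  have hlim : ∀ z : ℂ, ∃ y, z ∈ Metric.ball (0:ℂ) τ → Tendsto (fun k => (P k).eval z) atTop (nhds y) := by
    intro z
    by_cases hz : z ∈ Metric.ball (0:ℂ) τ
    · have hc : CauchySeq (fun k => (P k).eval z) :=
        (hcau ‖z‖ (by simpa using hz)).cauchySeq (by simp)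
      obtain ⟨y, hy⟩ := cauchySeq_tendsto_of_complete hc
      exact ⟨y, fun _ => hy⟩
    · exact ⟨0, fun h => absurd h hz⟩
  choose H hH using hlim
  have hHu : TendstoLocallyUniformlyOn (fun k z => (P k).eval z) H atTop (Metric.ball 0 τ) := by
    rw [tendstoLocallyUniformlyOn_iff_forall_isCompact Metric.isOpen_ball]
    intro K hK hKc
    rcases K.eq_empty_or_nonempty with rfl | hne
    · exact tendstoUniformlyOn_empty
    obtain ⟨w, hw, hmax⟩ := hKc.exists_isMaxOn hne continuous_norm.continuousOn
    have hKr : K ⊆ Metric.closedBall 0 ‖w‖ := fun z hz => by simpa using hmax hz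
    have hwτ : ‖w‖ < τ := by simpa using hK hw
    refine UniformCauchySeqOn.tendstoUniformlyOn_of_tendsto ((hcau _ hwτ).mono hKr) ?_
    exact fun z hz => hH z (hK hz)
  refine ⟨H, hHu.continuousOn (Eventually.of_forall fun k => (P k).continuous.continuousOn).frequently, hHu, ?_⟩
  intro z hz
  have t1 := (hH z hz).const_mul (q.eval z)
  have t2 := hu.tendsto_at hz
  simp only [eval_mul] at t2
  exact tendsto_nhds_unique t1 t2

lemma exists_sol (G : PowerSeries ℂ) (q : ℂ[X]) (hq : q.eval 0 ≠ 0) (ν n : ℕ) :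
    ∃ Q P, Q ≠ 0 ∧ IsSol G q ν n Q P := by
  let F : PowerSeries ℂ := (q : PowerSeries ℂ)⁻¹ * G
  have hqF : (q : PowerSeries ℂ) * F = G := by
    rw [← mul_assoc, PowerSeries.mul_inv_cancel, one_mul]
    rwa [Polynomial.constantCoeff_coe, coeff_zero_eq_eval_zero]
  let L : (degreeLT ℂ (ν + 1)) →ₗ[ℂ] (Fin ν → ℂ) :=
    { toFun := fun Q i => PowerSeries.coeff (n + 1 + i) (((Q : ℂ[X]) : PowerSeries ℂ) * F)
      map_add' := by
        intro x y; funext i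
        simp [add_mul]
      map_smul' := by
        intro c x; funext i
        simp [Polynomial.coe_smul] }
  have hfin : Module.finrank ℂ (degreeLT ℂ (ν+1)) = ν + 1 := by
    rw [(degreeLTEquiv ℂ (ν+1)).finrank_eq]; simp
  have : FiniteDimensional ℂ (degreeLT ℂ (ν+1)) := (degreeLTEquiv ℂ (ν+1)).symm.finiteDimensional
  have hker : LinearMap.ker L ≠ ⊥ := LinearMap.ker_ne_bot_of_finrank_lt (by rw [hfin]; simp)
  obtain ⟨Q, hQ, hQ0⟩ := (Submodule.ne_bot_iff _).1 hker
  refine ⟨Q, PowerSeries.trunc (n+1) (((Q : ℂ[X]) : PowerSeries ℂ) * F), by simpa using hQ0, ?_, ?_, ?_⟩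
  · exact Nat.lt_succ_iff.1 (PowerSeries.natDegree_trunc_lt _ _)
  · have := mem_degreeLT.1 Q.2
    exact Nat.lt_succ_iff.1 ((natDegree_lt_iff_degree_lt (by simpa using hQ0)).2 this)
  · intro k hk
    rw [← hqF, mul_left_comm, ← Polynomial.coeff_coe, Polynomial.coe_mul, PowerSeries.coeff_mul,
      PowerSeries.coeff_mul]
    refine Finset.sum_congr rfl fun ij hij => ?_
    congr 1
    rw [Polynomial.coeff_coe, PowerSeries.coeff_trunc]
    split_ifs with h
    · rfl
    · have hs := Finset.HasAntidiagonal.mem_antidiagonal.1 hij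
      have h1 : ij.2 - (n+1) < ν := by omega
      have h2 := congrFun (LinearMap.mem_ker.1 hQ) ⟨ij.2 - (n+1), h1⟩
      have h3 : n + 1 + (ij.2 - (n+1)) = ij.2 := by omega
      simpa [L, h3] using h2

lemma quot_coeff_tendsto (ν : ℕ) (Q R : ℕ → ℂ[X]) (Q0 R0 : ℂ[X]) (b : ℕ → ℂ) (a : ℂ)
    (hQ : ∀ n, Q n = (X - C (b n)) * R n) (hQ0 : Q0 = (X - C a) * R0)
    (hR : ∀ n, (R n).natDegree ≤ ν) (hR0 : R0.natDegree ≤ ν)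
    (hb : Tendsto b atTop (nhds a))
    (hc : ∀ j, Tendsto (fun n => (Q n).coeff j) atTop (nhds (Q0.coeff j))) (j : ℕ) :
    Tendsto (fun n => (R n).coeff j) atTop (nhds (R0.coeff j)) := by
  have key : ∀ d j, ν < j + d →
      Tendsto (fun n => (R n).coeff j) atTop (nhds (R0.coeff j)) := by
    intro d
    induction d with
    | zero =>
      intro j hj
      have h1 : ∀ n, (R n).coeff j = 0 := fun n =>
        coeff_eq_zero_of_natDegree_lt (lt_of_le_of_lt (hR n) (by simpa using hj))
      have h2 : R0.coeff j = 0 :=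
        coeff_eq_zero_of_natDegree_lt (lt_of_le_of_lt hR0 (by simpa using hj))
      simp [h1, h2]
    | succ d ih =>
      intro j hj
      have h := ih (j+1) (by omega)
      have e : ∀ (R : ℂ[X]) (b : ℂ), R.coeff j =
          ((X - C b) * R).coeff (j+1) + b * R.coeff (j+1) := by
        intro R b; simp [sub_mul]
      have h2 := (hc (j+1)).add (hb.mul h)
      rw [e R0 a, ← hQ0]
      refine h2.congr fun n => ?_
      rw [e (R n) (b n), ← hQ n]
  exact key (ν + 1) j (by omega)

lemma eval_tendsto (ν : ℕ) (Q : ℕ → ℂ[X]) (Q0 : ℂ[X])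
    (hR : ∀ n, (Q n).natDegree ≤ ν) (hR0 : Q0.natDegree ≤ ν)
    (hc : ∀ j, Tendsto (fun n => (Q n).coeff j) atTop (nhds (Q0.coeff j))) (z : ℂ) :
    Tendsto (fun n => (Q n).eval z) atTop (nhds (Q0.eval z)) := by
  rw [eval_eq_sum_range' (Nat.lt_succ_of_le hR0)]
  simp_rw [fun n => eval_eq_sum_range' (Nat.lt_succ_of_le (hR n)) z]
  exact tendsto_finsetSum _ fun i _ => (hc i).mul_const _

lemma exists_root_close (ν : ℕ) (p : ℂ[X]) (hm : p.Monic) (hd : p.natDegree = ν + 1) (a : ℂ) :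
    ∃ b, p.IsRoot b ∧ ‖b - a‖ ^ (ν + 1) ≤ ‖p.eval a‖ := by
  have hs := IsAlgClosed.splits p
  have hcard : p.roots.card = ν + 1 := by rw [← hd, hs.natDegree_eq_card_roots]
  by_contra! hcon
  have hp : p.eval a = (p.roots.map (fun r => a - r)).prod := by
    conv_lhs => rw [hs.eq_prod_roots, hm.leadingCoeff]
    simp [eval_multiset_prod]
  have hne : p.roots ≠ 0 := by
    intro h; simp [h] at hcard
  -- pick the closest root
  obtain ⟨b, hb, hmin⟩ : ∃ b ∈ p.roots.toFinset, ∀ r ∈ p.roots.toFinset, ‖b - a‖ ≤ ‖r - a‖ :=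
    Finset.exists_min_image _ (fun r => ‖r - a‖) (by
      obtain ⟨x, hx⟩ := Multiset.exists_mem_of_ne_zero hne
      exact ⟨x, by simpa using hx⟩)
  have hb' : p.IsRoot b := by
    rw [Multiset.mem_toFinset] at hb; exact isRoot_of_mem_roots hb
  refine absurd (hcon b hb') (not_lt.2 ?_)
  have gen : ∀ s : Multiset ℂ, (∀ r ∈ s, ‖b - a‖ ≤ ‖r - a‖) →
      ‖b - a‖ ^ s.card ≤ ‖(s.map (fun r => a - r)).prod‖ := by
    intro s
    induction s using Multiset.induction_on with
    | empty => simp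
    | cons r s ih =>
      intro h
      rw [Multiset.card_cons, Multiset.map_cons, Multiset.prod_cons, norm_mul, pow_succ', norm_sub_rev a r]
      exact mul_le_mul (h r (by simp)) (ih fun x hx => h x (by simp [hx])) (by positivity) (by positivity)
  rw [hp, ← hcard]
  exact gen _ fun r hr => hmin r (by simpa using hr)

lemma roots_tendsto (ν : ℕ) : ∀ (p : ℕ → ℂ[X]) (α : Fin ν → ℂ), (∀ n, (p n).Monic) →
    (∀ n, (p n).natDegree = ν) →
    (∀ j, Tendsto (fun n => (p n).coeff j) atTop (nhds ((∏ i, (X - C (α i))).coeff j))) →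
    ∃ β : ℕ → Fin ν → ℂ, (∀ n, (p n).roots = Multiset.map (β n) Finset.univ.val) ∧
        ∀ i, Tendsto (fun n => β n i) atTop (nhds (α i)) := by
  induction ν with
  | zero =>
    intro p α hm hd hc
    refine ⟨fun _ i => i.elim0, fun n => ?_, fun i => i.elim0⟩
    rw [(Polynomial.Monic.natDegree_eq_zero (hm n)).1 (hd n)]
    simp
  | succ ν ih =>
    intro p α hm hd hc
    choose b hb hb2 using fun n => exists_root_close ν (p n) (hm n) (hd n) (α 0)
    have hd0 : (∏ i, (X - C (α i))).natDegree = ν + 1 := by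
      rw [natDegree_finsetProd_X_sub_C_eq_card]; simp
    have hev := eval_tendsto (ν+1) p _ (fun n => (hd n).le) hd0.le hc (α 0)
    have hz : (∏ i, (X - C (α i))).eval (α 0) = 0 := by
      rw [Fin.prod_univ_succ]; simp
    rw [hz] at hev
    have hbt : Tendsto b atTop (nhds (α 0)) := by
      rw [tendsto_iff_norm_sub_tendsto_zero]
      have h1 : Tendsto (fun n => ‖b n - α 0‖ ^ (ν+1)) atTop (nhds 0) :=
        squeeze_zero (fun n => by positivity) hb2 (by simpa using hev.norm)
      have h2 := h1.rpow_const (p := ((ν+1 : ℕ) : ℝ)⁻¹) (Or.inr (by positivity))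
      rw [Real.zero_rpow (by positivity)] at h2
      refine h2.congr fun n => ?_
      rw [Real.pow_rpow_inv_natCast (norm_nonneg _) (by omega)]
    choose R hR using fun n => dvd_iff_isRoot.2 (hb n)
    have hRm : ∀ n, (R n).Monic := fun n =>
      (monic_X_sub_C (b n)).of_mul_monic_left (by rw [← hR n]; exact hm n)
    have hRd : ∀ n, (R n).natDegree = ν := by
      intro n
      have := hd n
      rw [hR n, (monic_X_sub_C (b n)).natDegree_mul (hRm n), natDegree_X_sub_C] at this
      omega
    have hR0d : (∏ i : Fin ν, (X - C (α i.succ))).natDegree = ν := by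
      rw [natDegree_finsetProd_X_sub_C_eq_card]; simp
    have hp0 : (∏ i, (X - C (α i))) = (X - C (α 0)) * ∏ i : Fin ν, (X - C (α i.succ)) := by
      rw [Fin.prod_univ_succ]
    have hRc := quot_coeff_tendsto ν p R _ (∏ i : Fin ν, (X - C (α i.succ))) b (α 0) hR
      hp0 (fun n => (hRd n).le) hR0d.le hbt hc
    obtain ⟨β, hβ1, hβ2⟩ := ih R (fun i => α i.succ) hRm hRd hRc
    refine ⟨fun n => Fin.cons (b n) (β n), fun n => ?_, fun i => ?_⟩
    · rw [hR n, roots_mul (by rw [← hR n]; exact (hm n).ne_zero), roots_X_sub_C, hβ1 n]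
      simp [Fin.univ_succ, Function.comp_def]
    · refine Fin.cases ?_ (fun i => ?_) i
      · simpa using hbt
      · simpa using hβ2 i

lemma subseq_limit {g : ℂ → ℂ} {τ : ℝ} (hτ : 0 < τ) (hg : AnalyticOnNhd ℂ g (Metric.ball 0 τ))
    {ν : ℕ} (α : Fin ν → ℂ) (hα : ∀ i, α i ∈ Metric.ball (0:ℂ) τ) (hgα : ∀ i, g (α i) ≠ 0)
    (n : ℕ → ℕ) (hn : Tendsto n atTop atTop) (Q P : ℕ → ℂ[X]) (hQ0 : ∀ k, Q k ≠ 0)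
    (h : ∀ k, IsSol (taylorPS g) (∏ i, (X - C (α i))) ν (n k) (Q k) (P k)) :
    ∃ (ψ : ℕ → ℕ) (c : ℕ → ℂ), StrictMono ψ ∧
      ∀ j, Tendsto (fun k => c k * (Q (ψ k)).coeff j) atTop
        (nhds ((∏ i, (X - C (α i)) : ℂ[X]).coeff j)) := by
  set q : ℂ[X] := ∏ i, (X - C (α i)) with hqdef
  have hqd : q.natDegree = ν := by
    rw [hqdef, natDegree_finsetProd_X_sub_C_eq_card]; simp
  have hqm : q.Monic := monic_prod_of_monic _ _ fun i _ => monic_X_sub_C _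
  let v : ℕ → (Fin (ν+1) → ℂ) := fun k i => (Q k).coeff i
  have hv : ∀ k, v k ≠ 0 := by
    intro k hk
    apply hQ0 k
    ext j
    by_cases hj : j < ν + 1
    · simpa [v] using congrFun hk ⟨j, hj⟩
    · rw [coeff_eq_zero_of_natDegree_lt (by have := (h k).degQ; omega), coeff_zero]
  let d : ℕ → ℂ := fun k => ((‖v k‖ : ℝ) : ℂ)⁻¹
  have hmem : ∀ k, d k • v k ∈ Metric.sphere (0 : Fin (ν+1) → ℂ) 1 := by
    intro k
    have := norm_ne_zero_iff.2 (hv k)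
    simp [d, norm_smul, this]
  obtain ⟨u, hu, ψ, hψ, hlim⟩ := (isCompact_sphere (0 : Fin (ν+1) → ℂ) 1).tendsto_subseq hmem
  let Q0 : ℂ[X] := ∑ i : Fin (ν+1), C (u i) * X ^ (i : ℕ)
  have hQ0c : ∀ i : Fin (ν+1), Q0.coeff i = u i := by
    intro i
    simp [Q0, finsetSum_coeff, coeff_X_pow, Fin.val_inj]
  have hQ0d : Q0.natDegree ≤ ν := by
    refine natDegree_sum_le_of_forall_le _ _ fun i _ => ?_
    exact (natDegree_C_mul_X_pow_le _ _).trans (by omega)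
  have hQ0ne : Q0 ≠ 0 := by
    intro h0
    have : u = 0 := by
      funext i; rw [← hQ0c i, h0]; simp
    rw [this] at hu; simp at hu
  have hcoef : ∀ j, Tendsto (fun k => (C (d (ψ k)) * Q (ψ k)).coeff j) atTop (nhds (Q0.coeff j)) := by
    intro j
    by_cases hj : j < ν + 1
    · have := (tendsto_pi_nhds.1 hlim) ⟨j, hj⟩
      rw [hQ0c ⟨j, hj⟩]
      simpa [v, coeff_C_mul] using this
    · have e : ∀ k, (C (d (ψ k)) * Q (ψ k)).coeff j = 0 := by
        intro k
        rw [coeff_C_mul, coeff_eq_zero_of_natDegree_lt (by have := (h (ψ k)).degQ; omega), mul_zero]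
      rw [coeff_eq_zero_of_natDegree_lt (by omega)]
      simp [e]
  obtain ⟨H, hHc, -, hH⟩ := key_limit hτ hg α hα (fun k => n (ψ k)) (hn.comp hψ.tendsto_atTop)
    (fun k => C (d (ψ k)) * Q (ψ k)) (fun k => C (d (ψ k)) * P (ψ k)) Q0
    (fun k => (h (ψ k)).smul _) hQ0d hcoef
  obtain ⟨R, hR⟩ := dvd_of_eqOn hg.continuousOn hHc α hα hgα Finset.univ Q0 hH
  rw [← hqdef] at hR
  have hRne : R ≠ 0 := by rintro rfl; simp at hR; exact hQ0ne hR
  have hRd : R.natDegree = 0 := by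
    rw [hR, hqm.natDegree_mul' hRne, hqd] at hQ0d; omega
  obtain ⟨a, rfl⟩ : ∃ a, R = C a := ⟨_, eq_C_of_natDegree_eq_zero hRd⟩
  have ha : a ≠ 0 := by rintro rfl; simp at hRne
  refine ⟨ψ, fun k => a⁻¹ * d (ψ k), hψ, fun j => ?_⟩
  have h1 := (hcoef j).const_mul a⁻¹
  have h2 : a⁻¹ * Q0.coeff j = q.coeff j := by
    rw [hR, coeff_mul_C]; field_simp
  rw [h2] at h1
  simpa [coeff_C_mul, mul_assoc] using h1

theorem stmt8 (τ : ℝ) (ν : ℕ) (f g : ℂ → ℂ) (α : Fin ν → ℂ)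
    (hτ : 0 < τ)
    (hg : AnalyticOnNhd ℂ g (Metric.ball 0 τ))
    (hα : ∀ i, 0 < ‖α i‖ ∧ ‖α i‖ < τ)
    (hgα : ∀ i, g (α i) ≠ 0)
    (hf : ∀ z ∈ Metric.ball (0 : ℂ) τ, (∀ i, z ≠ α i) →
      f z = g z / ∏ i, (z - α i)) :
    ∃ (P Q : ℕ → Polynomial ℂ) (N : ℕ),
      (∀ n, N ≤ n →
        (P n).natDegree ≤ n ∧ (Q n).natDegree ≤ ν ∧ (Q n).eval 0 = 1 ∧
        (∀ k ≤ n + ν,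
          iteratedDeriv k (fun z => f z - (P n).eval z / (Q n).eval z) 0 = 0) ∧
        (∀ P' Q' : Polynomial ℂ, P'.natDegree ≤ n → Q'.natDegree ≤ ν → Q'.eval 0 ≠ 0 →
          (∀ k ≤ n + ν,
            iteratedDeriv k (fun z => f z - P'.eval z / Q'.eval z) 0 = 0) →
          P' * Q n = P n * Q') ∧
        (Q n).roots.card = ν) ∧
      (∃ β : ℕ → Fin ν → ℂ,
        (∀ n, N ≤ n → (Q n).roots = Multiset.map (β n) Finset.univ.val) ∧
        ∀ i, Tendsto (fun n => β n i) atTop (nhds (α i))) ∧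
      (∀ Kc : Set ℂ, IsCompact Kc →
        Kc ⊆ {z : ℂ | ‖z‖ < τ ∧ ∀ i, z ≠ α i} →
        TendstoUniformlyOn (fun n z => (P n).eval z / (Q n).eval z) f atTop Kc) := by
  have hαb : ∀ i, α i ∈ Metric.ball (0:ℂ) τ := fun i => by simpa using (hα i).2
  obtain ⟨q, hqdef⟩ : ∃ q : ℂ[X], q = ∏ i, (X - C (α i)) := ⟨_, rfl⟩
  have hqd : q.natDegree = ν := by
    rw [hqdef, natDegree_finsetProd_X_sub_C_eq_card]; simp
  have hqm : q.Monic := by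
    rw [hqdef]; exact monic_prod_of_monic _ _ fun i _ => monic_X_sub_C _
  have hqe : ∀ z, q.eval z = ∏ i, (z - α i) := by
    intro z; rw [hqdef, eval_prod]; simp
  have hq0 : q.eval 0 ≠ 0 := by
    rw [hqe]
    refine Finset.prod_ne_zero_iff.2 fun i _ => ?_
    simpa using norm_pos_iff.1 (hα i).1
  have hqν : q.coeff ν = 1 := by rw [← hqd]; exact hqm
  have hsub := fun n hn Q P h0 h => subseq_limit hτ hg α hαb hgα n hn Q P h0 h
  have hkey := fun n hn Q P Q0 h h0 hc => key_limit hτ hg α hαb n hn Q P Q0 h h0 hc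
  rw [← hqdef] at hsub hkey
  set G := taylorPS g with hG
  -- leading coefficient never vanishes for large n
  obtain ⟨N, hN⟩ : ∃ N, ∀ n ≥ N, ∀ Q P, IsSol G q ν n Q P → Q ≠ 0 → Q.coeff ν ≠ 0 := by
    by_contra! hcon
    choose n hn Q P hs hne hz using hcon
    obtain ⟨ψ, c, hψ, hlim⟩ := hsub n (tendsto_atTop_mono hn tendsto_id) Q P hne hs
    have := hlim ν
    simp only [hz, mul_zero, hqν] at this
    exact zero_ne_one (tendsto_nhds_unique tendsto_const_nhds this)
  have hex : ∀ n, ∃ Q P, Q.coeff ν = 1 ∧ IsSol G q ν (max n N) Q P := by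
    intro n
    obtain ⟨Q, P, hne, hs⟩ := exists_sol G q hq0 ν (max n N)
    have := hN _ (le_max_right _ _) Q P hs hne
    refine ⟨_, _, ?_, hs.smul (Q.coeff ν)⁻¹⟩
    rw [coeff_C_mul]; field_simp
  choose Q P hQν hs using hex
  have hQne : ∀ n, Q n ≠ 0 := by
    intro n h0; have := hQν n; simp [h0] at this
  have hQd : ∀ n, (Q n).natDegree = ν := fun n =>
    le_antisymm (hs n).degQ (le_natDegree_of_ne_zero (by simp [hQν n]))
  have hQm : ∀ n, (Q n).Monic := by
    intro n; rw [Monic, leadingCoeff, hQd, hQν]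
  have hmax : Tendsto (fun n => max n N) atTop atTop :=
    tendsto_atTop_mono (fun n => le_max_left n N) tendsto_id
  have hQc : ∀ j, Tendsto (fun n => (Q n).coeff j) atTop (nhds (q.coeff j)) := by
    intro j
    refine tendsto_of_subseq_tendsto fun ns hns => ?_
    obtain ⟨ψ, c, hψ, hlim⟩ := hsub (fun k => max (ns k) N) (hmax.comp hns) (fun k => Q (ns k))
      (fun k => P (ns k)) (fun k => hQne _) (fun k => hs _)
    refine ⟨ψ, ?_⟩
    have hc := hlim ν
    simp only [hQν, mul_one, hqν] at hc
    have h1 := (hlim j).div hc one_ne_zero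
    rw [div_one] at h1
    refine h1.congr' ?_
    filter_upwards [hc.eventually_ne one_ne_zero] with k hk
    simp only [Pi.div_apply]
    field_simp
  have hQ0t := eval_tendsto ν Q q (fun n => (hQd n).le) hqd.le hQc 0
  obtain ⟨N1, hN1⟩ := eventually_atTop.1 (hQ0t.eventually_ne hq0)
  obtain ⟨H, hHc, hHu, hH⟩ := hkey _ hmax Q P q hs hqd.le hQc
  obtain ⟨β, hβ1, hβ2⟩ := roots_tendsto ν Q α hQm hQd (by rw [← hqdef]; exact hQc)
  have hroots : ∀ n, N1 ≤ n → (C ((Q n).eval 0)⁻¹ * Q n).roots = (Q n).roots := by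
    intro n hn
    exact roots_C_mul _ (inv_ne_zero (hN1 n hn))
  have hfg : ∀ᶠ z in nhds 0, f z = g z / q.eval z := by
    filter_upwards [Metric.ball_mem_nhds (0:ℂ) hτ, q.continuous.continuousAt.eventually_ne hq0] with z hz hz2
    rw [hqe] at hz2 ⊢
    exact hf z hz fun i => sub_ne_zero.1 (Finset.prod_ne_zero_iff.1 hz2 i (Finset.mem_univ i))
  have hg0 : AnalyticAt ℂ g 0 := hg 0 (by simpa using hτ)
  refine ⟨fun n => C ((Q n).eval 0)⁻¹ * P n, fun n => C ((Q n).eval 0)⁻¹ * Q n, max N N1,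
    ?_, ⟨β, ?_, hβ2⟩, ?_⟩
  · intro n hn
    have hnN : N ≤ n := (le_max_left _ _).trans hn
    have hnN1 : N1 ≤ n := (le_max_right _ _).trans hn
    have hs0 := hs n
    rw [max_eq_left hnN] at hs0
    have hs' := hs0.smul ((Q n).eval 0)⁻¹
    have he : (C ((Q n).eval 0)⁻¹ * Q n).eval 0 = 1 := by
      rw [eval_mul, eval_C, inv_mul_cancel₀ (hN1 n hnN1)]
    refine ⟨hs'.degP, hs'.degQ, he, ?_, ?_, ?_⟩
    · exact (pade_iff q _ _ hg0 hfg hq0 (by rw [he]; exact one_ne_zero) _).2 hs'.eqn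
    · intro P' Q' hP' hQ' hQ'0 hk
      have hs2 : IsSol G q ν n Q' P' := ⟨hP', hQ', (pade_iff q _ _ hg0 hfg hq0 hQ'0 _).1 hk⟩
      have hs3 := hs2.sub (hs0.smul (Q'.coeff ν))
      have hz : Q' - C (Q'.coeff ν) * Q n = 0 := by
        by_contra hne
        exact hN n hnN _ _ hs3 hne (by simp [coeff_C_mul, hQν])
      have hQQ : Q' = C (Q'.coeff ν) * Q n := sub_eq_zero.1 hz
      have hPP : P' = C (Q'.coeff ν) * P n := by
        refine IsSol.unique (Q := Q') hs2 ?_ hqd.le hqm.ne_zero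
        have := hs0.smul (Q'.coeff ν)
        rwa [← hQQ] at this
      generalize Q'.coeff ν = c at hQQ hPP
      rw [hQQ, hPP]; ring
    · rw [hroots n hnN1, hβ1 n]; simp
  · intro n hn
    rw [hroots n ((le_max_right _ _).trans hn), hβ1 n]
  · intro K hK hKs
    have hKb : K ⊆ Metric.ball 0 τ := fun z hz => by simpa using (hKs hz).1
    have hqK : ∀ z ∈ K, q.eval z ≠ 0 := by
      intro z hz
      rw [hqe]
      exact Finset.prod_ne_zero_iff.2 fun i _ => sub_ne_zero.2 ((hKs hz).2 i)
    have hd := (hHu.mono hKb).fun_div₀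
      (poly_unif ν Q q (fun n => (hQd n).le) hqd.le hQc K) (hHc.mono hKb)
      q.continuous.continuousOn hqK
    rw [tendstoLocallyUniformlyOn_iff_tendstoUniformlyOn_of_compact hK] at hd
    refine (hd.congr_right ?_).congr ?_
    · intro z hz
      have h1 := mul_left_cancel₀ (hqK z hz) (hH z (hKb hz))
      simp only
      rw [h1, hqe, hf z (hKb hz) (hKs hz).2]
    · filter_upwards [eventually_ge_atTop N1] with n hn z hz
      have := inv_ne_zero (hN1 n hn)
      simp only [eval_mul, eval_C]
      rw [mul_div_mul_left _ _ this]
end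

section
/- Let f be analytic at 0, meromorphic in |z| < τ with exactly ν poles α_1,...,α_ν (with multiplicity) satisfying 0 < |α_1| ≤ ... ≤ |α_ν| < τ. Let q(z) = Π_{j=1}^ν (1 − z/α_j). Then the denominators Q_n (normalized with Q_n(0) = 1) of the Padé approximants [n/ν] of f converge, coefficientwise, to q as n → ∞. -/
open Filter Polynomial

lemma aux_pow_dvd (N : ℕ) : ∀ R : ℂ[X],
    (fun z : ℂ => R.eval z) =O[nhdsWithin 0 {0}ᶜ] (fun z : ℂ => z ^ N) → X ^ N ∣ R := by
  induction N with
  | zero => intro R _; simp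
  | succ N ih =>
    intro R h
    have h0 : R.eval 0 = 0 := by
      have t1 : Tendsto (fun z : ℂ => z ^ (N+1)) (nhdsWithin 0 {0}ᶜ) (nhds 0) := by
        have : ContinuousAt (fun z : ℂ => z ^ (N+1)) 0 := by fun_prop
        have := this.tendsto
        simp only [ne_eq, Nat.add_eq_zero_iff, one_ne_zero, and_false, not_false_eq_true, zero_pow] at this
        exact this.mono_left nhdsWithin_le_nhds
      have t2 := h.trans_tendsto t1
      have t3 : Tendsto (fun z : ℂ => R.eval z) (nhdsWithin 0 {0}ᶜ) (nhds (R.eval 0)) :=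
        (R.continuous.tendsto 0).mono_left nhdsWithin_le_nhds
      exact tendsto_nhds_unique t3 t2
    obtain ⟨S, rfl⟩ : X ∣ R := by
      rw [X_dvd_iff, coeff_zero_eq_eval_zero, h0]
    rw [pow_succ', mul_dvd_mul_iff_left X_ne_zero]
    apply ih
    have := (Asymptotics.isBigO_refl (fun z : ℂ => z⁻¹) (nhdsWithin 0 {0}ᶜ)).mul h
    refine this.congr' ?_ ?_
    · filter_upwards [self_mem_nhdsWithin] with z hz
      have : z ≠ 0 := hz
      simp [this]
    · filter_upwards [self_mem_nhdsWithin] with z hz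
      have : z ≠ 0 := hz
      rw [pow_succ', inv_mul_cancel_left₀ this]

lemma aux_identity (τ : ℝ) (ν : ℕ) (f g : ℂ → ℂ) (α : Fin ν → ℂ)
    (hτ : 0 < τ)
    (hα : ∀ i, 0 < ‖α i‖ ∧ ‖α i‖ < τ)
    (hf : ∀ z ∈ Metric.ball (0 : ℂ) τ, (∀ i, z ≠ α i) →
      f z = g z / ∏ i, (z - α i))
    (G : ℕ → ℂ[X]) (hGd : ∀ m, (G (m+1)).natDegree ≤ m) (hga : AnalyticAt ℂ g 0)
    (hG : ∀ m, (fun z => g z - (G m).eval z) =O[nhds 0] (fun z => z ^ m))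
    (n : ℕ) (P Q : ℂ[X]) (hP : P.natDegree ≤ n) (hQ : Q.natDegree ≤ ν)
    (hQ0 : Q.eval 0 = 1)
    (hmatch : ∀ k ≤ n + ν,
      iteratedDeriv k (fun z => f z - P.eval z / Q.eval z) 0 = 0) :
    P * ∏ i, (X - C (α i)) =
      ∑ j ∈ Finset.range (ν+1), C (Q.coeff j) * X ^ j * G (n + ν - j + 1) := by
  set D : ℂ[X] := ∏ i, (X - C (α i)) with hD
  have hDe : ∀ z, D.eval z = ∏ i, (z - α i) := by intro z; simp [hD, eval_prod]
  have hD0 : D.eval 0 ≠ 0 := by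
    rw [hDe, Finset.prod_ne_zero_iff]
    intro i _
    have := norm_pos_iff.1 (hα i).1
    simpa using this
  have evD : ∀ᶠ z in nhds (0:ℂ), D.eval z ≠ 0 := D.continuous.continuousAt.eventually_ne hD0
  have evQ : ∀ᶠ z in nhds (0:ℂ), Q.eval z ≠ 0 :=
    Q.continuous.continuousAt.eventually_ne (by rw [hQ0]; exact one_ne_zero)
  have evf : f =ᶠ[nhds 0] fun z => g z / D.eval z := by
    filter_upwards [evD, Metric.ball_mem_nhds (0:ℂ) hτ] with z hz hb
    rw [hDe]
    apply hf z hb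
    intro i hi
    apply hz
    rw [hDe]
    exact Finset.prod_eq_zero (Finset.mem_univ i) (by simp [hi])
  have polyan : ∀ (p : ℂ[X]), AnalyticAt ℂ (fun z => p.eval z) 0 := fun p => by
    exact p.differentiable.analyticAt 0
  have hφ : AnalyticAt ℂ (fun z => f z - P.eval z / Q.eval z) 0 := by
    refine AnalyticAt.sub ?_ ((polyan P).div (polyan Q) (by rw [hQ0]; exact one_ne_zero))
    exact (hga.div (polyan D) hD0).congr evf.symm
  have hO : (fun z => f z - P.eval z / Q.eval z) =O[nhds 0] (fun z : ℂ => z ^ (n + ν + 1)) := by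
    have h1 := (natCast_le_analyticOrderAt_iff_iteratedDeriv_eq_zero (n := n + ν + 1) hφ).2
      (fun i hi => hmatch i (by omega))
    obtain ⟨u, hu, hue⟩ := (natCast_le_analyticOrderAt hφ).1 h1
    have hu1 : u =O[nhds 0] (fun _ => (1:ℂ)) := hu.continuousAt.tendsto.isBigO_one ℂ
    have := (Asymptotics.isBigO_refl (fun z : ℂ => z ^ (n+ν+1)) (nhds 0)).mul hu1
    refine this.congr' ?_ ?_
    · filter_upwards [hue] with z hz
      rw [hz]; simp
    · simp
  have hO2 : (fun z => Q.eval z * g z - (P * D).eval z) =O[nhds 0]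
      (fun z : ℂ => z ^ (n + ν + 1)) := by
    have hu1 : (fun z => (Q * D).eval z) =O[nhds 0] (fun _ => (1:ℂ)) :=
      (Q*D).continuous.continuousAt.tendsto.isBigO_one ℂ
    refine (hu1.mul hO).congr' ?_ ?_
    · filter_upwards [evf, evD, evQ] with z h1 h2 h3
      rw [h1]
      simp only [eval_mul]
      field_simp
    · simp
  have hO3 : (fun z => Q.eval z * g z -
      (∑ j ∈ Finset.range (ν+1), C (Q.coeff j) * X ^ j * G (n + ν - j + 1)).eval z) =O[nhds 0]
      (fun z : ℂ => z ^ (n + ν + 1)) := by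
    have : ∀ j ∈ Finset.range (ν+1),
        (fun z => Q.coeff j * (z ^ j * (g z - (G (n + ν - j + 1)).eval z))) =O[nhds 0]
        (fun z : ℂ => z ^ (n + ν + 1)) := by
      intro j hj
      refine Asymptotics.IsBigO.const_mul_left ?_ _
      refine ((Asymptotics.isBigO_refl (fun z : ℂ => z ^ j) (nhds 0)).mul (hG _)).congr_right ?_
      intro z
      rw [← pow_add]
      congr 1
      have := Finset.mem_range.1 hj
      omega
    refine (Asymptotics.IsBigO.sum this).congr_left ?_
    intro z
    rw [Finset.sum_apply, eval_eq_sum_range' (Nat.lt_succ_of_le hQ), Finset.sum_mul, eval_finsetSum,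
      ← Finset.sum_sub_distrib]
    refine Finset.sum_congr rfl fun j _ => ?_
    simp only [eval_mul, eval_C, eval_pow, eval_X]
    ring
  rw [← sub_eq_zero]
  set R := P * D - ∑ j ∈ Finset.range (ν+1), C (Q.coeff j) * X ^ j * G (n + ν - j + 1) with hR
  have hdvd : X ^ (n+ν+1) ∣ R := by
    apply aux_pow_dvd
    refine ((hO3.sub hO2).congr_left ?_).mono nhdsWithin_le_nhds
    intro z
    simp only [hR, eval_sub]
    ring
  apply eq_zero_of_dvd_of_natDegree_lt hdvd
  rw [natDegree_X_pow]
  apply Nat.lt_succ_of_le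
  refine (natDegree_sub_le _ _).trans (max_le ?_ ?_)
  · refine natDegree_mul_le_of_le hP ?_
    rw [hD, natDegree_prod_of_monic _ _ (fun i _ => monic_X_sub_C _)]
    simp
  · refine natDegree_sum_le_of_forall_le _ _ fun j hj => ?_
    have hj' := Finset.mem_range.1 hj
    have h1 : (C (Q.coeff j) * X ^ j).natDegree ≤ j := natDegree_C_mul_X_pow_le _ _
    refine (natDegree_mul_le_of_le h1 (hGd _)).trans ?_
    omega

lemma aux_divides (r : ℝ) (g : ℂ → ℂ) (hg : ContinuousOn g (Metric.ball 0 r)) {ι : Type*}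
    (α : ι → ℂ) (hα : ∀ i, ‖α i‖ < r) (hgα : ∀ i, g (α i) ≠ 0)
    (h : ℂ → ℂ) (hh : ContinuousOn h (Metric.ball 0 r)) (s : Finset ι) : ∀ Q : ℂ[X],
    (∀ z ∈ Metric.ball (0:ℂ) r, (∏ i ∈ s, (z - α i)) * h z = Q.eval z * g z) →
    (∏ i ∈ s, (X - C (α i))) ∣ Q := by
  classical
  induction s using Finset.induction_on with
  | empty => intro Q _; simp
  | insert a s ha ih =>
    intro Q hQ
    have ham : α a ∈ Metric.ball (0:ℂ) r := by simpa using hα a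
    have h0 : Q.eval (α a) = 0 := by
      have := hQ _ ham
      rw [Finset.prod_insert ha] at this
      simp only [sub_self, zero_mul] at this
      exact (mul_eq_zero.1 this.symm).resolve_right (hgα a)
    obtain ⟨S, rfl⟩ := dvd_iff_isRoot.2 h0
    rw [Finset.prod_insert ha]
    refine mul_dvd_mul_left _ (ih S ?_)
    have hne : ∀ z ∈ Metric.ball (0:ℂ) r, z ≠ α a →
        (∏ i ∈ s, (z - α i)) * h z = S.eval z * g z := by
      intro z hz hza
      have := hQ z hz
      rw [Finset.prod_insert ha] at this
      simp only [eval_mul, eval_sub, eval_X, eval_C] at this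
      apply mul_left_cancel₀ (sub_ne_zero.2 hza)
      linear_combination this
    intro z hz
    by_cases hza : z = α a
    · have hzn : Metric.ball (0:ℂ) r ∈ nhds z := Metric.isOpen_ball.mem_nhds hz
      have c1 : ContinuousAt (fun z => (∏ i ∈ s, (z - α i)) * h z) z :=
        ContinuousAt.mul (by fun_prop) (hh.continuousAt hzn)
      have c2 : ContinuousAt (fun z => S.eval z * g z) z :=
        S.continuous.continuousAt.mul (hg.continuousAt hzn)
      have e : (fun z => (∏ i ∈ s, (z - α i)) * h z) =ᶠ[nhdsWithin z {z}ᶜ]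
          (fun z => S.eval z * g z) := by
        filter_upwards [self_mem_nhdsWithin, mem_nhdsWithin_of_mem_nhds hzn] with w hw hwb
        exact hne w hwb (by rw [← hza]; exact hw)
      exact tendsto_nhds_unique_of_eventuallyEq
        (c1.tendsto.mono_left nhdsWithin_le_nhds) (c2.tendsto.mono_left nhdsWithin_le_nhds) e
    · exact hne z hz hza

lemma aux_taylor (τ r : ℝ) (hr : 0 < r) (hrτ : r < τ) (g : ℂ → ℂ)
    (hg : AnalyticOnNhd ℂ g (Metric.ball 0 τ)) :
    ∃ G : ℕ → ℂ[X], (∀ m, (G (m+1)).natDegree ≤ m) ∧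
      (∀ m, (fun z => g z - (G m).eval z) =O[nhds 0] (fun z => z ^ m)) ∧
      TendstoUniformlyOn (fun n z => (G n).eval z) g atTop (Metric.closedBall 0 r) := by
  obtain ⟨R, hrR, hRτ⟩ := exists_between hrτ
  obtain ⟨R', hrR', hRR'⟩ := exists_between hrR
  lift R to NNReal using (by linarith)
  lift R' to NNReal using (by linarith)
  have hp : HasFPowerSeriesOnBall g (cauchyPowerSeries g 0 R) 0 R := by
    apply DifferentiableOn.hasFPowerSeriesOnBall
    · intro z hz
      refine (hg z ?_).differentiableAt.differentiableWithinAt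
      simp only [Metric.mem_closedBall, Metric.mem_ball] at *
      linarith
    · exact_mod_cast hr.trans hrR
  set p := cauchyPowerSeries g 0 R
  have hG : ∀ n z, (∑ k ∈ Finset.range n, C (p.coeff k) * X ^ k).eval z = p.partialSum n z := by
    intro n z
    rw [eval_finsetSum, FormalMultilinearSeries.partialSum]
    refine Finset.sum_congr rfl fun k _ => ?_
    rw [FormalMultilinearSeries.apply_eq_pow_smul_coeff]
    rw [eval_mul, eval_C, eval_pow, eval_X, smul_eq_mul, mul_comm]
  refine ⟨fun n => ∑ k ∈ Finset.range n, C (p.coeff k) * X ^ k, ?_, ?_, ?_⟩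
  · intro m
    refine natDegree_sum_le_of_forall_le _ _ fun j hj => ?_
    have hj' := Finset.mem_range.1 hj
    exact (natDegree_C_mul_X_pow_le _ _).trans (by omega)
  · intro m
    simp only [hG]
    have := hp.hasFPowerSeriesAt.isBigO_sub_partialSum_pow m
    simp only [zero_add] at this
    refine Asymptotics.IsBigO.of_norm_right ?_
    simpa using this
  · simp only [hG]
    have := hp.tendstoUniformlyOn (r' := R') (by exact_mod_cast hRR')
    simp only [zero_add] at this
    exact this.mono (Metric.closedBall_subset_ball hrR')

lemma aux_limit (r : ℝ) (hr : 0 < r) (ν : ℕ) (g : ℂ → ℂ) (hg : ContinuousOn g (Metric.closedBall 0 r))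
    (α : Fin ν → ℂ) (hα : ∀ i, ‖α i‖ < r) (hgα : ∀ i, g (α i) ≠ 0)
    (G : ℕ → ℂ[X])
    (hG : TendstoUniformlyOn (fun n z => (G n).eval z) g atTop (Metric.closedBall 0 r))
    (w : ℕ → Fin (ν+1) → ℂ) (w' : Fin (ν+1) → ℂ) (hw : Tendsto w atTop (nhds w'))
    (P : ℕ → ℂ[X]) (N : ℕ → Fin (ν+1) → ℕ) (hN : ∀ j, Tendsto (fun n => N n j) atTop atTop)
    (hP : ∀ n, P n * ∏ i, (X - C (α i)) = ∑ j : Fin (ν+1), C (w n j) * X ^ (j:ℕ) * G (N n j)) :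
    ∏ i, (X - C (α i)) ∣ ∑ j : Fin (ν+1), C (w' j) * X ^ (j:ℕ) := by
  set K := Metric.closedBall (0:ℂ) r with hK
  set D : ℂ[X] := ∏ i, (X - C (α i)) with hD
  have hDe : ∀ z, D.eval z = ∏ i, (z - α i) := by intro z; simp [hD, eval_prod]
  let gK : C(K, ℂ) := ⟨K.domRestrict g, continuousOn_iff_continuous_domRestrict.1 hg⟩
  let T : ℂ[X] → C(K, ℂ) := fun p => p.toContinuousMapOn K
  have hGT : Tendsto (fun n => T (G n)) atTop (nhds gK) := by
    rw [ContinuousMap.tendsto_iff_tendstoUniformly]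
    exact tendstoUniformlyOn_iff_tendstoUniformly_comp_coe.1 hG
  set Q' : ℂ[X] := ∑ j : Fin (ν+1), C (w' j) * X ^ (j:ℕ) with hQ'
  have hS : Tendsto (fun n => T (P n * D)) atTop (nhds (T Q' * gK)) := by
    have h1 : Tendsto (fun n => ∑ j : Fin (ν+1), w n j • (T (X ^ (j:ℕ)) * T (G (N n j)))) atTop
        (nhds (∑ j : Fin (ν+1), w' j • (T (X ^ (j:ℕ)) * gK))) := by
      refine tendsto_finsetSum _ fun j _ => ?_
      refine ((tendsto_pi_nhds.1 hw) j).smul ?_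
      exact tendsto_const_nhds.mul (hGT.comp (hN j))
    convert h1 using 1
    · funext n
      rw [hP]
      ext z
      simp [T, eval_finsetSum, mul_assoc]
    · congr 1
      ext z
      simp [T, hQ', eval_finsetSum, Finset.sum_mul, mul_assoc]
  obtain ⟨δ, hδ, hδD⟩ : ∃ δ > 0, ∀ z ∈ Metric.sphere (0:ℂ) r, δ ≤ ‖D.eval z‖ := by
    have hne : (Metric.sphere (0:ℂ) r).Nonempty := NormedSpace.sphere_nonempty.2 hr.le
    obtain ⟨z, hz, hm⟩ := (isCompact_sphere (0:ℂ) r).exists_isMinOn hne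
      (f := fun z => ‖D.eval z‖) (D.continuous.norm.continuousOn)
    refine ⟨‖D.eval z‖, ?_, fun y hy => hm hy⟩
    rw [gt_iff_lt, norm_pos_iff, hDe, Finset.prod_ne_zero_iff]
    intro i _ h0
    have := hα i
    rw [← sub_eq_zero.1 h0] at this
    simp at hz
    linarith
  have hcomp : ∀ p : ℂ[X], ‖T p‖ ≤ δ⁻¹ * ‖T (p * D)‖ := by
    intro p
    have h0 : 0 ≤ δ⁻¹ * ‖T (p * D)‖ := by positivity
    rw [ContinuousMap.norm_le _ h0]
    rintro ⟨z, hz⟩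
    change ‖p.eval z‖ ≤ _
    refine Complex.norm_le_of_forall_mem_frontier_norm_le (f := fun z => p.eval z)
      (U := Metric.ball 0 r) Metric.isBounded_ball p.differentiable.diffContOnCl ?_ ?_
    · intro y hy
      rw [frontier_ball _ hr.ne'] at hy
      have hyK : y ∈ K := Metric.sphere_subset_closedBall hy
      have h2 := (T (p * D)).norm_coe_le_norm ⟨y, hyK⟩
      change ‖(p * D).eval y‖ ≤ _ at h2
      rw [eval_mul, norm_mul] at h2
      rw [le_inv_mul_iff₀ hδ]
      have := mul_le_mul_of_nonneg_right (hδD y hy) (norm_nonneg (p.eval y))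
      linarith
    · rw [closure_ball _ hr.ne']; exact hz
  have hTsub : ∀ p q, T (p - q) = T p - T q := by intro p q; ext z; simp [T]
  have hTmul : ∀ p q, T (p * q) = T p * T q := by intro p q; ext z; simp [T]
  have hC : CauchySeq (fun n => T (P n)) := by
    have := hS.cauchySeq
    rw [Metric.cauchySeq_iff] at this ⊢
    intro ε hε
    obtain ⟨M, hM⟩ := this (δ * ε) (by positivity)
    refine ⟨M, fun m hm n hn => ?_⟩
    have h1 := hM m hm n hn
    rw [dist_eq_norm, ← hTsub] at h1 ⊢
    rw [← sub_mul] at h1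
    refine (hcomp _).trans_lt ?_
    rwa [inv_mul_lt_iff₀ hδ]
  obtain ⟨h, hh⟩ := cauchySeq_tendsto_of_complete hC
  have hlim : h * T D = T Q' * gK := by
    refine tendsto_nhds_unique ?_ hS
    simp only [hTmul]
    exact hh.mul_const _
  let h' : ℂ → ℂ := fun z => Function.extend (Subtype.val : K → ℂ) h 0 z
  have hh' : ∀ z : K, h' z = h z := fun z => Subtype.val_injective.extend_apply _ _ _
  have hcont : ContinuousOn h' K := by
    rw [continuousOn_iff_continuous_domRestrict]
    refine h.continuous.congr ?_
    intro z
    exact (hh' z).symm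
  refine aux_divides r g (hg.mono Metric.ball_subset_closedBall) α hα hgα h'
    (hcont.mono Metric.ball_subset_closedBall) Finset.univ Q' ?_
  intro z hz
  have hzK : z ∈ K := Metric.ball_subset_closedBall hz
  have := congrArg (fun u : C(K, ℂ) => u ⟨z, hzK⟩) hlim
  change h ⟨z, hzK⟩ * D.eval z = Q'.eval z * g z at this
  rw [← hDe, ← this, ← hh' ⟨z, hzK⟩, mul_comm]

/-- The denominators of the row sequence `[n/ν]` of Padé approximants of a meromorphic
function converge coefficientwise to `q(z) = ∏ (1 - z/α_j)`. -/
theorem stmt9 (τ : ℝ) (ν : ℕ) (f g : ℂ → ℂ) (α : Fin ν → ℂ)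
    (hτ : 0 < τ)
    (hg : AnalyticOnNhd ℂ g (Metric.ball 0 τ))
    (hα : ∀ i, 0 < ‖α i‖ ∧ ‖α i‖ < τ)
    (hgα : ∀ i, g (α i) ≠ 0)
    (hf : ∀ z ∈ Metric.ball (0 : ℂ) τ, (∀ i, z ≠ α i) →
      f z = g z / ∏ i, (z - α i))
    (P Q : ℕ → Polynomial ℂ)
    (hP : ∀ n, (P n).natDegree ≤ n) (hQ : ∀ n, (Q n).natDegree ≤ ν)
    (hQ0 : ∀ n, (Q n).eval 0 = 1)
    (hmatch : ∀ n, ∀ k ≤ n + ν,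
      iteratedDeriv k (fun z => f z - (P n).eval z / (Q n).eval z) 0 = 0) :
    ∀ k : ℕ, Tendsto (fun n => (Q n).coeff k) atTop
      (nhds ((∏ i, (1 - Polynomial.C (α i)⁻¹ * Polynomial.X)).coeff k)) := by
  obtain ⟨r, hr, hrτ, hαr⟩ : ∃ r, 0 < r ∧ r < τ ∧ ∀ i, ‖α i‖ < r := by
    have h1 : ∀ᶠ r in nhdsWithin τ (Set.Iio τ), ∀ i, ‖α i‖ < r := by
      rw [eventually_all]
      intro i
      exact nhdsWithin_le_nhds (lt_mem_nhds (hα i).2)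
    have h2 : ∀ᶠ r in nhdsWithin τ (Set.Iio τ), 0 < r := nhdsWithin_le_nhds (lt_mem_nhds hτ)
    have h3 : ∀ᶠ r in nhdsWithin τ (Set.Iio τ), r < τ := self_mem_nhdsWithin
    obtain ⟨r, a, b, c⟩ := (h1.and (h2.and h3)).exists
    exact ⟨r, b, c, a⟩
  obtain ⟨G, hGd, hGO, hGu⟩ := aux_taylor τ r hr hrτ g hg
  set D : ℂ[X] := ∏ i, (X - C (α i)) with hD
  set q : ℂ[X] := ∏ i, (1 - C (α i)⁻¹ * X) with hq
  have hα0 : ∀ i, α i ≠ 0 := fun i => norm_pos_iff.1 (hα i).1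
  have hDq : D = C (∏ i, (-α i)) * q := by
    rw [hD, hq, map_prod, ← Finset.prod_mul_distrib]
    refine Finset.prod_congr rfl fun i _ => ?_
    rw [mul_sub, ← mul_assoc, ← C_mul, neg_mul, mul_inv_cancel₀ (hα0 i)]
    simp
    ring
  have hd0 : (∏ i, (-α i)) ≠ 0 := Finset.prod_ne_zero_iff.2 fun i _ => neg_ne_zero.2 (hα0 i)
  have hDdeg : D.natDegree = ν := by
    rw [hD, natDegree_prod_of_monic _ _ (fun i _ => monic_X_sub_C _)]
    simp
  have hDne : D ≠ 0 := (monic_prod_of_monic _ _ (fun i _ => monic_X_sub_C _)).ne_zero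
  have hqdeg : q.natDegree = ν := by
    rw [← hDdeg, hDq, natDegree_C_mul hd0]
  have hq0 : q.coeff 0 = 1 := by
    rw [coeff_zero_eq_eval_zero, hq, eval_prod]; simp
  have hid : ∀ n, P n * D =
      ∑ j ∈ Finset.range (ν+1), C ((Q n).coeff j) * X ^ j * G (n + ν - j + 1) := fun n =>
    aux_identity τ ν f g α hτ hα hf G hGd (hg 0 (Metric.mem_ball_self hτ)) hGO n (P n) (Q n)
      (hP n) (hQ n) (hQ0 n) (hmatch n)
  let v : ℕ → Fin (ν+1) → ℂ := fun n j => (Q n).coeff j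
  have hv0 : ∀ n, v n 0 = 1 := by
    intro n
    simp only [v, Fin.val_zero, coeff_zero_eq_eval_zero, hQ0]
  have hvne : ∀ n, v n ≠ 0 := by
    intro n h
    have := hv0 n
    rw [h] at this
    simp at this
  suffices hv : Tendsto v atTop (nhds fun j => q.coeff j) by
    intro k
    rcases Nat.lt_or_ge k (ν+1) with hk | hk
    · exact (tendsto_pi_nhds.1 hv) ⟨k, hk⟩
    · have e1 : q.coeff k = 0 := coeff_eq_zero_of_natDegree_lt (by omega)
      have e2 : ∀ n, (Q n).coeff k = 0 := fun n =>
        coeff_eq_zero_of_natDegree_lt (by have := hQ n; omega)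
      simp only [e1, e2]
      exact tendsto_const_nhds
  let w : ℕ → Fin (ν+1) → ℂ := fun n => ((‖v n‖ : ℂ)⁻¹) • v n
  have hwn : ∀ n, w n ∈ Metric.sphere (0 : Fin (ν+1) → ℂ) 1 := by
    intro n
    have : ‖v n‖ ≠ 0 := norm_ne_zero_iff.2 (hvne n)
    simp [w, norm_smul, this]
  have hvw : ∀ n, v n = (w n 0)⁻¹ • w n := by
    intro n
    have : (‖v n‖ : ℂ) ≠ 0 := by exact_mod_cast norm_ne_zero_iff.2 (hvne n)
    simp only [w, Pi.smul_apply, hv0, smul_eq_mul, mul_one, inv_inv, smul_smul]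
    rw [mul_inv_cancel₀ this, one_smul]
  apply tendsto_of_subseq_tendsto
  intro ns hns
  obtain ⟨w', hwls, φ, hφ, hlim⟩ := (isCompact_sphere (0 : Fin (ν+1) → ℂ) 1).tendsto_subseq
    (x := fun n => w (ns n)) (fun n => hwn _)
  refine ⟨φ, ?_⟩
  have hσ : Tendsto (fun n => ns (φ n)) atTop atTop := hns.comp hφ.tendsto_atTop
  have hdvd := aux_limit r hr ν g (fun z hz => (hg z (Metric.closedBall_subset_ball hrτ hz)).continuousAt.continuousWithinAt)
    α hαr hgα G hGu (fun n => w (ns (φ n))) w' hlim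
    (fun n => C ((‖v (ns (φ n))‖ : ℂ)⁻¹) * P (ns (φ n)))
    (fun n j => ns (φ n) + ν - j + 1)
    (fun j => by
      refine tendsto_atTop_mono (fun n => ?_) hσ
      have := j.2
      omega)
    (fun n => by
      rw [mul_assoc, hid, Finset.sum_range, Finset.mul_sum]
      refine Finset.sum_congr rfl fun j _ => ?_
      simp only [w, v, Pi.smul_apply, smul_eq_mul, C_mul]
      ring)
  set Q' : ℂ[X] := ∑ j : Fin (ν+1), C (w' j) * X ^ (j:ℕ) with hQ'
  have hQlc : ∀ j : Fin (ν+1), Q'.coeff j = w' j := by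
    intro j
    rw [hQ', finsetSum_coeff]
    simp only [coeff_C_mul, coeff_X_pow, Fin.val_inj]
    simp
  have hQldeg : Q'.natDegree ≤ ν := by
    refine natDegree_sum_le_of_forall_le _ _ fun j _ => ?_
    exact (natDegree_C_mul_X_pow_le _ _).trans (by omega)
  obtain ⟨c, hc⟩ : ∃ c : ℂ, Q' = C c * q := by
    obtain ⟨e, he⟩ := hdvd
    have hed : e.natDegree = 0 := by
      by_cases he0 : e = 0
      · simp [he0]
      have := natDegree_mul hDne he0
      rw [← he, hDdeg] at this
      omega
    rw [eq_C_of_natDegree_eq_zero hed] at he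
    refine ⟨e.coeff 0 * ∏ i, (-α i), ?_⟩
    rw [he]
    change D * _ = _
    rw [hDq, C_mul]
    ring
  have hwlc : ∀ j : Fin (ν+1), w' j = c * q.coeff j := by
    intro j
    rw [← hQlc, hc, coeff_C_mul]
  have hc0 : c ≠ 0 := by
    rintro rfl
    have : w' = 0 := by funext j; simp [hwlc]
    rw [this] at hwls
    simp at hwls
  have hwl0 : w' 0 = c := by rw [hwlc]; simp [hq0]
  have hfin : (fun j : Fin (ν+1) => q.coeff j) = (w' 0)⁻¹ • w' := by
    funext j
    rw [Pi.smul_apply, hwl0, hwlc, smul_eq_mul, inv_mul_cancel_left₀ hc0]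
  rw [hfin]
  simp only [hvw]
  have h0 : Tendsto (fun n => w (ns (φ n)) 0) atTop (nhds (w' 0)) := (tendsto_pi_nhds.1 hlim) 0
  exact (h0.inv₀ (by rw [hwl0]; exact hc0)).smul hlim
end

section
/- (Fabry ratio theorem) Let f(z) = Σ a_n z^n be a power series with radius of convergence R ∈ (0, ∞). If the ratio a_n/a_{n+1} converges to a complex number x_0 (in particular a_{n+1} ≠ 0 for large n), then |x_0| = R and the point x_0 is a singular point of f, i.e. f admits no analytic continuation to any neighborhood of x_0. -/
open Filter

lemma fab_inner {𝕜 : Type*} [NormedField 𝕜] (c x : 𝕜) (k : ℕ) :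
    HasSum (fun i : ℕ => c * (k.choose i : 𝕜) * x ^ (k + i)) (c * (x + x ^ 2) ^ k) := by
  have h : c * (x + x ^ 2) ^ k
      = ∑ i ∈ Finset.range (k + 1), c * (k.choose i : 𝕜) * x ^ (k + i) := by
    have : x + x ^ 2 = x * (x + 1) := by ring
    rw [this, mul_pow, add_pow, Finset.mul_sum, Finset.mul_sum]
    refine Finset.sum_congr rfl fun i _ => ?_
    rw [pow_add]; simp; ring
  rw [h]
  apply hasSum_sum_of_ne_finset_zero
  intro i hi
  rw [Nat.choose_eq_zero_of_lt (by simpa using hi)]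
  simp

lemma fab_expand (b : ℕ → ℂ)
    (hb : ∀ r : ℝ, 0 ≤ r → r < 1 → Summable fun n => ‖b n‖ * r ^ n)
    (w : ℂ) (hw : ‖w‖ < 1) :
    HasSum (fun j : ℕ => w ^ j * ∑ k ∈ Finset.range (j + 1),
        b k * ((k.choose (j - k) : ℂ) / 2 ^ k))
      (∑' k, b k * ((w + w ^ 2) / 2) ^ k) := by
  set F : ℕ × ℕ → ℂ := fun p => b p.1 / 2 ^ p.1 * (p.1.choose p.2 : ℂ) * w ^ (p.1 + p.2) with hF
  have hn : ∀ p : ℕ × ℕ, ‖F p‖ = ‖b p.1‖ / 2 ^ p.1 * (p.1.choose p.2 : ℝ) * ‖w‖ ^ (p.1 + p.2) := by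
    intro p; simp [hF]
  have h0 : 0 ≤ ‖w‖ := norm_nonneg w
  have hS : Summable F := by
    apply Summable.of_norm
    rw [summable_prod_of_nonneg (fun _ => norm_nonneg _)]
    simp only [hn]
    refine ⟨fun k => (fab_inner _ _ k).summable, ?_⟩
    simp only [fun k => (fab_inner (‖b k‖ / 2 ^ k) ‖w‖ k).tsum_eq]
    convert hb ((‖w‖ + ‖w‖ ^ 2) / 2) (by positivity) (by nlinarith) using 2 with k
    rw [div_pow]; ring
  have h1 : HasSum F (∑' k, b k * ((w + w ^ 2) / 2) ^ k) := by
    have := hS.hasSum.prod_fiberwise (fun k => fab_inner (b k / 2 ^ k) w k)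
    have e : ∑' k, b k * ((w + w ^ 2) / 2) ^ k = ∑' p, F p := by
      rw [← this.tsum_eq]
      refine tsum_congr fun k => ?_
      rw [div_pow]; ring
    rw [e]; exact hS.hasSum
  have h2 := (Finset.HasAntidiagonal.sigmaAntidiagonalEquivProd (A := ℕ)).hasSum_iff.mpr h1
  have h3 := h2.sigma (fun j => hasSum_fintype _)
  convert h3 using 2 with j
  rw [← Finset.Nat.sum_antidiagonal_eq_sum_range_succ (fun k i => b k * ((k.choose i : ℂ) / 2 ^ k)),
    Finset.mul_sum]
  simp only [Function.comp]
  rw [← Finset.sum_coe_sort]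
  refine Finset.sum_congr rfl fun p _ => ?_
  have := Finset.HasAntidiagonal.mem_antidiagonal.mp p.2
  simp only [hF, Finset.HasAntidiagonal.sigmaAntidiagonalEquivProd_apply]
  rw [this]; ring
  

lemma fab_bound (b : ℕ → ℂ)
    (hb : ∀ r : ℝ, 0 ≤ r → r < 1 → Summable fun n => ‖b n‖ * r ^ n)
    (U : Set ℂ) (g : ℂ → ℂ) (hU : IsOpen U) (h1 : (1 : ℂ) ∈ U) (hg : DifferentiableOn ℂ g U)
    (hgf : ∀ z ∈ U, ‖z‖ < 1 → g z = ∑' n, b n * z ^ n) :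
    ∃ B ρ : ℝ, 0 < B ∧ 1 < ρ ∧ ∀ s : ℝ, 0 ≤ s → s ≤ 1 → ∀ j : ℕ,
      ‖∑ k ∈ Finset.range (j + 1), b k * (s : ℂ) ^ k * ((k.choose (j - k) : ℂ) / 2 ^ k)‖
        ≤ B / ρ ^ j := by
  classical
  set f : ℂ → ℂ := fun z => ∑' n, b n * z ^ n with hf
  set h : ℂ → ℂ := fun z => if ‖z‖ < 1 then f z else g z with hh
  have hhU : ∀ z ∈ U, h z = g z := by
    intro z hz
    by_cases hz1 : ‖z‖ < 1
    · simp only [hh, hz1, if_true]; exact (hgf z hz hz1).symm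
    · simp [hh, hz1]
  have hball : IsOpen {z : ℂ | ‖z‖ < 1} := isOpen_lt continuous_norm continuous_const
  have hfd : DifferentiableOn ℂ f {z : ℂ | ‖z‖ < 1} := by
    intro z hz
    obtain ⟨r, hzr, hr⟩ := exists_between (show ‖z‖ < 1 from hz)
    have hr0 : 0 ≤ r := (norm_nonneg z).trans hzr.le
    have : DifferentiableOn ℂ f {z : ℂ | ‖z‖ < r} := by
      apply Complex.differentiableOn_tsum_of_summable_norm (hb r hr0 hr)
      · intro i; fun_prop
      · exact isOpen_lt continuous_norm continuous_const
      · intro i w hw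
        rw [norm_mul, norm_pow]
        gcongr
        exact le_of_lt hw
    exact (this.differentiableAt ((isOpen_lt continuous_norm continuous_const).mem_nhds hzr)).differentiableWithinAt
  set V : Set ℂ := {z : ℂ | ‖z‖ < 1} ∪ U with hV
  have hVo : IsOpen V := hball.union hU
  have hhd : DifferentiableOn ℂ h V := by
    rintro z (hz | hz)
    · have : h =ᶠ[nhds z] f := by
        filter_upwards [hball.mem_nhds hz] with w hw
        simp only [hh]; rw [if_pos hw]
      exact (this.differentiableAt_iff.mpr (hfd.differentiableAt (hball.mem_nhds hz))).differentiableWithinAt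
    · have : h =ᶠ[nhds z] g := by
        filter_upwards [hU.mem_nhds hz] with w hw
        exact hhU w hw
      exact (this.differentiableAt_iff.mpr (hg.differentiableAt (hU.mem_nhds hz))).differentiableWithinAt
  set Φ : ℝ × ℂ → ℂ := fun p => (p.1 : ℂ) * ((p.2 + p.2 ^ 2) / 2) with hΦ
  have hΦc : Continuous Φ := by fun_prop
  have key : Set.Icc (0 : ℝ) 1 ×ˢ Metric.closedBall (0 : ℂ) 1 ⊆ Φ ⁻¹' V := by
    rintro ⟨s, w⟩ ⟨⟨hs0, hs1⟩, hw⟩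
    simp only [mem_closedBall_zero_iff] at hw hs0 hs1
    have e : Φ (s, w) = s * w * ((1 + w) / 2) := by simp only [hΦ]; ring
    have hn : ‖Φ (s, w)‖ = s * ‖w‖ * (‖1 + w‖ / 2) := by
      rw [e]; simp [abs_of_nonneg hs0]
    have h1w : ‖1 + w‖ ≤ 1 + ‖w‖ := by simpa using norm_add_le (1 : ℂ) w
    by_cases hlt : ‖Φ (s, w)‖ < 1
    · exact Or.inl hlt
    · right
      push Not at hlt
      have hnw := norm_nonneg w
      have hnw1 := norm_nonneg (1 + w)
      have hsw : s * ‖w‖ ≤ 1 := by nlinarith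
      have hsw0 : 0 ≤ s * ‖w‖ := by positivity
      have h2 : ‖1 + w‖ = 2 := by
        apply le_antisymm (by linarith)
        by_contra hc; push Not at hc; nlinarith
      rw [hn, h2] at hlt
      have hs : s = 1 := by nlinarith
      have hw1 : ‖w‖ = 1 := by nlinarith
      have hwe : w = 1 := by
        have q1 : ‖w‖ ^ 2 = w.re ^ 2 + w.im ^ 2 := by
          rw [← Complex.normSq_eq_norm_sq, Complex.normSq_apply]; ring
        have q2 : ‖1 + w‖ ^ 2 = (1 + w.re) ^ 2 + w.im ^ 2 := by
          rw [← Complex.normSq_eq_norm_sq, Complex.normSq_apply]; simp; ring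
        rw [hw1] at q1; rw [h2] at q2
        have hre : w.re = 1 := by linarith
        have him : w.im = 0 := by
          rw [hre] at q1; nlinarith
        apply Complex.ext <;> simp [hre, him]
      rw [e, hs, hwe]; norm_num; exact h1
  obtain ⟨δ, hδ, hδs⟩ := (isCompact_Icc.prod (isCompact_closedBall (0 : ℂ) 1)).exists_cthickening_subset_open
    (hVo.preimage hΦc) key
  set ρ : ℝ := 1 + δ with hρ
  have hρ0 : 0 < ρ := by positivity
  have key2 : Set.Icc (0 : ℝ) 1 ×ˢ Metric.closedBall (0 : ℂ) ρ ⊆ Φ ⁻¹' V := by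
    rintro ⟨s, w⟩ ⟨hs, hw⟩
    simp only [mem_closedBall_zero_iff] at hw hs
    apply hδs
    apply Metric.mem_cthickening_of_dist_le (s, w) (s, w / ρ)
    · refine ⟨hs, ?_⟩
      simp only [mem_closedBall_zero_iff, norm_div, Complex.norm_real, Real.norm_eq_abs, abs_of_pos hρ0]
      rw [div_le_one hρ0]; exact hw
    · rw [Prod.dist_eq]
      simp only [dist_self]
      apply max_le hδ.le
      have : w - w / ρ = w / ρ * (δ : ℂ) := by
        have : (ρ : ℂ) ≠ 0 := by exact_mod_cast hρ0.ne'
        field_simp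
        rw [hρ]; push_cast; ring
      rw [dist_eq_norm, this]
      simp only [norm_mul, norm_div, Complex.norm_real, Real.norm_eq_abs, abs_of_pos hρ0, abs_of_pos hδ]
      have : ‖w‖ / ρ ≤ 1 := by rw [div_le_one hρ0]; exact hw
      nlinarith
  have hcomp : IsCompact (Set.Icc (0 : ℝ) 1 ×ˢ Metric.closedBall (0 : ℂ) ρ) :=
    isCompact_Icc.prod (isCompact_closedBall _ _)
  have hcont : ContinuousOn (fun p => h (Φ p)) (Set.Icc (0 : ℝ) 1 ×ˢ Metric.closedBall (0 : ℂ) ρ) :=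
    hhd.continuousOn.comp hΦc.continuousOn key2
  obtain ⟨B, hB⟩ := hcomp.exists_bound_of_continuousOn hcont
  refine ⟨max B 1, ρ, by positivity, by linarith, ?_⟩
  intro s hs0 hs1 j
  set H : ℂ → ℂ := fun w => h (Φ (s, w)) with hH
  have hHd : DifferentiableOn ℂ H (Metric.closedBall 0 ρ) := by
    apply hhd.comp
    · simp only [hΦ]; fun_prop
    · intro w hw; exact key2 ⟨⟨hs0, hs1⟩, hw⟩
  have hHdc : DiffContOnCl ℂ H (Metric.ball 0 ρ) := by
    apply DifferentiableOn.diffContOnCl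
    rw [closure_ball _ hρ0.ne']; exact hHd
  have hHb : ‖iteratedDeriv j H 0‖ ≤ j.factorial * (max B 1) / ρ ^ j := by
    apply Complex.norm_iteratedDeriv_le_of_forall_mem_sphere_norm_le j hρ0 hHdc
    intro z hz
    exact (hB (s, z) ⟨⟨hs0, hs1⟩, Metric.sphere_subset_closedBall hz⟩).trans (le_max_left _ _)
  set c : ℕ → ℂ := fun j => ∑ k ∈ Finset.range (j + 1),
    b k * (s : ℂ) ^ k * ((k.choose (j - k) : ℂ) / 2 ^ k) with hc
  have P1 : HasFPowerSeriesAt H (FormalMultilinearSeries.ofScalars ℂ c) 0 := by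
    rw [hasFPowerSeriesAt_iff]
    filter_upwards [Metric.ball_mem_nhds (0 : ℂ) one_pos] with w hw
    have hw : ‖w‖ < 1 := by simpa using hw
    have := fab_expand (fun k => b k * (s : ℂ) ^ k) (fun r hr0 hr1 => by
      refine Summable.of_nonneg_of_le (fun n => by positivity) (fun n => ?_) (hb r hr0 hr1)
      rw [norm_mul, norm_pow, Complex.norm_real, Real.norm_eq_abs, abs_of_nonneg hs0]
      have : s ^ n ≤ 1 := pow_le_one₀ hs0 hs1
      have h3 : ‖b n‖ * s ^ n ≤ ‖b n‖ := mul_le_of_le_one_right (norm_nonneg _) this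
      gcongr) w hw
    have e1 : (fun n => w ^ n • (FormalMultilinearSeries.ofScalars ℂ c).coeff n) = fun j => w ^ j * c j := by
      funext n; rw [FormalMultilinearSeries.coeff_ofScalars, smul_eq_mul]
    have e2 : H (0 + w) = ∑' k, b k * (s : ℂ) ^ k * ((w + w ^ 2) / 2) ^ k := by
      have hΦ1 : ‖Φ (s, w)‖ < 1 := by
        have : ‖Φ (s, w)‖ ≤ s * ((‖w‖ + ‖w‖ ^ 2) / 2) := by
          simp only [hΦ, norm_mul, norm_div, Complex.norm_real, Real.norm_eq_abs, abs_of_nonneg hs0]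
          have := norm_add_le w (w ^ 2)
          rw [norm_pow] at this
          simp only [Complex.norm_ofNat]
          gcongr
        have := norm_nonneg w
        have : (‖w‖ + ‖w‖ ^ 2) / 2 < 1 := by nlinarith
        nlinarith
      simp only [zero_add, hH, hh]
      rw [if_pos hΦ1]
      simp only [hf, hΦ]
      refine tsum_congr fun n => ?_
      rw [mul_pow]; ring
    rw [e1, e2]
    exact this
  have P2 : HasFPowerSeriesAt H (FormalMultilinearSeries.ofScalars ℂ
      (fun n => (n.factorial : ℂ)⁻¹ * iteratedDeriv n H 0)) 0 := by
    rw [hasFPowerSeriesAt_iff]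
    filter_upwards [Metric.ball_mem_nhds (0 : ℂ) hρ0] with w hw
    have := Complex.hasSum_taylorSeries_on_ball (hHd.mono Metric.ball_subset_closedBall) hw
    convert this using 1
    · funext n; simp [FormalMultilinearSeries.coeff_ofScalars]; ring
    · simp
  have hP := congrArg (fun p => FormalMultilinearSeries.coeff p j) (P1.eq_formalMultilinearSeries P2)
  simp only [FormalMultilinearSeries.coeff_ofScalars] at hP
  change ‖c j‖ ≤ _
  rw [hP, norm_mul, norm_inv, Complex.norm_natCast]
  have hfac : (0 : ℝ) < j.factorial := by positivity
  calc _ ≤ (j.factorial : ℝ)⁻¹ * (j.factorial * (max B 1) / ρ ^ j) := by gcongr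
    _ = _ := by field_simp

/-- product of distinct positive integers -/
lemma fab_fact (S : Finset ℕ) (hS : ∀ j ∈ S, 1 ≤ j) : S.card.factorial ≤ ∏ j ∈ S, j := by
  induction S using Finset.induction_on_max with
  | empty => simp
  | insert a s hlt ih =>
    have ha : a ∉ s := fun h => lt_irrefl _ (hlt a h)
    rw [Finset.card_insert_of_notMem ha, Finset.prod_insert ha, Nat.factorial_succ]
    have hsub : insert a s ⊆ Finset.Icc 1 a := by
      intro x hx
      rw [Finset.mem_Icc]
      refine ⟨hS x hx, ?_⟩
      rcases Finset.mem_insert.mp hx with h | h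
      · exact h.le
      · exact (hlt x h).le
    have := Finset.card_le_card hsub
    rw [Finset.card_insert_of_notMem ha, Nat.card_Icc] at this
    exact Nat.mul_le_mul (by omega) (ih fun j hj => hS j (Finset.mem_insert_of_mem hj))

lemma fab_dist (N : ℕ) (S : Finset ℕ) :
    (S.card.factorial : ℝ) ≤ ∏ j ∈ S, (4 * |(j : ℝ) + 1 / 2 - N|) := by
  set v : ℕ → ℕ := fun j => if j < N then 2 * (N - j) else 2 * (j - N) + 1 with hv
  have hinj : Function.Injective v := by
    intro i j hij
    simp only [hv] at hij
    split_ifs at hij <;> omega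
  have h1 := fab_fact (S.image v) (by
    intro j hj
    obtain ⟨i, _, rfl⟩ := Finset.mem_image.mp hj
    simp only [hv]; split_ifs <;> omega)
  rw [Finset.card_image_of_injective _ hinj, Finset.prod_image (fun i _ j _ h => hinj h)] at h1
  have h2 : (S.card.factorial : ℝ) ≤ ∏ j ∈ S, (v j : ℝ) := by exact_mod_cast h1
  refine h2.trans (Finset.prod_le_prod (fun _ _ => by positivity) fun j _ => ?_)
  simp only [hv]
  split_ifs with h
  · have h' : (j : ℝ) + 1 ≤ N := by exact_mod_cast h
    rw [abs_of_nonpos (by linarith)]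
    push_cast [Nat.cast_sub h.le]; linarith
  · have h' : (N : ℝ) ≤ j := by exact_mod_cast (not_lt.mp h)
    rw [abs_of_nonneg (by linarith)]
    push_cast [Nat.cast_sub (not_lt.mp h)]; linarith

lemma fab_exp {x y : ℝ} (hx : x ≤ 2) (hy : y ≤ 2) :
    Real.exp (-2) * |x - y| ≤ |Real.exp (-y) - Real.exp (-x)| := by
  wlog h : y ≤ x generalizing x y
  · rw [abs_sub_comm, abs_sub_comm (Real.exp _)]
    exact this hy hx (le_of_not_ge h)
  rw [abs_of_nonneg (by linarith)]
  refine le_trans ?_ (le_abs_self _)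
  have e1 : Real.exp (-y) = Real.exp (-x) * Real.exp (x - y) := by rw [← Real.exp_add]; ring_nf
  have e2 : x - y + 1 ≤ Real.exp (x - y) := Real.add_one_le_exp _
  have e3 : Real.exp (-2) ≤ Real.exp (-x) := Real.exp_le_exp.mpr (by linarith)
  have e4 := Real.exp_pos (-x)
  calc _ ≤ Real.exp (-x) * (x - y) := by gcongr
    _ ≤ _ := by rw [e1]; nlinarith

/-- lower bound for the multiplier -/
lemma fab_lower (N : ℕ) (hN : 0 < N) (S : Finset ℕ) (hS : ∀ j ∈ S, j < 2 * N) (η : ℝ) (hη : 0 < η) :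
    (η * (Real.exp (-2) / 4)) ^ S.card * Real.exp (-(η * N)) ≤
      |∏ j ∈ S, (Real.exp (-1 / N) ^ N - Real.exp (-((j : ℝ) + 1 / 2) / N))| := by
  have hN' : (0 : ℝ) < N := by exact_mod_cast hN
  have hN1 : Real.exp (-1 / N) ^ N = Real.exp (-1) := by
    rw [← Real.exp_nat_mul]; congr 1; field_simp
  rw [hN1, Finset.abs_prod]
  have A : ∏ j ∈ S, (Real.exp (-2) / (4 * N) * (4 * |(j : ℝ) + 1 / 2 - N|)) ≤
      ∏ j ∈ S, |Real.exp (-1) - Real.exp (-((j : ℝ) + 1 / 2) / N)| := by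
    refine Finset.prod_le_prod (fun _ _ => by positivity) fun j hj => ?_
    have hj2 : (j : ℝ) + 1 ≤ 2 * N := by exact_mod_cast hS j hj
    have := fab_exp (x := ((j : ℝ) + 1 / 2) / N) (y := 1)
      (by rw [div_le_iff₀ hN']; linarith) (by norm_num)
    rw [neg_div]
    refine le_trans (le_of_eq ?_) this
    have : ((j : ℝ) + 1 / 2) / N - 1 = ((j : ℝ) + 1 / 2 - N) / N := by field_simp
    rw [this, abs_div, abs_of_pos hN']; field_simp
  refine le_trans ?_ A
  rw [Finset.prod_mul_distrib, Finset.prod_const]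
  have B := fab_dist N S
  have C := Real.pow_div_factorial_le_exp (η * N) (by positivity) S.card
  have hf : (0 : ℝ) < S.card.factorial := by positivity
  rw [div_le_iff₀ hf] at C
  have C' : (η * N) ^ S.card * Real.exp (-(η * N)) ≤ S.card.factorial := by
    rw [Real.exp_neg, ← div_eq_mul_inv, div_le_iff₀ (Real.exp_pos _)]; linarith
  calc _ = (Real.exp (-2) / (4 * N)) ^ S.card * ((η * N) ^ S.card * Real.exp (-(η * N))) := by
        rw [← mul_assoc, ← mul_pow]; congr 2; field_simp
    _ ≤ _ := by gcongr; exact C'.trans B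

/-- upper bound for the functional with multiplier -/
lemma fab_upper (J : Finset ℕ) (d : ℕ → ℂ) (q A : ℝ)  (x : ℕ → ℝ)
    (hx0 : ∀ j, 0 ≤ x j) (hx1 : ∀ j, x j ≤ 1)
    (hd : ∀ i : ℕ, ‖∑ k ∈ J, d k * (((q ^ i) ^ k : ℝ) : ℂ)‖ ≤ A) (S : Finset ℕ) :
    ∀ i : ℕ, ‖∑ k ∈ J, d k * (((q ^ i) ^ k * ∏ j ∈ S, (q ^ k - x j) : ℝ) : ℂ)‖ ≤ 2 ^ S.card * A := by
  classical
  induction S using Finset.induction_on with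
  | empty => intro i; simpa using hd i
  | insert a s ha ih =>
    intro i
    have e : ∑ k ∈ J, d k * (((q ^ i) ^ k * ∏ j ∈ insert a s, (q ^ k - x j) : ℝ) : ℂ)
        = ∑ k ∈ J, d k * (((q ^ (i + 1)) ^ k * ∏ j ∈ s, (q ^ k - x j) : ℝ) : ℂ)
          - (x a : ℂ) * ∑ k ∈ J, d k * (((q ^ i) ^ k * ∏ j ∈ s, (q ^ k - x j) : ℝ) : ℂ) := by
      rw [Finset.mul_sum, ← Finset.sum_sub_distrib]
      refine Finset.sum_congr rfl fun k _ => ?_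
      rw [Finset.prod_insert ha]
      push_cast
      rw [pow_succ, mul_pow]; ring
    rw [e, Finset.card_insert_of_notMem ha]
    refine (norm_sub_le _ _).trans ?_
    rw [norm_mul, Complex.norm_real, Real.norm_eq_abs, abs_of_nonneg (hx0 a)]
    have h1 := ih (i + 1)
    have h2 := mul_le_of_le_one_left (norm_nonneg (∑ k ∈ J, d k * (((q ^ i) ^ k * ∏ j ∈ s, (q ^ k - x j) : ℝ) : ℂ))) (hx1 a)
    have h3 := ih i
    have h4 : (2 : ℝ) ^ (s.card + 1) * A = 2 ^ s.card * A + 2 ^ s.card * A := by ring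
    linarith

/-- constant sign -/
lemma fab_sign (M T : ℕ) (v y : ℕ → ℝ) (x : ℕ → ℝ) (S : Finset ℕ)
    (hS : ∀ k, k ∈ S ↔ (M ≤ k ∧ k < T) ∧ ¬ (0 ≤ v k ↔ 0 ≤ v (k + 1)))
    (hy1 : ∀ k j, k ≤ j → x j < y k) (hy2 : ∀ k j, j < k → y k < x j) :
    ∃ κ : ℝ, |κ| = 1 ∧ ∀ k, M ≤ k → k ≤ T →
      v k * ∏ j ∈ S, (y k - x j) = κ * (|v k| * |∏ j ∈ S, (y k - x j)|) := by
  classical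
  set σ : ℕ → ℝ := fun k => ∏ j ∈ S, (if k ≤ j then 1 else -1) with hσ
  set e : ℕ → ℝ := fun k => if 0 ≤ v k then 1 else -1 with he
  have hP : ∀ k, ∏ j ∈ S, (y k - x j) = σ k * |∏ j ∈ S, (y k - x j)| := by
    intro k
    rw [Finset.abs_prod, hσ, ← Finset.prod_mul_distrib]
    refine Finset.prod_congr rfl fun j _ => ?_
    split_ifs with h
    · rw [abs_of_pos (by linarith [hy1 k j h])]; ring
    · rw [abs_of_neg (by linarith [hy2 k j (not_le.mp h)])]; ring
  have hv : ∀ k, v k = e k * |v k| := by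
    intro k
    simp only [he]
    split_ifs with h
    · rw [abs_of_nonneg h]; ring
    · rw [abs_of_neg (not_le.mp h)]; ring
  have hσs : ∀ k, σ (k + 1) = σ k * (if k ∈ S then -1 else 1) := by
    intro k
    have : (if k ∈ S then (-1 : ℝ) else 1) = ∏ j ∈ S, (if j = k then -1 else 1) := by
      rw [Finset.prod_ite_eq']
    rw [this, hσ, ← Finset.prod_mul_distrib]
    refine Finset.prod_congr rfl fun j _ => ?_
    split_ifs <;> first | omega | norm_num
  have hstep : ∀ k, M ≤ k → k < T → e (k + 1) * σ (k + 1) = e k * σ k := by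
    intro k h1 h2
    rw [hσs]
    by_cases hk : k ∈ S
    · have := ((hS k).mp hk).2
      simp only [hk, he, if_true]
      split_ifs <;> first | tauto | ring
    · have h3 : (0 ≤ v k ↔ 0 ≤ v (k + 1)) := by
        by_contra hc; exact hk ((hS k).mpr ⟨⟨h1, h2⟩, hc⟩)
      simp only [hk, he, if_false]
      split_ifs <;> first | tauto | ring
  have hconst : ∀ k, M ≤ k → k ≤ T → e k * σ k = e M * σ M := by
    intro k hk
    induction k, hk using Nat.le_induction with
    | base => intro _; rfl
    | succ k hk ih => intro h; rw [hstep k hk (by omega), ih (by omega)]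
  refine ⟨e M * σ M, ?_, ?_⟩
  · rw [abs_mul, hσ, Finset.abs_prod]
    have h1 : |e M| = 1 := by simp only [he]; split_ifs <;> simp
    rw [h1, one_mul]
    apply Finset.prod_eq_one
    intro j _
    split_ifs <;> simp
  · intro k h1 h2
    rw [← hconst k h1 h2]
    conv_lhs => rw [hP k, hv k]
    ring

/-- a direction with few sign changes -/
lemma fab_dir (z : ℕ → ℂ) (M T L : ℕ) (hL : 0 < L) (ε : ℝ) (hε : ε * (8 * L + 2) < 1)
    (hz : ∀ k, M ≤ k → z k ≠ 0) (hd : ∀ k, M ≤ k → ‖z (k + 1) - z k‖ ≤ ε * ‖z k‖) :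
    ∃ t : ℝ, 0 ≤ t ∧ t ≤ 1 ∧ ∃ S : Finset ℕ,
      (∀ k, k ∈ S ↔ (M ≤ k ∧ k < T) ∧
        ¬ (0 ≤ (z k).re + t * (z k).im ↔ 0 ≤ (z (k + 1)).re + t * (z (k + 1)).im)) ∧
      L * S.card ≤ T := by
  classical
  have hLr : (0 : ℝ) < L := by exact_mod_cast hL
  set t : ℕ → ℝ := fun i => i / L with ht
  set bad : ℕ → ℕ → Prop := fun i k => ¬ (0 ≤ (z k).re + t i * (z k).im ↔ 0 ≤ (z (k + 1)).re + t i * (z (k + 1)).im) with hbad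
  set S : ℕ → Finset ℕ := fun i => (Finset.Ico M T).filter (bad i) with hS
  have hbd : ∀ i < L, ∀ k, M ≤ k → bad i k → |(z k).re + t i * (z k).im| ≤ 2 * ε * ‖z k‖ := by
    intro i hi k hk hb
    have ht0 : 0 ≤ t i := by simp only [ht]; positivity
    have ht1 : t i ≤ 1 := by
      simp only [ht]; rw [div_le_one hLr]; exact_mod_cast hi.le
    have h1 : |(z k).re + t i * (z k).im| ≤
        |((z (k + 1)).re + t i * (z (k + 1)).im) - ((z k).re + t i * (z k).im)| := by
      simp only [hbad] at hb
      by_cases h : 0 ≤ (z k).re + t i * (z k).im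
      · have h' : ¬ 0 ≤ (z (k + 1)).re + t i * (z (k + 1)).im := fun h' => hb ⟨fun _ => h', fun _ => h⟩
        push Not at h'
        rw [abs_of_nonneg h, abs_of_neg (by linarith)]; linarith
      · have h' : 0 ≤ (z (k + 1)).re + t i * (z (k + 1)).im := by
          by_contra h'; exact hb ⟨fun x => absurd x h, fun x => absurd x h'⟩
        push Not at h
        rw [abs_of_neg h, abs_of_nonneg (by linarith)]; linarith
    have h2 : ((z (k + 1)).re + t i * (z (k + 1)).im) - ((z k).re + t i * (z k).im)
        = (z (k + 1) - z k).re + t i * (z (k + 1) - z k).im := by simp; ring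
    rw [h2] at h1
    have h3 := Complex.abs_re_le_norm (z (k + 1) - z k)
    have h4 := Complex.abs_im_le_norm (z (k + 1) - z k)
    have h5 := abs_add_le (z (k + 1) - z k).re (t i * (z (k + 1) - z k).im)
    rw [abs_mul, abs_of_nonneg ht0] at h5
    have h6 := mul_le_of_le_one_left (abs_nonneg (z (k + 1) - z k).im) ht1
    linarith [hd k hk]
  have huniq : ∀ i < L, ∀ i' < L, ∀ k, M ≤ k → bad i k → bad i' k → i = i' := by
    intro i hi i' hi' k hk hb hb'
    by_contra hne
    have h1 := hbd i hi k hk hb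
    have h2 := hbd i' hi' k hk hb'
    have hzk : 0 < ‖z k‖ := norm_pos_iff.mpr (hz k hk)
    have ht0 : 0 ≤ t i := by simp only [ht]; positivity
    have ht1 : t i ≤ 1 := by
      simp only [ht]; rw [div_le_one hLr]; exact_mod_cast hi.le
    have hsep : 1 / (L : ℝ) ≤ |t i - t i'| := by
      simp only [ht]
      rw [← sub_div, abs_div, abs_of_pos hLr]
      gcongr
      have : (1 : ℤ) ≤ |(i : ℤ) - i'| := Int.one_le_abs (by omega)
      exact_mod_cast this
    have h3 : |t i - t i'| * |(z k).im| ≤ 4 * ε * ‖z k‖ := by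
      rw [← abs_mul]
      have : (t i - t i') * (z k).im = ((z k).re + t i * (z k).im) - ((z k).re + t i' * (z k).im) := by ring
      rw [this]
      have := abs_sub ((z k).re + t i * (z k).im) ((z k).re + t i' * (z k).im)
      linarith
    have h4 : |(z k).im| ≤ 4 * ε * L * ‖z k‖ := by
      have : 1 / (L : ℝ) * |(z k).im| ≤ 4 * ε * ‖z k‖ := le_trans (by gcongr) h3
      rw [one_div, inv_mul_le_iff₀ hLr] at this
      linarith
    have h5 : |(z k).re| ≤ 2 * ε * ‖z k‖ + |(z k).im| := by
      have : (z k).re = ((z k).re + t i * (z k).im) - t i * (z k).im := by ring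
      have h6 := abs_sub ((z k).re + t i * (z k).im) (t i * (z k).im)
      rw [← this, abs_mul, abs_of_nonneg ht0] at h6
      have h7 := mul_le_of_le_one_left (abs_nonneg (z k).im) ht1
      linarith
    have h6 := Complex.norm_le_abs_re_add_abs_im (z k)
    nlinarith
  have hdisj : ((Finset.range L : Finset ℕ) : Set ℕ).PairwiseDisjoint S := by
    intro i hi i' hi' hne
    simp only [Finset.coe_range, Set.mem_Iio] at hi hi'
    rw [Function.onFun, Finset.disjoint_left]
    intro k hk hk'
    simp only [hS, Finset.mem_filter, Finset.mem_Ico] at hk hk'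
    exact hne (huniq i hi i' hi' k hk.1.1 hk.2 hk'.2)
  have hsum : ∑ i ∈ Finset.range L, (S i).card ≤ T := by
    rw [← Finset.card_biUnion hdisj]
    calc _ ≤ (Finset.range T).card := by
          apply Finset.card_le_card
          intro k hk
          simp only [hS, Finset.mem_biUnion, Finset.mem_filter, Finset.mem_Ico] at hk
          obtain ⟨_, _, h, _⟩ := hk
          exact Finset.mem_range.mpr h.2
      _ = T := Finset.card_range T
  obtain ⟨i, hi, hiS⟩ := Finset.exists_min_image (Finset.range L) (fun i => (S i).card) ⟨0, Finset.mem_range.mpr hL⟩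
  have hi' := Finset.mem_range.mp hi
  refine ⟨t i, by simp only [ht]; positivity, ?_, S i, ?_, ?_⟩
  · simp only [ht]; rw [div_le_one hLr]; exact_mod_cast hi'.le
  · intro k; simp only [hS, Finset.mem_filter, Finset.mem_Ico, hbad]
  · refine le_trans ?_ hsum
    have := Finset.card_nsmul_le_sum (Finset.range L) (fun i => (S i).card) _ hiS
    simpa using this

lemma fab_core (b : ℕ → ℂ) (B ρ : ℝ) (hρ : 1 < ρ)
    (hbd : ∀ s : ℝ, 0 ≤ s → s ≤ 1 → ∀ j : ℕ,
      ‖∑ k ∈ Finset.range (j + 1), b k * (s : ℂ) ^ k * ((k.choose (j - k) : ℂ) / 2 ^ k)‖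
        ≤ B / ρ ^ j)
    (M L : ℕ) (hM : 0 < M) (hL : 0 < L) (ε η : ℝ) (hε : ε * (8 * L + 2) < 1) (hη : 0 < η)
    (hz : ∀ k, M ≤ k → b k ≠ 0) (hd : ∀ k, M ≤ k → ‖b (k + 1) - b k‖ ≤ ε * ‖b k‖) :
    ∃ m : ℕ, L * m ≤ 3 * M ∧
      (η * (Real.exp (-2) / 4)) ^ m * Real.exp (-(η * (2 * M))) * (1 / (2 * M)) ≤
        2 * (2 ^ m * (B / ρ ^ (3 * M) / ‖b (2 * M)‖)) := by
  classical
  set N := 2 * M with hN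
  have hNpos : 0 < N := by omega
  have hNr : (0 : ℝ) < N := by exact_mod_cast hNpos
  have hbN : b N ≠ 0 := hz N (by omega)
  have hbNn : 0 < ‖b N‖ := norm_pos_iff.mpr hbN
  set z : ℕ → ℂ := fun k => b k / b N with hzdef
  obtain ⟨t, ht0, ht1, S, hS, hcard⟩ := fab_dir z M (3 * M) L hL ε hε
    (fun k hk => div_ne_zero (hz k hk) hbN) (fun k hk => by
      simp only [hzdef]
      rw [← sub_div, norm_div, norm_div, ← mul_div_assoc]
      gcongr
      exact hd k hk)
  refine ⟨S.card, hcard, ?_⟩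
  set q : ℝ := Real.exp (-1 / N) with hq
  have hq0 : 0 < q := Real.exp_pos _
  have hq1 : q ≤ 1 := by
    rw [hq, Real.exp_le_one_iff]; apply div_nonpos_of_nonpos_of_nonneg <;> linarith
  set x : ℕ → ℝ := fun j => Real.exp (-((j : ℝ) + 1 / 2) / N) with hx
  have hqk : ∀ k : ℕ, q ^ k = Real.exp (-(k : ℝ) / N) := by
    intro k; rw [hq, ← Real.exp_nat_mul]; congr 1; ring
  set v : ℕ → ℝ := fun k => (z k).re + t * (z k).im with hv
  set P : ℕ → ℝ := fun k => ∏ j ∈ S, (q ^ k - x j) with hP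
  set c : ℕ → ℝ := fun k => (k.choose (3 * M - k) : ℝ) / 2 ^ k with hc
  have hc0 : ∀ k, 0 ≤ c k := fun k => by simp only [hc]; positivity
  obtain ⟨κ, hκ, hκv⟩ := fab_sign M (3 * M) v (fun k => q ^ k) x S hS
    (by
      intro k j hkj
      have : (k : ℝ) ≤ j := by exact_mod_cast hkj
      simp only [hqk, hx]
      apply Real.exp_lt_exp.mpr
      gcongr; linarith)
    (by
      intro k j hkj
      have : (j : ℝ) + 1 ≤ k := by exact_mod_cast hkj
      simp only [hqk, hx]
      apply Real.exp_lt_exp.mpr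
      gcongr; linarith)
  have hlow := fab_lower N hNpos S (fun j hj => by have := ((hS j).mp hj).1.2; omega) η hη
  set J := Finset.range (3 * M + 1) with hJ
  have hup := fab_upper J (fun k => z k * (c k : ℂ)) q (B / ρ ^ (3 * M) / ‖b N‖) x
    (fun j => (Real.exp_pos _).le)
    (fun j => by
      simp only [hx]; rw [Real.exp_le_one_iff, neg_div]
      have : 0 ≤ ((j : ℝ) + 1 / 2) / N := by positivity
      linarith)
    (fun i => by
      have h := hbd (q ^ i) (by positivity) (pow_le_one₀ hq0.le hq1) (3 * M)
      have e : ∑ k ∈ J, z k * (c k : ℂ) * (((q ^ i) ^ k : ℝ) : ℂ) =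
          (∑ k ∈ J, b k * ((q ^ i : ℝ) : ℂ) ^ k * ((k.choose (3 * M - k) : ℂ) / 2 ^ k)) / b N := by
        rw [Finset.sum_div]
        refine Finset.sum_congr rfl fun k _ => ?_
        simp only [hzdef, hc]; push_cast; ring
      rw [e, norm_div]
      gcongr) S 0
  simp only [pow_zero, one_pow, one_mul] at hup
  set X : ℂ := ∑ k ∈ J, z k * (c k : ℂ) * ((∏ j ∈ S, (q ^ k - x j) : ℝ) : ℂ) with hX
  have hXre : X.re + t * X.im = ∑ k ∈ J, v k * P k * c k := by
    rw [hX, Complex.re_sum, Complex.im_sum, Finset.mul_sum, ← Finset.sum_add_distrib]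
    refine Finset.sum_congr rfl fun k _ => ?_
    rw [mul_assoc, ← Complex.ofReal_mul, Complex.re_mul_ofReal, Complex.im_mul_ofReal]
    simp only [hv, hP]; ring
  have hsum : ∑ k ∈ J, v k * P k * c k = κ * ∑ k ∈ J, |v k| * |P k| * c k := by
    rw [Finset.mul_sum]
    refine Finset.sum_congr rfl fun k hk => ?_
    have hk' : k ≤ 3 * M := by have := Finset.mem_range.mp hk; omega
    by_cases hkM : M ≤ k
    · have := hκv k hkM hk'
      simp only [hP]; rw [this]; ring
    · have : c k = 0 := by
        simp only [hc]; rw [Nat.choose_eq_zero_of_lt (by omega)]; simp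
      rw [this]; ring
  have hXn : |X.re + t * X.im| ≤ 2 * ‖X‖ := by
    have h3 := Complex.abs_re_le_norm X
    have h4 := Complex.abs_im_le_norm X
    have h5 := abs_add_le X.re (t * X.im)
    rw [abs_mul, abs_of_nonneg ht0] at h5
    have h6 := mul_le_of_le_one_left (abs_nonneg X.im) ht1
    linarith
  have hge : |v N| * |P N| * c N ≤ |X.re + t * X.im| := by
    rw [hXre, hsum, abs_mul, hκ, one_mul]
    refine le_trans ?_ (le_abs_self _)
    exact Finset.single_le_sum (f := fun k => |v k| * |P k| * c k)
      (fun k _ => mul_nonneg (by positivity) (hc0 k)) (Finset.mem_range.mpr (by omega))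
  have hvN : v N = 1 := by simp [hv, hzdef, hbN]
  have hcN : 1 / (2 * M) ≤ c N := by
    simp only [hc]
    have e : 3 * M - N = M := by omega
    have h4 := Nat.four_pow_le_two_mul_self_mul_centralBinom M hM
    have h4' : (4 : ℝ) ^ M ≤ 2 * M * (N.choose M : ℝ) := by
      rw [Nat.centralBinom] at h4; exact_mod_cast h4
    have h2 : (2 : ℝ) ^ N = 4 ^ M := by rw [hN, pow_mul]; norm_num
    have hMr : (0 : ℝ) < M := by exact_mod_cast hM
    rw [e, h2, div_le_div_iff₀ (by positivity) (by positivity)]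
    linarith
  rw [hvN, abs_one, one_mul] at hge
  have hNcast : (N : ℝ) = 2 * M := by rw [hN]; push_cast; ring
  rw [hNcast] at hlow
  calc _ ≤ |P N| * c N := by
        apply mul_le_mul _ hcN (by positivity) (abs_nonneg _)
        simp only [hP, hx, hq, hNcast]
        exact hlow
    _ ≤ _ := by linarith

lemma fab_main (b : ℕ → ℂ)
    (hb : ∀ r : ℝ, 0 ≤ r → r < 1 → Summable fun n => ‖b n‖ * r ^ n)
    (hne : ∀ᶠ n in atTop, b n ≠ 0)
    (hratio : Tendsto (fun n => b n / b (n + 1)) atTop (nhds 1))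
    (U : Set ℂ) (g : ℂ → ℂ) (hU : IsOpen U) (h1 : (1 : ℂ) ∈ U) (hg : DifferentiableOn ℂ g U)
    (hgf : ∀ z ∈ U, ‖z‖ < 1 → g z = ∑' n, b n * z ^ n) : False := by
  obtain ⟨B, ρ, hB, hρ, hbd⟩ := fab_bound b hb U g hU h1 hg hgf
  have hρ0 : 0 < ρ := by linarith
  set l := Real.log ρ with hl
  have hl0 : 0 < l := Real.log_pos hρ
  set η := l / 4 with hη
  have hη0 : 0 < η := by positivity
  set D := 2 / (η * (Real.exp (-2) / 4)) with hD
  have hD0 : 0 < D := by positivity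
  obtain ⟨L', hL'⟩ := exists_nat_gt (6 * Real.log D / l)
  set L := L' + 1 with hLdef
  have hL : 6 * Real.log D / l ≤ L := by rw [hLdef]; push_cast; linarith
  have hLpos : 0 < L := by omega
  have hLr : (0 : ℝ) < L := by exact_mod_cast hLpos
  set ε : ℝ := 1 / (8 * L + 3) with hε
  have hε0 : 0 < ε := by positivity
  have hε1 : ε * (8 * L + 2) < 1 := by
    rw [hε, one_div, inv_mul_lt_iff₀ (by positivity)]; linarith
  have hinv : Tendsto (fun n => b (n + 1) / b n) atTop (nhds 1) := by
    have := hratio.inv₀ one_ne_zero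
    simpa using this
  have e1 : ∀ᶠ n in atTop, ‖b (n + 1) - b n‖ ≤ ε * ‖b n‖ := by
    filter_upwards [hne, (Metric.tendsto_nhds.mp hinv) ε hε0] with n hn hd
    have : b (n + 1) - b n = (b (n + 1) / b n - 1) * b n := by field_simp
    rw [this, norm_mul]
    rw [dist_eq_norm] at hd
    gcongr
  have e2 : ∀ᶠ n in atTop, ‖b n‖ * Real.exp (η * n) ≤ ‖b (n + 1)‖ * Real.exp (η * (n + 1 : ℕ)) := by
    have hn1 : Tendsto (fun n => ‖b n / b (n + 1)‖) atTop (nhds 1) := by simpa using hratio.norm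
    have h1e : 1 < Real.exp η := by simpa using hη0
    filter_upwards [(tendsto_add_atTop_nat 1).eventually hne, hn1.eventually_le_const h1e] with n hn hd
    rw [norm_div, div_le_iff₀ (norm_pos_iff.mpr hn)] at hd
    have : Real.exp (η * (n + 1 : ℕ)) = Real.exp η * Real.exp (η * n) := by
      rw [← Real.exp_add]; congr 1; push_cast; ring
    rw [this]
    calc _ ≤ Real.exp η * ‖b (n + 1)‖ * Real.exp (η * n) := by gcongr
      _ = _ := by ring
  obtain ⟨n0, hn0⟩ := eventually_atTop.mp (hne.and (e1.and e2))
  set c0 := ‖b n0‖ * Real.exp (η * n0) with hc0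
  have hc0pos : 0 < c0 := by
    have := norm_pos_iff.mpr (hn0 n0 le_rfl).1
    positivity
  have hmono : ∀ n, n0 ≤ n → c0 ≤ ‖b n‖ * Real.exp (η * n) := by
    intro n hn
    induction n, hn using Nat.le_induction with
    | base => exact le_rfl
    | succ n hn ih => exact ih.trans (hn0 n hn).2.2
  -- the final inequality
  have fin : ∀ M : ℕ, n0 ≤ M → 0 < M → Real.exp (l * M) ≤ 4 * B / c0 * M := by
    intro M hM hM0
    have hMr : (0 : ℝ) < M := by exact_mod_cast hM0
    obtain ⟨m, hm, hineq⟩ := fab_core b B ρ hρ hbd M L hM0 hLpos ε η hε1 hη0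
      (fun k hk => (hn0 k (hM.trans hk)).1) (fun k hk => (hn0 k (hM.trans hk)).2.1)
    have hbN := hmono (2 * M) (by omega)
    have hbNpos : 0 < ‖b (2 * M)‖ := norm_pos_iff.mpr (hn0 _ (by omega)).1
    have hDm : D ^ m ≤ Real.exp (l * M / 2) := by
      rw [← Real.exp_log (pow_pos hD0 m), Real.log_pow]
      apply Real.exp_le_exp.mpr
      have hmr : (L : ℝ) * m ≤ 3 * M := by exact_mod_cast hm
      rw [div_le_iff₀ hl0] at hL
      have : 6 * (m * Real.log D) ≤ 3 * M * l := by
        calc 6 * (m * Real.log D) = m * (6 * Real.log D) := by ring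
          _ ≤ m * (L * l) := by gcongr
          _ = L * m * l := by ring
          _ ≤ _ := by gcongr
      linarith
    have hρM : ρ ^ (3 * M) = Real.exp (3 * l * M) := by
      rw [← Real.exp_log (pow_pos hρ0 _), Real.log_pow]; congr 1; push_cast; ring
    have hNc : ((2 * M : ℕ) : ℝ) = 2 * M := by push_cast; ring
    rw [hNc] at hbN
    have hbN' : c0 / Real.exp (η * (2 * M)) ≤ ‖b (2 * M)‖ := by
      rw [div_le_iff₀ (Real.exp_pos _)]; exact hbN
    set w := η * (Real.exp (-2) / 4) with hw
    have hw0 : 0 < w := by positivity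
    have hDw : D ^ m * w ^ m = 2 ^ m := by
      rw [← mul_pow]; congr 1; rw [hD]; field_simp
    have s1 : w ^ m * Real.exp (-(η * (2 * M))) * (1 / (2 * M)) ≤
        w ^ m * (2 * (D ^ m * (B / ρ ^ (3 * M) / ‖b (2 * M)‖))) := by
      refine hineq.trans (le_of_eq ?_)
      rw [← hDw]; ring
    rw [mul_assoc] at s1
    have s2 := le_of_mul_le_mul_left s1 (pow_pos hw0 m)
    have s3 : Real.exp (-(η * (2 * M))) * (1 / (2 * M)) ≤
        2 * (Real.exp (l * M / 2) * (B / Real.exp (3 * l * M) / (c0 / Real.exp (η * (2 * M))))) := by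
      refine s2.trans ?_
      rw [hρM]
      gcongr
    have hx : η * (2 * M) = l * M / 2 := by rw [hη]; ring
    rw [hx, Real.exp_neg] at s3
    have h3 : Real.exp (3 * l * M) = Real.exp (l * M / 2) ^ 6 := by
      rw [← Real.exp_nat_mul]; congr 1; push_cast; ring
    have h2 : Real.exp (l * M) = Real.exp (l * M / 2) ^ 2 := by
      rw [← Real.exp_nat_mul]; congr 1; push_cast; ring
    rw [h3] at s3
    rw [h2]
    have hE1 : 1 ≤ Real.exp (l * M / 2) := Real.one_le_exp (by positivity)
    set E := Real.exp (l * M / 2)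
    have hE0 : 0 < E := by linarith
    have s4 : E ^ 3 ≤ 4 * B / c0 * M := by
      have : 2 * (E * (B / E ^ 6 / (c0 / E))) = (4 * B / c0 * M) * (1 / (E ^ 4 * (2 * M))) := by
        field_simp; norm_num
      rw [this] at s3
      have h5 : E⁻¹ * (1 / (2 * M)) = E ^ 3 * (1 / (E ^ 4 * (2 * M))) := by field_simp
      rw [h5] at s3
      exact le_of_mul_le_mul_right s3 (by positivity)
    have : E ^ 2 ≤ E ^ 3 := pow_le_pow_right₀ hE1 (by norm_num)
    linarith
  have htend : Tendsto (fun M : ℕ => Real.exp (l * M) / (l * M)) atTop atTop := by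
    have h := Real.tendsto_exp_div_pow_atTop 1
    have h2 : Tendsto (fun M : ℕ => l * (M : ℝ)) atTop atTop :=
      tendsto_natCast_atTop_atTop.const_mul_atTop hl0
    simpa [Function.comp_def] using h.comp h2
  have := htend.eventually_gt_atTop (4 * B / c0 / l)
  obtain ⟨M, hM1, hM2, hM3⟩ := (this.and ((eventually_ge_atTop n0).and (eventually_gt_atTop 0))).exists
  have hMr : (0 : ℝ) < M := by exact_mod_cast hM3
  have h := fin M hM2 hM3
  rw [lt_div_iff₀ (by positivity)] at hM1
  have : 4 * B / c0 / l * (l * M) = 4 * B / c0 * M := by field_simp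
  linarith

lemma fab_radius (a : ℕ → ℂ) (R : ℝ) (hR : 0 < R)
    (hconv : ∀ r : ℝ, 0 ≤ r → r < R → Summable fun n => ‖a n‖ * r ^ n)
    (hdiv : ∀ r : ℝ, R < r → ¬ Summable fun n => ‖a n‖ * r ^ n)
    (x₀ : ℂ) (hne : ∀ᶠ n in atTop, a (n + 1) ≠ 0)
    (hratio : Tendsto (fun n => a n / a (n + 1)) atTop (nhds x₀)) : ‖x₀‖ = R := by
  have hn := hratio.norm
  rcases lt_trichotomy ‖x₀‖ R with h | h | h
  · exfalso
    obtain ⟨r, hr1, hr2⟩ := exists_between h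
    have hr0 : 0 < r := (norm_nonneg _).trans_lt hr1
    have e : ∀ᶠ n in atTop, ‖a n‖ * r ^ n ≤ ‖a (n + 1)‖ * r ^ (n + 1) := by
      filter_upwards [hne, hn.eventually_le_const hr1] with n h1 h2
      rw [norm_div, div_le_iff₀ (norm_pos_iff.mpr h1)] at h2
      calc _ ≤ r * ‖a (n + 1)‖ * r ^ n := by gcongr
        _ = _ := by ring
    obtain ⟨n0, hn0⟩ := eventually_atTop.mp (hne.and e)
    have hm : ∀ n, n0 + 1 ≤ n → ‖a (n0 + 1)‖ * r ^ (n0 + 1) ≤ ‖a n‖ * r ^ n := by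
      intro n hn
      induction n, hn using Nat.le_induction with
      | base => exact le_rfl
      | succ n hn ih => exact ih.trans (hn0 n (by omega)).2
    have hpos : 0 < ‖a (n0 + 1)‖ * r ^ (n0 + 1) := by
      have := norm_pos_iff.mpr (hn0 n0 le_rfl).1
      positivity
    have ht := (hconv r hr0.le hr2).tendsto_atTop_zero
    have := ge_of_tendsto ht (eventually_atTop.mpr ⟨n0 + 1, hm⟩)
    linarith
  · exact h
  · exfalso
    obtain ⟨r', hr1', hr2'⟩ := exists_between h
    obtain ⟨r, hr1, hr2⟩ := exists_between hr1'
    have hr0 : 0 < r := hR.trans hr1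
    have hr0' : 0 < r' := hR.trans hr1'
    apply hdiv r hr1
    apply summable_of_ratio_norm_eventually_le (r := r / r') ((div_lt_one hr0').mpr hr2)
    filter_upwards [hne, hn.eventually_const_le hr2'] with n h1 h2
    rw [norm_div, le_div_iff₀ (norm_pos_iff.mpr h1)] at h2
    simp only [norm_mul, norm_norm, norm_pow, Real.norm_eq_abs, abs_of_pos hr0, abs_norm]
    calc ‖a (n + 1)‖ * r ^ (n + 1) = r / r' * ((r' * ‖a (n + 1)‖) * r ^ n) := by
          field_simp; ring
      _ ≤ _ := by gcongr

/-- Fabry's ratio theorem: if `a n / a (n+1) → x₀` then `‖x₀‖ = R` and `x₀` is a singular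
point of the sum `f` of the series, i.e. `f` extends holomorphically to no neighborhood
of `x₀`. -/
theorem stmt16 (a : ℕ → ℂ) (R : ℝ) (hR : 0 < R)
    (hconv : ∀ r : ℝ, 0 ≤ r → r < R → Summable fun n => ‖a n‖ * r ^ n)
    (hdiv : ∀ r : ℝ, R < r → ¬ Summable fun n => ‖a n‖ * r ^ n)
    (x₀ : ℂ) (hne : ∀ᶠ n in atTop, a (n + 1) ≠ 0)
    (hratio : Tendsto (fun n => a n / a (n + 1)) atTop (nhds x₀)) :
    ‖x₀‖ = R ∧
    ¬ ∃ (U : Set ℂ) (g : ℂ → ℂ), IsOpen U ∧ x₀ ∈ U ∧ DifferentiableOn ℂ g U ∧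
        ∀ z ∈ U, ‖z‖ < R → g z = ∑' n, a n * z ^ n := by
  have hx : ‖x₀‖ = R := fab_radius a R hR hconv hdiv x₀ hne hratio
  refine ⟨hx, ?_⟩
  rintro ⟨U, g, hU, hxU, hg, hgf⟩
  have hx0 : x₀ ≠ 0 := norm_pos_iff.mp (by rw [hx]; exact hR)
  have hc : Continuous (fun z : ℂ => x₀ * z) := by fun_prop
  apply fab_main (fun n => a n * x₀ ^ n) ?_ ?_ ?_ ((fun z => x₀ * z) ⁻¹' U) (fun z => g (x₀ * z))
    (hU.preimage hc) (by simpa using hxU) ?_ ?_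
  · intro r hr0 hr1
    convert hconv (R * r) (by positivity) (by nlinarith) using 2 with n
    rw [norm_mul, norm_pow, hx, mul_pow]; ring
  · obtain ⟨n0, h0⟩ := eventually_atTop.mp hne
    refine eventually_atTop.mpr ⟨n0 + 1, fun n hn => ?_⟩
    obtain ⟨k, rfl⟩ : ∃ k, n = k + 1 := ⟨n - 1, by omega⟩
    exact mul_ne_zero (h0 k (by omega)) (pow_ne_zero _ hx0)
  · have := hratio.div_const x₀
    rw [div_self hx0] at this
    refine this.congr fun n => ?_
    rw [pow_succ, div_div, mul_comm (x₀ ^ n), ← mul_assoc, mul_div_mul_right _ _ (pow_ne_zero n hx0)]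
  · apply hg.comp (by fun_prop)
    intro z hz; exact hz
  · intro z hz hz1
    rw [hgf (x₀ * z) hz (by rw [norm_mul, hx]; nlinarith)]
    refine tsum_congr fun n => ?_
    rw [mul_pow]; ring
end

section
/- There exists a power series with radius of convergence 1 having exactly one singular point on the unit circle, for which the ratio a_n/a_{n+1} of consecutive coefficients does not converge; e.g. suitable lacunary modifications show statement (1) of Hadamard's trichotomy is false: 'if x_0 is the only singularity on the circle of convergence, then a_n/a_{n+1} → x_0' does not hold in general. -/
open Filter

lemma aux_pow (k : ℕ) : ∃ q : ℕ → ℝ,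
    (∀ n : ℕ, (n : ℝ) ^ k = ∑ j ∈ Finset.range (k + 1), q j * ((n + j).choose j : ℝ)) ∧
    ∑ j ∈ Finset.range (k + 1), |q j| ≤ 2 ^ k * (k.factorial : ℝ) := by
  induction k with
  | zero => exact ⟨fun _ => 1, by simp, by simp⟩
  | succ k ih =>
    obtain ⟨q, hq, hb⟩ := ih
    have hS : ∀ (A B : ℕ → ℝ), A 0 = 0 → B (k + 1) = 0 →
        ∑ j ∈ Finset.range (k + 2), (A j + B j)
          = ∑ j ∈ Finset.range (k + 1), (A (j + 1) + B j) := by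
      intro A B hA hB
      rw [Finset.sum_add_distrib, Finset.sum_add_distrib, Finset.sum_range_succ' A,
        Finset.sum_range_succ B, hA, hB]
      ring
    let A : ℕ → ℝ := fun j => j * q (j - 1)
    let B : ℕ → ℝ := fun j => if j ≤ k then -((j + 1) * q j) else 0
    have hBk : B (k + 1) = 0 := by simp [B]
    have hA0 : A 0 = 0 := by simp [A]
    have hBj : ∀ j ∈ Finset.range (k + 1), B j = -((j + 1) * q j) := by
      intro j hj
      have : j ≤ k := by simpa [Nat.lt_succ_iff] using hj
      simp [B, this]
    refine ⟨fun j => A j + B j, ?_, ?_⟩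
    · intro n
      simp only [add_mul]
      rw [hS (fun j => A j * ((n + j).choose j : ℝ)) (fun j => B j * ((n + j).choose j : ℝ))
        (by simp [hA0]) (by simp [hBk]), pow_succ, hq n, Finset.sum_mul]
      refine Finset.sum_congr rfl fun j hj => ?_
      rw [hBj j hj]
      have h1 : ((n + (j + 1)).choose (j + 1) : ℝ) * (j + 1) = (n + j + 1) * ((n + j).choose j) := by
        have := Nat.add_one_mul_choose_eq (n + j) j
        rw [← add_assoc]
        exact_mod_cast this.symm
      simp only [A, Nat.add_sub_cancel]
      push_cast
      linear_combination (-q j) * h1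
    · calc ∑ j ∈ Finset.range (k + 2), |A j + B j|
          ≤ ∑ j ∈ Finset.range (k + 2), (|A j| + |B j|) :=
            Finset.sum_le_sum fun j _ => abs_add_le _ _
        _ = ∑ j ∈ Finset.range (k + 1), (|A (j + 1)| + |B j|) :=
            hS (fun j => |A j|) (fun j => |B j|) (by simp [hA0]) (by simp [hBk])
        _ ≤ ∑ j ∈ Finset.range (k + 1), (2 * (k + 1)) * |q j| := by
            refine Finset.sum_le_sum fun j hj => ?_
            rw [hBj j hj]
            simp only [A, Nat.add_sub_cancel, abs_neg, abs_mul]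
            have : (j : ℝ) ≤ k := by
              have : j ≤ k := by simpa [Nat.lt_succ_iff] using hj
              exact_mod_cast this
            have h0 : |((j + 1 : ℕ) : ℝ)| = j + 1 := by
              rw [abs_of_nonneg (by positivity)]; push_cast; ring
            have h1 : |(j : ℝ) + 1| = j + 1 := abs_of_nonneg (by positivity)
            rw [h0, h1]
            nlinarith [abs_nonneg (q j)]
        _ = 2 * (k + 1) * ∑ j ∈ Finset.range (k + 1), |q j| := by rw [Finset.mul_sum]
        _ ≤ 2 * (k + 1) * (2 ^ k * (k.factorial : ℝ)) := by gcongr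
        _ = _ := by rw [Nat.factorial_succ]; push_cast; ring

lemma aux_R (k : ℕ) : ∃ R : ℂ → ℂ, Differentiable ℂ R ∧
    (∀ (M : ℝ) (w : ℂ), 1 ≤ M → ‖w‖ ≤ M → ‖R w‖ ≤ 2 ^ k * (k.factorial : ℝ) * M ^ (k + 1)) ∧
    (∀ z : ℂ, ‖z‖ < 1 → HasSum (fun n : ℕ => (n : ℂ) ^ k * z ^ n) (R (1 - z)⁻¹)) := by
  obtain ⟨q, hq, hb⟩ := aux_pow k
  refine ⟨fun w => ∑ j ∈ Finset.range (k + 1), (q j : ℂ) * w ^ (j + 1), by fun_prop, ?_, ?_⟩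
  · intro M w hM hw
    refine (norm_sum_le _ _).trans ?_
    calc _ ≤ ∑ j ∈ Finset.range (k + 1), |q j| * M ^ (k + 1) := by
          refine Finset.sum_le_sum fun j hj => ?_
          rw [norm_mul, norm_pow, Complex.norm_real, Real.norm_eq_abs]
          have hjk : j + 1 ≤ k + 1 := by simpa using hj
          gcongr
          exact (pow_le_pow_left₀ (norm_nonneg _) hw _).trans (pow_le_pow_right₀ hM hjk)
      _ ≤ _ := by rw [← Finset.sum_mul]; gcongr
  · intro z hz
    have := hasSum_sum (s := Finset.range (k + 1)) (fun j _ =>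
      (hasSum_choose_mul_geometric_of_norm_lt_one j hz).mul_left (q j : ℂ))
    convert! this using 1
    · funext n
      have h := congrArg (fun x : ℝ => (x : ℂ)) (hq n)
      push_cast at h
      rw [h, Finset.sum_mul]
      exact Finset.sum_congr rfl fun j _ => by ring
    · simp

lemma aux_F : ∃ F : ℂ → ℂ, DifferentiableOn ℂ F {1}ᶜ ∧ ∀ z : ℂ, ‖z‖ < 1 →
    F z = ∑' n : ℕ, ((Real.cos (Real.pi * √(n : ℝ)) : ℝ) : ℂ) * z ^ n := by
  choose R hRd hRb hRs using aux_R
  let c : ℕ → ℂ := fun k => (-1) ^ k * (Real.pi : ℂ) ^ (2 * k) / ((2 * k).factorial : ℂ)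
  let u : ℝ → ℕ → ℝ := fun M k => M * ((2 * Real.pi ^ 2 * M) ^ k / (k.factorial : ℝ))
  have hu : ∀ M, Summable (u M) := fun M => (Real.summable_pow_div_factorial _).mul_left M
  have hcn : ∀ k, ‖c k‖ = Real.pi ^ (2 * k) / ((2 * k).factorial : ℝ) := by
    intro k
    simp [c, abs_of_pos Real.pi_pos]
  have hub : ∀ (M : ℝ) (w : ℂ) (k : ℕ), 1 ≤ M → ‖w‖ ≤ M → ‖c k * R k w‖ ≤ u M k := by
    intro M w k hM hw
    have h1 := hRb k M w hM hw
    have hf : (k.factorial : ℝ) * k.factorial ≤ (2 * k).factorial := by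
      have := Nat.le_of_dvd (Nat.factorial_pos _) (Nat.factorial_mul_factorial_dvd_factorial_add k k)
      rw [two_mul]
      exact_mod_cast this
    have hk : (0 : ℝ) < k.factorial := by positivity
    rw [norm_mul, hcn]
    calc _ ≤ Real.pi ^ (2 * k) / ((k.factorial : ℝ) * k.factorial)
            * (2 ^ k * (k.factorial : ℝ) * M ^ (k + 1)) := by gcongr
      _ = u M k := by
        simp only [u]
        field_simp
        ring
  have hh : Differentiable ℂ (fun w => ∑' k, c k * R k w) := by
    intro w
    have : DifferentiableOn ℂ (fun w => ∑' k, c k * R k w) (Metric.ball 0 (‖w‖ + 1)) := by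
      refine Complex.differentiableOn_tsum_of_summable_norm (hu (‖w‖ + 1))
        (fun k => ((hRd k).const_mul _).differentiableOn) Metric.isOpen_ball ?_
      intro k v hv
      refine hub _ _ _ (by linarith [norm_nonneg w]) ?_
      exact (mem_ball_zero_iff.mp hv).le
    exact this.differentiableAt (Metric.isOpen_ball.mem_nhds (by simp))
  refine ⟨fun z => ∑' k, c k * R k (1 - z)⁻¹, ?_, ?_⟩
  · intro z hz
    have hz' : 1 - z ≠ 0 := by
      intro h
      exact hz (by simp [sub_eq_zero.mp h])
    have h2 : DifferentiableAt ℂ (fun z : ℂ => (1 - z)⁻¹) z := by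
      fun_prop (disch := exact hz')
    exact ((hh _).comp z h2).differentiableWithinAt
  · intro z hz
    let f : ℕ → ℕ → ℂ := fun k n => c k * ((n : ℂ) ^ k * z ^ n)
    have hfs : Summable (Function.uncurry f) := by
      apply Summable.of_norm
      have hz1 : ‖((‖z‖ : ℝ) : ℂ)‖ < 1 := by simpa using hz
      have hn : ∀ k n, ‖f k n‖ = ‖c k‖ * ((n : ℝ) ^ k * ‖z‖ ^ n) := by
        intro k n; simp [f]
      have hR : ∀ k, HasSum (fun n : ℕ => (n : ℝ) ^ k * ‖z‖ ^ n)
          (R k (1 - ((‖z‖ : ℝ) : ℂ))⁻¹).re := by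
        intro k
        have := Complex.hasSum_re (hRs k _ hz1)
        convert this using 1
        funext n
        norm_cast
      rw [summable_prod_of_nonneg (fun _ => norm_nonneg _)]
      simp only [Function.uncurry, hn]
      refine ⟨fun k => (hR k).summable.mul_left _, ?_⟩
      have h1 : 1 ≤ max 1 ‖(1 - ((‖z‖ : ℝ) : ℂ))⁻¹‖ := le_max_left _ _
      refine Summable.of_nonneg_of_le (fun k => tsum_nonneg fun n => by positivity) ?_
        (hu (max 1 ‖(1 - ((‖z‖ : ℝ) : ℂ))⁻¹‖))
      intro k
      rw [((hR k).mul_left _).tsum_eq]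
      refine le_trans ?_ (hub _ _ k h1 (le_max_right _ _))
      rw [norm_mul]
      gcongr
      exact Complex.re_le_norm _
    have hcomm := hfs.tsum_comm
    calc _ = ∑' k, ∑' n, f k n := by
          refine tsum_congr fun k => ?_
          exact (((hRs k z hz).mul_left (c k)).tsum_eq).symm
      _ = ∑' n, ∑' k, f k n := hcomm.symm
      _ = _ := by
          refine tsum_congr fun n => ?_
          have h := (Complex.hasSum_ofReal.mpr (Real.hasSum_cos (Real.pi * √(n : ℝ)))).mul_right (z ^ n)
          rw [← h.tsum_eq]
          refine tsum_congr fun k => ?_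
          have hs : (√(n : ℝ)) ^ (2 * k) = (n : ℝ) ^ k := by
            rw [pow_mul, Real.sq_sqrt (by positivity)]
          simp only [f, c]
          rw [mul_pow, hs]
          push_cast
          ring

lemma aux_sq (m : ℕ) : Real.cos (Real.pi * √((m ^ 2 : ℕ) : ℝ)) = (-1) ^ m := by
  push_cast
  rw [Real.sqrt_sq (by positivity), mul_comm, Real.cos_nat_mul_pi]

lemma aux_not_zero : ¬ Tendsto (fun n : ℕ => ‖((Real.cos (Real.pi * √(n : ℝ)) : ℝ) : ℂ)‖)
    atTop (nhds 0) := by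
  intro h
  have h2 := h.comp (tendsto_pow_atTop (α := ℕ) two_ne_zero)
  have h3 : ((fun n : ℕ => ‖((Real.cos (Real.pi * √(n : ℝ)) : ℝ) : ℂ)‖) ∘ fun m : ℕ => m ^ 2)
      = fun _ => (1 : ℝ) := by
    funext m
    simp only [Function.comp]
    rw [aux_sq]
    simp
  rw [h3] at h2
  exact zero_ne_one (tendsto_nhds_unique h2 tendsto_const_nhds)

lemma aux_ratio : ¬ ∃ L : ℂ, Tendsto (fun n : ℕ => ((Real.cos (Real.pi * √(n : ℝ)) : ℝ) : ℂ) /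
    ((Real.cos (Real.pi * √((n + 1 : ℕ) : ℝ)) : ℝ) : ℂ)) atTop (nhds L) := by
  rintro ⟨L, hL⟩
  let b : ℕ → ℝ := fun n => Real.cos (Real.pi * √(n : ℝ))
  have hb : Tendsto (fun n => b n / b (n + 1)) atTop (nhds L.re) := by
    have := (Complex.continuous_re.tendsto L).comp hL
    convert this using 1
    funext n
    simp only [Function.comp, b]
    norm_cast
  have hsub : Tendsto (fun m : ℕ => b (m ^ 2) / b (m ^ 2 + 1)) atTop (nhds 1) := by
    have hd : Tendsto (fun m : ℕ => √((m : ℝ) ^ 2 + 1) - m) atTop (nhds 0) := by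
      refine tendsto_of_tendsto_of_tendsto_of_le_of_le' tendsto_const_nhds
        tendsto_one_div_atTop_nhds_zero_nat ?_ ?_
      · filter_upwards with m
        have : (m : ℝ) ≤ √((m : ℝ) ^ 2 + 1) := Real.le_sqrt_of_sq_le (by linarith)
        linarith
      · filter_upwards [eventually_gt_atTop 0] with m hm
        have hm' : (0 : ℝ) < m := by exact_mod_cast hm
        have : √((m : ℝ) ^ 2 + 1) ≤ m + 1 / m := by
          apply Real.sqrt_le_iff.mpr ⟨by positivity, ?_⟩
          have : ((m : ℝ) + 1 / m) ^ 2 = m ^ 2 + 2 + (1 / m) ^ 2 := by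
            field_simp
            ring
          rw [this]
          nlinarith [sq_nonneg (1 / (m : ℝ))]
        linarith
    have h1 : Tendsto (fun m : ℕ => 1 / Real.cos (Real.pi * (√((m : ℝ) ^ 2 + 1) - m))) atTop
        (nhds (1 / Real.cos (Real.pi * 0))) :=
      tendsto_const_nhds.div ((Real.continuous_cos.tendsto _).comp (hd.const_mul _)) (by simp)
    simp only [mul_zero, Real.cos_zero, div_one] at h1
    refine h1.congr fun m => ?_
    have e1 : b (m ^ 2) = (-1) ^ m := aux_sq m
    have e2 : b (m ^ 2 + 1) = (-1) ^ m * Real.cos (Real.pi * (√((m : ℝ) ^ 2 + 1) - m)) := by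
      simp only [b]
      rw [← Real.cos_add_nat_mul_pi]
      push_cast
      congr 1
      ring
    rw [e1, e2]
    have : ((-1 : ℝ)) ^ m ≠ 0 := by simp
    field_simp
  have hL1 : L.re = 1 :=
    tendsto_nhds_unique (hb.comp (tendsto_pow_atTop (α := ℕ) two_ne_zero)) hsub
  rw [hL1] at hb
  obtain ⟨N, hN⟩ := eventually_atTop.mp (hb.eventually (lt_mem_nhds (zero_lt_one)))
  have hpos : ∀ n, N ≤ n → 0 < b n * b (n + 1) := by
    intro n hn
    have h := hN n hn
    rcases div_pos_iff.mp h with ⟨h1, h2⟩ | ⟨h1, h2⟩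
    · exact mul_pos h1 h2
    · exact mul_pos_of_neg_of_neg h1 h2
  have hall : ∀ M n, N ≤ M → M ≤ n → 0 < b M * b n := by
    intro M n hM hn
    induction n, hn using Nat.le_induction with
    | base =>
      have := hpos M hM
      have : b M ≠ 0 := by rintro h; simp [h] at this
      exact mul_self_pos.mpr this
    | succ n hn ih =>
      have h1 := hpos n (hM.trans hn)
      have h2 := mul_pos ih h1
      have h3 : b M * b n * (b n * b (n + 1)) = (b n) ^ 2 * (b M * b (n + 1)) := by ring
      rw [h3] at h2
      exact pos_of_mul_pos_right h2 (sq_nonneg _)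
  have := hall (N ^ 2) ((N + 1) ^ 2) (by nlinarith [sq_nonneg N, Nat.le_self_pow two_ne_zero N]) (by gcongr; omega)
  simp only [b] at this
  rw [aux_sq, aux_sq, pow_succ, ← mul_assoc, ← mul_pow] at this
  norm_num at this

lemma aux_sing : ¬ ∃ (U : Set ℂ) (g : ℂ → ℂ), IsOpen U ∧ (1 : ℂ) ∈ U ∧ DifferentiableOn ℂ g U ∧
    ∀ z ∈ U, ‖z‖ < 1 → g z = ∑' n : ℕ, ((Real.cos (Real.pi * √(n : ℝ)) : ℝ) : ℂ) * z ^ n := by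
  rintro ⟨U, g, hU, h1U, hg, hgs⟩
  obtain ⟨F, hF, hFs⟩ := aux_F
  obtain ⟨ε, hε, hεU⟩ := Metric.isOpen_iff.mp hU 1 h1U
  have hV : IsOpen (Metric.ball (1 : ℂ) ε ∩ {1}ᶜ) := Metric.isOpen_ball.inter isOpen_compl_singleton
  have hVc : IsPreconnected (Metric.ball (1 : ℂ) ε ∩ {1}ᶜ) := by
    have : Metric.ball (1 : ℂ) ε ∩ {1}ᶜ
        = (fun s : ℂ => 1 + Complex.exp s) '' {s | s.re < Real.log ε} := by
      ext z
      simp only [Set.mem_inter_iff, Metric.mem_ball, Set.mem_compl_iff, Set.mem_singleton_iff,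
        Set.mem_image, Set.mem_ofPred_eq, dist_eq_norm]
      constructor
      · rintro ⟨h1, h2⟩
        have h3 : z - 1 ≠ 0 := sub_ne_zero.mpr h2
        refine ⟨Complex.log (z - 1), ?_, by rw [Complex.exp_log h3]; ring⟩
        rw [Complex.log_re]
        exact Real.log_lt_log (norm_pos_iff.mpr h3) h1
      · rintro ⟨s, hs, rfl⟩
        refine ⟨?_, by simp [Complex.exp_ne_zero]⟩
        simp only [add_sub_cancel_left, Complex.norm_exp]
        exact (Real.lt_log_iff_exp_lt hε).mp hs
    rw [this]
    refine IsPreconnected.image ?_ _ (by fun_prop)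
    exact (convex_halfSpace_re_lt _).isPreconnected
  have hFV : AnalyticOnNhd ℂ F (Metric.ball (1 : ℂ) ε ∩ {1}ᶜ) :=
    (hF.mono Set.inter_subset_right).analyticOnNhd hV
  have hgV : AnalyticOnNhd ℂ g (Metric.ball (1 : ℂ) ε ∩ {1}ᶜ) :=
    (hg.mono (Set.inter_subset_left.trans hεU)).analyticOnNhd hV
  let δ : ℝ := min (ε / 2) 1
  have hδ : 0 < δ := by positivity
  have hδ1 : δ ≤ 1 := min_le_right _ _
  have hδ2 : δ ≤ ε / 2 := min_le_left _ _
  let z₀ : ℂ := ((1 - δ : ℝ) : ℂ)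
  have hz₀n : ‖z₀‖ < 1 := by
    simp only [z₀, Complex.norm_real, Real.norm_eq_abs]
    rw [abs_of_nonneg (by linarith)]
    linarith
  have hz₀ : z₀ ∈ Metric.ball (1 : ℂ) ε ∩ {1}ᶜ := by
    constructor
    · have : z₀ - 1 = ((-δ : ℝ) : ℂ) := by simp [z₀]
      rw [Metric.mem_ball, dist_eq_norm, this, Complex.norm_real, Real.norm_eq_abs, abs_neg,
        abs_of_pos hδ]
      linarith
    · intro h
      rw [Set.mem_singleton_iff] at h
      rw [h] at hz₀n
      simp at hz₀n
  have hev : F =ᶠ[nhds z₀] g := by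
    have hm : Metric.ball (1 : ℂ) ε ∩ {1}ᶜ ∈ nhds z₀ := hV.mem_nhds hz₀
    have hb : Metric.ball (0 : ℂ) 1 ∈ nhds z₀ :=
      Metric.isOpen_ball.mem_nhds (by simpa using hz₀n)
    filter_upwards [hm, hb] with z h1 h2
    have h3 : ‖z‖ < 1 := by simpa using h2
    rw [hFs z h3, hgs z (hεU h1.1) h3]
  have heq := hFV.eqOn_of_preconnected_of_eventuallyEq hgV hVc hz₀ hev
  let E : ℂ → ℂ := Function.update F 1 (g 1)
  have hE1 : ∀ z, z ≠ 1 → E z = F z := fun z hz => Function.update_of_ne hz _ _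
  have hE : Differentiable ℂ E := by
    intro z
    by_cases hz : z = 1
    · subst hz
      have h1 : DifferentiableAt ℂ g 1 := hg.differentiableAt (hU.mem_nhds h1U)
      refine h1.congr_of_eventuallyEq ?_
      filter_upwards [Metric.ball_mem_nhds (1 : ℂ) hε] with w hw
      by_cases hw1 : w = 1
      · subst hw1; simp [E]
      · rw [hE1 w hw1]
        exact heq ⟨hw, hw1⟩
    · have h1 : DifferentiableAt ℂ F z := hF.differentiableAt (isOpen_compl_singleton.mem_nhds hz)
      refine h1.congr_of_eventuallyEq ?_
      filter_upwards [isOpen_compl_singleton.mem_nhds hz] with w hw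
      exact hE1 w hw
  have hP := hE.hasFPowerSeriesOnBall 0 (R := 1) one_pos
  have hQ : HasFPowerSeriesAt E (FormalMultilinearSeries.ofScalars ℂ
      (fun n : ℕ => ((Real.cos (Real.pi * √(n : ℝ)) : ℝ) : ℂ))) 0 := by
    rw [hasFPowerSeriesAt_iff]
    filter_upwards [Metric.ball_mem_nhds (0 : ℂ) one_pos] with z hz
    have hz' : ‖z‖ < 1 := by simpa using hz
    have hne : z ≠ 1 := by rintro rfl; simp at hz'
    have hsm : Summable fun n : ℕ => ((Real.cos (Real.pi * √(n : ℝ)) : ℝ) : ℂ) * z ^ n := by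
      refine Summable.of_norm_bounded (summable_geometric_of_lt_one (norm_nonneg z) hz') ?_
      intro n
      rw [norm_mul, norm_pow, Complex.norm_real, Real.norm_eq_abs]
      exact mul_le_of_le_one_left (by positivity) (Real.abs_cos_le_one _)
    rw [zero_add, hE1 z hne, hFs z hz']
    convert! hsm.hasSum using 1
    funext n
    rw [FormalMultilinearSeries.coeff_ofScalars, smul_eq_mul, mul_comm]
  have hpq := hP.hasFPowerSeriesAt.eq_formalMultilinearSeries hQ
  rw [hpq] at hP
  have hs := hP.hasSum (y := 1) (by simp)
  have ht := hs.summable.tendsto_atTop_zero.norm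
  simp only [norm_zero] at ht
  apply aux_not_zero
  refine ht.congr fun n => ?_
  simp [FormalMultilinearSeries.ofScalars, List.ofFn_const]


/-- There is a power series of radius `1` with exactly one singular point on the unit
circle whose ratio of consecutive coefficients has no limit. -/
theorem stmt17 :
    ∃ a : ℕ → ℂ,
      (∀ r : ℝ, 0 ≤ r → r < 1 → Summable fun n => ‖a n‖ * r ^ n) ∧
      (∀ r : ℝ, 1 < r → ¬ Summable fun n => ‖a n‖ * r ^ n) ∧
      (∃! ζ : ℂ, ‖ζ‖ = 1 ∧
        ¬ ∃ (U : Set ℂ) (g : ℂ → ℂ), IsOpen U ∧ ζ ∈ U ∧ DifferentiableOn ℂ g U ∧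
            ∀ z ∈ U, ‖z‖ < 1 → g z = ∑' n, a n * z ^ n) ∧
      ¬ ∃ L : ℂ, Tendsto (fun n => a n / a (n + 1)) atTop (nhds L) := by
  refine ⟨fun n => ((Real.cos (Real.pi * √(n : ℝ)) : ℝ) : ℂ), ?_, ?_, ?_, aux_ratio⟩
  · intro r h0 h1
    refine Summable.of_nonneg_of_le (fun n => by positivity) (fun n => ?_)
      (summable_geometric_of_lt_one h0 h1)
    rw [Complex.norm_real, Real.norm_eq_abs]
    exact mul_le_of_le_one_left (by positivity) (Real.abs_cos_le_one _)
  · intro r hr hs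
    apply aux_not_zero
    refine squeeze_zero (fun n => norm_nonneg _) (fun n => ?_) hs.tendsto_atTop_zero
    exact le_mul_of_one_le_right (norm_nonneg _) (one_le_pow₀ hr.le)
  · refine ⟨1, ⟨by simp, aux_sing⟩, ?_⟩
    rintro ζ ⟨-, h⟩
    by_contra hne
    obtain ⟨F, hF, hFs⟩ := aux_F
    exact h ⟨{1}ᶜ, F, isOpen_compl_singleton, hne, hF, fun z _ hz => hFs z hz⟩
end

section
/- Let f be analytic at 0 and meromorphic in |z| < τ with exactly ν poles (with multiplicity) in |z| < τ, and suppose |α_ν| < |α_{ν+1}| where α_{ν+1} is (the modulus of) the nearest singularity of f beyond |α_ν| (so τ = |α_{ν+1}|). Then for each fixed z with |z| < τ that is not a pole of f, the error f(z) − [n/ν](z) satisfies limsup_{n→∞} |f(z) − [n/ν](z)|^{1/n} ≤ |z|/τ; in particular the convergence of the row sequence ([n/ν])_n to f is geometric on compact subsets of the punctured disk. -/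
open Filter Polynomial

/-- Taylor partial sum at `0`. -/
noncomputable def tay (N : ℕ) (F : ℂ → ℂ) (z : ℂ) : ℂ :=
  ∑ k ∈ Finset.range N, ((k.factorial : ℂ)⁻¹ * iteratedDeriv k F 0) * z ^ k

lemma tay_bound {τ r : ℝ} {F : ℂ → ℂ} (hF : DifferentiableOn ℂ F (Metric.ball 0 τ))
    (hr : 0 < r) (hrτ : r < τ) :
    ∃ C > 0, ∀ z : ℂ, ‖z‖ < r → ∀ N : ℕ, ‖F z - tay N F z‖ ≤ C * (‖z‖ / r) ^ N := by
  obtain ⟨r', h1, h2⟩ := exists_between hrτ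
  have hr' : 0 < r' := hr.trans h1
  lift r' to NNReal using hr'.le
  lift r to NNReal using hr.le
  have H := (hF.mono (Metric.closedBall_subset_ball h2)).hasFPowerSeriesOnBall (by exact_mod_cast hr')
  obtain ⟨a, ha, C, hC, h⟩ := H.uniform_geometric_approx' (r' := r) (by exact_mod_cast h1)
  refine ⟨C, hC, fun z hz N => ?_⟩
  have := h z (by simpa using hz) N
  have e : (cauchyPowerSeries F 0 r').partialSum N z = tay N F z := by
    unfold FormalMultilinearSeries.partialSum tay
    refine Finset.sum_congr rfl fun k _ => ?_
    have h3 := H.factorial_smul z k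
    rw [iteratedFDeriv_apply_eq_iteratedDeriv_mul_prod] at h3
    simp only [nsmul_eq_mul, Finset.prod_const, smul_eq_mul, Finset.card_univ,
      Fintype.card_fin] at h3
    have hk : (k.factorial : ℂ) ≠ 0 := by exact_mod_cast k.factorial_ne_zero
    rw [mul_assoc, mul_comm (iteratedDeriv _ _ _), ← h3]
    field_simp
  rw [e, zero_add] at this
  refine this.trans ?_
  have h0 : 0 ≤ a * (‖z‖ / r) := mul_nonneg ha.1.le (div_nonneg (norm_nonneg _) hr.le)
  gcongr
  exact mul_le_of_le_one_left (div_nonneg (norm_nonneg _) hr.le) ha.2.le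

lemma iteratedDeriv_poly (p : ℂ[X]) (k : ℕ) :
    iteratedDeriv k (fun z => p.eval z) = fun z => ((derivative^[k]) p).eval z := by
  induction k with
  | zero => simp
  | succ k ih =>
    rw [iteratedDeriv_succ, ih, Function.iterate_succ_apply']
    ext z
    simp

lemma tay_poly (p : ℂ[X]) (N : ℕ) (h : p.natDegree < N) (z : ℂ) :
    tay N (fun z => p.eval z) z = p.eval z := by
  unfold tay
  rw [Polynomial.eval_eq_sum_range' h]
  refine Finset.sum_congr rfl fun k _ => ?_
  rw [iteratedDeriv_poly]
  simp only [← coeff_zero_eq_eval_zero, coeff_iterate_derivative]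
  have hk : (k.factorial : ℂ) ≠ 0 := by exact_mod_cast k.factorial_ne_zero
  simp only [zero_add, Nat.descFactorial_self, nsmul_eq_mul]
  field_simp

lemma tay_sub {F G : ℂ → ℂ} (hF : AnalyticAt ℂ F 0) (hG : AnalyticAt ℂ G 0) (N : ℕ) (z : ℂ) :
    tay N (fun z => F z - G z) z = tay N F z - tay N G z := by
  unfold tay
  rw [← Finset.sum_sub_distrib]
  refine Finset.sum_congr rfl fun k _ => ?_
  rw [iteratedDeriv_fun_sub hF.contDiffAt hG.contDiffAt]
  ring

lemma tay_sum {ι : Type*} (s : Finset ι) (c : ι → ℂ) {F : ι → ℂ → ℂ}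
    (hF : ∀ i, AnalyticAt ℂ (F i) 0) (N : ℕ) (z : ℂ) :
    tay N (fun z => ∑ i ∈ s, c i * F i z) z = ∑ i ∈ s, c i * tay N (F i) z := by
  unfold tay
  simp_rw [Finset.mul_sum]
  rw [Finset.sum_comm]
  refine Finset.sum_congr rfl fun k _ => ?_
  rw [iteratedDeriv_fun_sum (f := fun i z => c i * F i z)
      (fun i _ => (analyticAt_const.mul (hF i)).contDiffAt),
    Finset.mul_sum, Finset.sum_mul]
  refine Finset.sum_congr rfl fun i _ => ?_
  rw [iteratedDeriv_const_mul_field]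
  ring

lemma tay_zero {F : ℂ → ℂ} {N : ℕ} (h : ∀ k < N, iteratedDeriv k F 0 = 0) (z : ℂ) :
    tay N F z = 0 := by
  unfold tay
  refine Finset.sum_eq_zero fun k hk => ?_
  rw [h k (Finset.mem_range.1 hk)]; simp

lemma match_mul {H K D : ℂ → ℂ} (hH : AnalyticAt ℂ H 0) (hK : AnalyticAt ℂ K 0)
    (hD : D =ᶠ[nhds 0] fun z => K z * H z) {N : ℕ} (h : ∀ k < N, iteratedDeriv k H 0 = 0) :
    ∀ k < N, iteratedDeriv k D 0 = 0 := by
  have hDa : AnalyticAt ℂ D 0 := (hK.mul hH).congr hD.symm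
  rw [← natCast_le_analyticOrderAt_iff_iteratedDeriv_eq_zero hDa, analyticOrderAt_congr hD]
  rw [← natCast_le_analyticOrderAt_iff_iteratedDeriv_eq_zero hH] at h
  have := analyticOrderAt_mul hK hH
  calc (N : ℕ∞) ≤ _ := h
    _ ≤ analyticOrderAt K 0 + analyticOrderAt H 0 := le_add_self
    _ = _ := this.symm

lemma dvd_of_integrals {s : ℝ} (hs : 0 < s) {G : ℂ → ℂ} (hG : DifferentiableOn ℂ G (Metric.closedBall 0 s))
    (A : Multiset ℂ) : (∀ a ∈ A, ‖a‖ < s ∧ G a ≠ 0) → ∀ (Q : ℂ[X]),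
    (∀ p : ℂ[X], p.natDegree < A.card →
      (∮ t in C(0, s), Q.eval t * G t * p.eval t / ((A.map (fun a => X - C a)).prod).eval t) = 0) →
    (A.map (fun a => X - C a)).prod ∣ Q := by
  induction A using Multiset.induction with
  | empty => intro _ Q _; simp
  | cons a A ih =>
    intro hA Q h
    have ha := hA a (by simp)
    have hne : ∀ t ∈ Metric.sphere (0 : ℂ) s, ∀ b ∈ a ::ₘ A, t - b ≠ 0 := by
      intro t ht b hb hh
      have := (hA b hb).1
      rw [← sub_eq_zero.1 hh] at this
      simp at ht; linarith
    set q := (A.map (fun a => X - C a)).prod with hq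
    have hq0 : ∀ t ∈ Metric.sphere (0 : ℂ) s, q.eval t ≠ 0 := by
      intro t ht
      rw [hq, eval_multiset_prod]
      refine Multiset.prod_ne_zero ?_
      simp only [Multiset.map_map, Multiset.mem_map, not_exists, not_and]
      intro b hb
      simpa using hne t ht b (by simp [hb])
    have hQG : DifferentiableOn ℂ (fun t => Q.eval t * G t) (Metric.closedBall 0 s) :=
      Q.differentiable.differentiableOn.mul hG
    have h1 := h q (by
      rw [hq, natDegree_multiset_prod_X_sub_C_eq_card]; simp)
    have h2 := hQG.circleIntegral_sub_inv_smul (w := a) (by simpa using ha.1)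
    have h3 : (∮ t in C(0, s), (t - a)⁻¹ • (Q.eval t * G t)) = 0 := by
      refine Eq.trans ?_ h1
      refine circleIntegral.integral_congr hs.le fun t ht => ?_
      have := hq0 t ht
      have := hne t ht a (by simp)
      simp only [Multiset.map_cons, Multiset.prod_cons, eval_mul, eval_sub, eval_X, eval_C, smul_eq_mul, ← hq]
      field_simp
    rw [h3] at h2
    have hQa : Q.eval a = 0 := by
      have := h2.symm
      simp [Real.pi_ne_zero, ha.2] at this
      exact this
    obtain ⟨Q', rfl⟩ := dvd_iff_isRoot.2 hQa
    rw [Multiset.map_cons, Multiset.prod_cons]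
    refine mul_dvd_mul_left _ (ih (fun b hb => hA b (by simp [hb])) Q' fun p hp => ?_)
    refine Eq.trans ?_ (h p (by simp; omega))
    refine circleIntegral.integral_congr hs.le fun t ht => ?_
    have := hq0 t ht
    have := hne t ht a (by simp)
    simp only [Multiset.map_cons, Multiset.prod_cons, eval_mul, eval_sub, eval_X, eval_C, ← hq]
    field_simp

lemma circInt_poly {s : ℝ} (hs : 0 < s) {G : ℂ → ℂ} (hG : DifferentiableOn ℂ G (Metric.closedBall 0 s))
    (q : ℂ[X]) (hq : ∀ t ∈ Metric.sphere (0 : ℂ) s, q.eval t ≠ 0) (Q p : ℂ[X]) :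
    CircleIntegrable (fun t => Q.eval t * G t * p.eval t / q.eval t) 0 s := by
  refine ContinuousOn.circleIntegrable hs.le ?_
  refine ContinuousOn.div ?_ q.continuous.continuousOn hq
  exact (Q.continuous.continuousOn.mul (hG.continuousOn.mono Metric.sphere_subset_closedBall)).mul
    p.continuous.continuousOn

/-- Polynomial with given coefficients. -/
noncomputable def pc {ν : ℕ} (c : Fin (ν + 1) → ℂ) : ℂ[X] :=
  ∑ j : Fin (ν + 1), C (c j) * X ^ (j : ℕ)

lemma pc_eval {ν : ℕ} (c : Fin (ν + 1) → ℂ) (z : ℂ) :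
    (pc c).eval z = ∑ j : Fin (ν + 1), c j * z ^ (j : ℕ) := by
  simp [pc, eval_finsetSum]

lemma pc_coeff {ν : ℕ} (c : Fin (ν + 1) → ℂ) (i : Fin (ν + 1)) : (pc c).coeff i = c i := by
  simp only [pc, finsetSum_coeff, coeff_C_mul, coeff_X_pow]
  rw [Finset.sum_eq_single i]
  · simp
  · intro b _ hb
    have : (i : ℕ) ≠ b := fun h => hb (Fin.ext h.symm)
    simp [this]
  · simp

lemma pc_natDegree {ν : ℕ} (c : Fin (ν + 1) → ℂ) : (pc c).natDegree ≤ ν := by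
  unfold pc
  refine natDegree_sum_le_of_forall_le _ _ fun i _ => ?_
  exact (natDegree_C_mul_X_pow_le _ _).trans (by omega)

lemma pc_of_poly {ν : ℕ} (Q : ℂ[X]) (h : Q.natDegree ≤ ν) :
    pc (fun j : Fin (ν + 1) => Q.coeff j) = Q := by
  conv_rhs => rw [Q.as_sum_range_C_mul_X_pow' (Nat.lt_succ_of_le h)]
  unfold pc
  rw [Fin.sum_univ_eq_sum_range (fun j => C (Q.coeff j) * X ^ j) (ν + 1)]

/-- The linear map used for the compactness argument. -/
noncomputable def phi {ν : ℕ} {s : ℝ} (hs : 0 < s) {G : ℂ → ℂ}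
    (hG : DifferentiableOn ℂ G (Metric.closedBall 0 s))
    (q : ℂ[X]) (hq : ∀ t ∈ Metric.sphere (0 : ℂ) s, q.eval t ≠ 0) (z : ℂ) :
    (Fin (ν + 1) → ℂ) →ₗ[ℂ] ℂ × (Fin ν → ℂ) where
  toFun c := ((pc c).eval z, fun j =>
    ∮ t in C(0, s), (pc c).eval t * G t * (X ^ (j : ℕ) : ℂ[X]).eval t / q.eval t)
  map_add' c d := by
    have h : pc (c + d) = pc c + pc d := by simp [pc, add_mul, Finset.sum_add_distrib]
    refine Prod.ext ?_ (funext fun j => ?_)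
    · simp [h]
    · simp only [Prod.snd_add, Pi.add_apply]
      rw [← circleIntegral.integral_add (circInt_poly hs hG q hq _ _)
        (circInt_poly hs hG q hq _ _)]
      congr 1
      ext t
      rw [h, eval_add]; ring
  map_smul' a c := by
    have h : pc (a • c) = C a * pc c := by simp [pc, Finset.mul_sum, mul_assoc]
    refine Prod.ext ?_ (funext fun j => ?_)
    · simp [h]
    · simp only [Prod.smul_snd, Pi.smul_apply, RingHom.id_apply]
      rw [← circleIntegral.integral_smul]
      congr 1
      ext t
      rw [h, eval_mul, eval_C, smul_eq_mul]; ring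

lemma phi_inj {ν : ℕ} {s : ℝ} (hs : 0 < s) {G : ℂ → ℂ}
    (hG : DifferentiableOn ℂ G (Metric.closedBall 0 s)) (α : Fin ν → ℂ)
    (hα : ∀ i, ‖α i‖ < s ∧ G (α i) ≠ 0)
    (hq : ∀ t ∈ Metric.sphere (0 : ℂ) s, (∏ i, (X - C (α i))).eval t ≠ 0) (z : ℂ)
    (hz : (∏ i, (X - C (α i))).eval z ≠ 0) :
    LinearMap.ker (phi (ν := ν) hs hG (∏ i, (X - C (α i))) hq z) = ⊥ := by
  rw [LinearMap.ker_eq_bot']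
  intro c hc
  have h1 : (pc c).eval z = 0 := congrArg Prod.fst hc
  have h2 : ∀ j : Fin ν, (∮ t in C(0, s), (pc c).eval t * G t * (X ^ (j : ℕ) : ℂ[X]).eval t /
      (∏ i, (X - C (α i))).eval t) = 0 := fun j => congrFun (congrArg Prod.snd hc) j
  have eA : ((Finset.univ.val.map α).map (fun a => X - C a)).prod = ∏ i, (X - C (α i)) := by
    rw [Multiset.map_map]; rfl
  have hdvd := dvd_of_integrals hs hG (Finset.univ.val.map α) (by
      intro a ha
      obtain ⟨i, -, rfl⟩ := Multiset.mem_map.1 ha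
      exact hα i) (pc c) (by
    intro p hp
    rw [eA]
    simp only [Multiset.card_map, Finset.card_val, Finset.card_univ, Fintype.card_fin] at hp
    have : (fun t => (pc c).eval t * G t * p.eval t / (∏ i, (X - C (α i))).eval t)
      = fun t => ∑ j : Fin ν, p.coeff j • ((pc c).eval t * G t * (X ^ (j : ℕ) : ℂ[X]).eval t /
      (∏ i, (X - C (α i))).eval t) := by
      ext t
      have e : p.eval t = ∑ j : Fin ν, p.coeff j * t ^ (j : ℕ) := by
        rw [Polynomial.eval_eq_sum_range' hp,
          Fin.sum_univ_eq_sum_range (fun j => p.coeff j * t ^ j) ν]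
      rw [e, Finset.mul_sum, Finset.sum_div]
      refine Finset.sum_congr rfl fun j _ => ?_
      simp only [eval_pow, eval_X, smul_eq_mul]
      ring
    rw [this, circleIntegral.integral_fun_sum]
    · refine Finset.sum_eq_zero fun j _ => ?_
      rw [circleIntegral.integral_smul, h2 j, smul_zero]
    · intro j _
      exact (circInt_poly hs hG _ hq _ _).const_smul)
  rw [eA] at hdvd
  have hmon : (∏ i, (X - C (α i))).Monic := monic_prod_of_monic _ _ fun i _ => monic_X_sub_C _
  have hdeg : (∏ i, (X - C (α i))).natDegree = ν := by
    rw [natDegree_prod_of_monic _ _ fun i _ => monic_X_sub_C _]; simp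
  have hzero : pc c = 0 := by
    obtain ⟨w, hw⟩ := hdvd
    by_contra hne
    have hw0 : w ≠ 0 := by rintro rfl; simp at hw; exact hne hw
    have hd := pc_natDegree c
    rw [hw, hmon.natDegree_mul' hw0, hdeg] at hd
    obtain ⟨k, rfl⟩ : ∃ k, w = C k := ⟨_, eq_C_of_natDegree_eq_zero (by omega)⟩
    rw [hw, eval_mul, eval_C] at h1
    rcases mul_eq_zero.1 h1 with h | h
    · exact hz h
    · exact hw0 (by simp [h])
  ext i
  rw [← pc_coeff c i, hzero]; simp

lemma limsup_root {u : ℕ → ℝ} (hu : ∀ n, 0 ≤ u n) {L b A : ℝ} (hb : 0 ≤ b) (hA : 0 < A) (hbL : b < L)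
    (h : ∀ᶠ n in atTop, u n ≤ A * b ^ n) :
    Filter.limsup (fun n => u n ^ ((1 : ℝ) / n)) atTop ≤ L := by
  refine limsup_le_of_le ?_ ?_
  · exact IsCoboundedUnder.of_frequently_ge (a := 0)
      (Frequently.of_forall fun n => Real.rpow_nonneg (hu n) _)
  · have h1 : Tendsto (fun n : ℕ => A ^ ((1 : ℝ) / n) * b) atTop (nhds (A ^ (0 : ℝ) * b)) := by
      refine Tendsto.mul_const _ ?_
      exact (Real.continuousAt_const_rpow hA.ne').tendsto.comp tendsto_one_div_atTop_nhds_zero_nat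
    rw [Real.rpow_zero, one_mul] at h1
    filter_upwards [h, h1.eventually (gt_mem_nhds hbL), eventually_gt_atTop 0] with n hn h2 h3
    calc u n ^ ((1 : ℝ) / n) ≤ (A * b ^ n) ^ ((1 : ℝ) / n) :=
          Real.rpow_le_rpow (hu n) hn (by positivity)
      _ = A ^ ((1 : ℝ) / n) * b := by
          rw [Real.mul_rpow hA.le (by positivity), one_div, Real.pow_rpow_inv_natCast hb h3.ne']
      _ ≤ L := h2.le

lemma rem_bound {τ r : ℝ} {g : ℂ → ℂ} (hg : DifferentiableOn ℂ g (Metric.ball 0 τ))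
    (hr : 0 < r) (hrτ : r < τ) (ν : ℕ) :
    ∃ B > 0, ∀ (c : Fin (ν + 1) → ℂ) (N : ℕ) (z : ℂ), ‖z‖ < r →
      ‖(pc c).eval z * g z - tay N (fun z => (pc c).eval z * g z) z‖ ≤
        B * ‖c‖ * (‖z‖ / r) ^ N := by
  have hd : ∀ j : Fin (ν + 1), DifferentiableOn ℂ (fun z => z ^ (j : ℕ) * g z) (Metric.ball 0 τ) :=
    fun j => (differentiable_id.pow _).differentiableOn.mul hg
  choose B hB hb using fun j => tay_bound (hd j) hr hrτ
  have hB0 : 0 < ∑ j, B j := Finset.sum_pos (fun j _ => hB j) ⟨0, Finset.mem_univ _⟩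
  refine ⟨∑ j, B j, hB0, fun c N z hz => ?_⟩
  have e : (fun z => (pc c).eval z * g z) = fun z => ∑ j, c j * (z ^ (j : ℕ) * g z) := by
    ext z
    rw [pc_eval, Finset.sum_mul]
    simp only [mul_assoc]
  have e' : (pc c).eval z * g z = ∑ j, c j * (z ^ (j : ℕ) * g z) := congrFun e z
  rw [e, e', tay_sum Finset.univ c (F := fun j z => z ^ (j : ℕ) * g z)
    (fun j => (hd j).analyticAt (Metric.ball_mem_nhds _ (hr.trans hrτ))),
    ← Finset.sum_sub_distrib, Finset.sum_mul, Finset.sum_mul]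
  refine norm_sum_le_of_le _ fun j _ => ?_
  rw [← mul_sub, norm_mul, mul_comm (B j), mul_assoc]
  exact mul_le_mul (norm_le_pi_norm c j) (hb j z hz N) (norm_nonneg _) (norm_nonneg _)



/-- Geometric rate of convergence in de Montessus' theorem: for `z` in the disk `‖z‖ < τ`
which is not a pole, `limsup ‖f z - [n/ν](z)‖^{1/n} ≤ ‖z‖/τ`. -/
theorem stmt18 (τ : ℝ) (ν : ℕ) (f g : ℂ → ℂ) (α : Fin ν → ℂ)
    (hτ : 0 < τ)
    (hg : AnalyticOnNhd ℂ g (Metric.ball 0 τ))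
    (hα : ∀ i, 0 < ‖α i‖ ∧ ‖α i‖ < τ)
    (hgα : ∀ i, g (α i) ≠ 0)
    (hf : ∀ z ∈ Metric.ball (0 : ℂ) τ, (∀ i, z ≠ α i) →
      f z = g z / ∏ i, (z - α i))
    (P Q : ℕ → Polynomial ℂ)
    (hP : ∀ n, (P n).natDegree ≤ n) (hQ : ∀ n, (Q n).natDegree ≤ ν)
    (hQ0 : ∀ n, (Q n).eval 0 = 1)
    (hmatch : ∀ n, ∀ k ≤ n + ν,
      iteratedDeriv k (fun z => f z - (P n).eval z / (Q n).eval z) 0 = 0) :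
    ∀ z : ℂ, ‖z‖ < τ → (∀ i, z ≠ α i) →
      Filter.limsup
        (fun n => ‖f z - (P n).eval z / (Q n).eval z‖ ^ ((1 : ℝ) / n)) atTop
      ≤ ‖z‖ / τ := by
  intro z hz hzα
  set q : ℂ[X] := ∏ i, (X - C (α i)) with hqdef
  have hqe : ∀ t, q.eval t = ∏ i, (t - α i) := by
    intro t; simp [hqdef, eval_prod]
  have hq0 : ∀ t, (∀ i, t ≠ α i) → q.eval t ≠ 0 := by
    intro t ht
    rw [hqe]
    exact Finset.prod_ne_zero_iff.2 fun i _ => sub_ne_zero.2 (ht i)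
  have hqdeg : q.natDegree = ν := by
    rw [hqdef, natDegree_prod_of_monic _ _ fun i _ => monic_X_sub_C _]; simp
  have hgd : DifferentiableOn ℂ g (Metric.ball 0 τ) := hg.differentiableOn
  have hg0 : AnalyticAt ℂ g 0 := hg 0 (by simpa using hτ)
  -- the remainder identity
  have hpq : ∀ n t, (Q n).eval t * g t - q.eval t * (P n).eval t =
      (Q n).eval t * g t - tay (n + ν + 1) (fun z => (Q n).eval z * g z) t := by
    intro n t
    have hQa : AnalyticAt ℂ (fun z => (Q n).eval z) 0 := (Q n).differentiable.analyticAt 0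
    have hPa : AnalyticAt ℂ (fun z => (P n).eval z) 0 := (P n).differentiable.analyticAt 0
    have hqa : AnalyticAt ℂ (fun z => q.eval z) 0 := q.differentiable.analyticAt 0
    have hq00 : q.eval 0 ≠ 0 := hq0 0 fun i h => by
      have := (hα i).1
      rw [← h] at this; simp at this
    have hQ00 : (Q n).eval 0 ≠ 0 := by rw [hQ0]; exact one_ne_zero
    have ev1 : ∀ᶠ w in nhds (0 : ℂ), q.eval w ≠ 0 :=
      q.continuous.continuousAt.eventually_ne hq00
    have ev2 : ∀ᶠ w in nhds (0 : ℂ), (Q n).eval w ≠ 0 :=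
      (Q n).continuous.continuousAt.eventually_ne hQ00
    have ev3 : ∀ᶠ w in nhds (0 : ℂ), w ∈ Metric.ball (0 : ℂ) τ := Metric.ball_mem_nhds _ hτ
    have hfq : ∀ w ∈ Metric.ball (0 : ℂ) τ, q.eval w ≠ 0 → f w = g w / q.eval w := by
      intro w hw hqw
      rw [hqe]
      refine hf w hw fun i hi => hqw ?_
      rw [hqe]
      exact Finset.prod_eq_zero (Finset.mem_univ i) (by rw [hi, sub_self])
    have hHa : AnalyticAt ℂ (fun z => f z - (P n).eval z / (Q n).eval z) 0 := by
      refine ((hg0.div hqa hq00).sub (hPa.div hQa hQ00)).congr ?_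
      filter_upwards [ev1, ev3] with w h1 h3
      simp [hfq w h3 h1]
    have hD := match_mul hHa (hqa.mul hQa)
      (D := fun z => (Q n).eval z * g z - (q * P n).eval z) (N := n + ν + 1) (by
        filter_upwards [ev1, ev2, ev3] with w h1 h2 h3
        simp only [Pi.mul_apply, hfq w h3 h1, eval_mul]
        field_simp) (fun k hk => hmatch n k (by omega))
    have h0 := tay_zero hD t
    rw [tay_sub (F := fun z => (Q n).eval z * g z) (hQa.mul hg0) ((q * P n).differentiable.analyticAt 0), sub_eq_zero,
      tay_poly _ _ (by
        have := natDegree_mul_le (p := q) (q := P n)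
        have := hP n
        omega), eval_mul] at h0
    have h0' : tay (n + ν + 1) (fun z => (Q n).eval z * g z) t = q.eval t * (P n).eval t := h0
    rw [h0']
  set c : ℕ → Fin (ν + 1) → ℂ := fun n j => (Q n).coeff j with hc
  have hpc : ∀ n, pc (c n) = Q n := fun n => pc_of_poly (Q n) (hQ n)
  have hcpos : ∀ n, 0 < ‖c n‖ := by
    intro n
    rw [norm_pos_iff]
    intro h
    have h1 := congrFun h 0
    simp only [hc, Fin.val_zero, coeff_zero_eq_eval_zero, hQ0, Pi.zero_apply] at h1
    exact one_ne_zero h1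
  have key : ∀ r, 0 < r → r < τ → ∃ B > 0, ∀ n t, ‖t‖ < r →
      ‖(Q n).eval t * g t - q.eval t * (P n).eval t‖ ≤ B * ‖c n‖ * (‖t‖ / r) ^ n := by
    intro r hr hrτ
    obtain ⟨B, hB, h⟩ := rem_bound hgd hr hrτ ν
    refine ⟨B, hB, fun n t ht => ?_⟩
    have := h (c n) (n + ν + 1) t ht
    rw [hpc] at this
    rw [hpq]
    refine this.trans ?_
    refine mul_le_mul_of_nonneg_left ?_ (by positivity)
    exact pow_le_pow_of_le_one (by positivity) ((div_le_one hr).2 ht.le) (by omega)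
  -- choose the contour
  obtain ⟨s, hs, hsτ, hsα⟩ : ∃ s, 0 < s ∧ s < τ ∧ ∀ i, ‖α i‖ < s := by
    have e1 : ∀ᶠ s in nhdsWithin τ (Set.Iio τ), ∀ i, ‖α i‖ < s :=
      eventually_all.2 fun i => nhdsWithin_le_nhds (lt_mem_nhds (hα i).2)
    have e2 : ∀ᶠ s in nhdsWithin τ (Set.Iio τ), 0 < s := nhdsWithin_le_nhds (lt_mem_nhds hτ)
    have e3 : ∀ᶠ s in nhdsWithin τ (Set.Iio τ), s < τ := self_mem_nhdsWithin
    obtain ⟨s, h1, h2, h3⟩ := (e1.and (e2.and e3)).exists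
    exact ⟨s, h2, h3, h1⟩
  have hqs : ∀ t ∈ Metric.sphere (0 : ℂ) s, q.eval t ≠ 0 := by
    intro t ht
    refine hq0 t fun i hi => ?_
    have := hsα i
    rw [← hi] at this
    simp at ht; linarith
  have hGs : DifferentiableOn ℂ g (Metric.closedBall 0 s) :=
    hgd.mono (Metric.closedBall_subset_ball hsτ)
  obtain ⟨K, hK, hKl⟩ := LinearMap.exists_antilipschitzWith _
    (phi_inj hs hGs α (fun i => ⟨hsα i, hgα i⟩) hqs z (hq0 z hzα))
  have hlow : ∀ᶠ n in atTop, ‖c n‖ ≤ K * ‖(Q n).eval z‖ := by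
    obtain ⟨r, hsr, hrτ⟩ := exists_between hsτ
    have hr := hs.trans hsr
    obtain ⟨B, hB, hb⟩ := key r hr hrτ
    obtain ⟨M, hM⟩ : ∃ M : ℝ, ∀ j : Fin ν, ∀ t ∈ Metric.sphere (0 : ℂ) s,
        ‖t ^ (j : ℕ) / q.eval t‖ ≤ M := by
      have : ∀ j : Fin ν, ∃ M : ℝ, ∀ t ∈ Metric.sphere (0 : ℂ) s, ‖t ^ (j : ℕ) / q.eval t‖ ≤ M :=
        fun j => (isCompact_sphere (0 : ℂ) s).exists_bound_of_continuousOn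
          ((continuous_pow _).continuousOn.div q.continuous.continuousOn hqs)
      choose M hM using this
      refine ⟨∑ j, |M j|, fun j t ht => (hM j t ht).trans ((le_abs_self _).trans ?_)⟩
      exact Finset.single_le_sum (f := fun j => |M j|) (fun _ _ => abs_nonneg _) (Finset.mem_univ j)
    have hL : ∀ n (j : Fin ν), ‖∮ t in C(0, s),
        (Q n).eval t * g t * (X ^ (j : ℕ) : ℂ[X]).eval t / q.eval t‖ ≤
        2 * Real.pi * s * (B * ‖c n‖ * (s / r) ^ n * |M|) := by
      intro n j
      have h0 : (∮ t in C(0, s), (P n * X ^ (j : ℕ)).eval t) = 0 :=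
        Complex.circleIntegral_eq_zero_of_differentiable_on_off_countable hs.le
          Set.countable_empty (P n * X ^ (j : ℕ)).continuous.continuousOn
          (fun t _ => (P n * X ^ (j : ℕ)).differentiable t)
      have h4 := circleIntegral.integral_sub
        (circInt_poly hs hGs q hqs (Q n) (X ^ (j : ℕ)))
        ((P n * X ^ (j : ℕ)).continuous.continuousOn.circleIntegrable hs.le)
      rw [h0, sub_zero] at h4
      rw [← h4]
      refine circleIntegral.norm_integral_le_of_norm_le_const hs.le fun t ht => ?_
      have hqt := hqs t ht
      have hts : ‖t‖ = s := by simpa using ht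
      have e : (Q n).eval t * g t * (X ^ (j : ℕ) : ℂ[X]).eval t / q.eval t -
          (P n * X ^ (j : ℕ)).eval t = ((Q n).eval t * g t - q.eval t * (P n).eval t) *
            (t ^ (j : ℕ) / q.eval t) := by
        simp only [eval_mul, eval_pow, eval_X]
        field_simp
      rw [e, norm_mul]
      have := hb n t (hts ▸ hsr)
      rw [hts] at this
      exact mul_le_mul this ((hM j t ht).trans (le_abs_self _)) (norm_nonneg _) (by positivity)
    have hlim : Tendsto (fun n : ℕ => (K * (2 * Real.pi * s * (B * |M|))) * (s / r) ^ n) atTop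
        (nhds ((K * (2 * Real.pi * s * (B * |M|))) * 0)) :=
      (tendsto_pow_atTop_nhds_zero_of_lt_one (by positivity) ((div_lt_one hr).2 hsr)).const_mul _
    rw [mul_zero] at hlim
    filter_upwards [hlim.eventually (gt_mem_nhds one_pos)] with n hn
    have h1 := ZeroHomClass.bound_of_antilipschitz _ hKl (c n)
    by_contra hcon
    push Not at hcon
    have h2 : ‖phi hs hGs q hqs z (c n)‖ ≤ max ‖(Q n).eval z‖
        (2 * Real.pi * s * (B * ‖c n‖ * (s / r) ^ n * |M|)) := by
      rw [Prod.norm_def]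
      refine max_le_max ?_ ?_
      · simp [phi, hpc]
      · refine (pi_norm_le_iff_of_nonneg (by positivity)).2 fun j => ?_
        have := hL n j
        simpa only [phi, LinearMap.coe_mk, AddHom.coe_mk, hpc] using this
    have hK' : (0 : ℝ) < K := by exact_mod_cast hK
    have h3 : ‖c n‖ ≤ K * max ‖(Q n).eval z‖
        (2 * Real.pi * s * (B * ‖c n‖ * (s / r) ^ n * |M|)) :=
      h1.trans (mul_le_mul_of_nonneg_left h2 hK'.le)
    rw [mul_max_of_nonneg _ _ hK'.le] at h3
    rcases le_max_iff.1 h3 with h | h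
    · linarith
    · have := mul_lt_mul_of_pos_right hn (hcpos n)
      nlinarith
  refine le_of_forall_gt_imp_ge_of_dense fun L hL => ?_
  obtain ⟨r, hr, hrτ, hzr, hrL⟩ : ∃ r, 0 < r ∧ r < τ ∧ ‖z‖ < r ∧ ‖z‖ / r < L := by
    have e1 : ∀ᶠ s in nhdsWithin τ (Set.Iio τ), ‖z‖ < s := nhdsWithin_le_nhds (lt_mem_nhds hz)
    have e2 : ∀ᶠ s in nhdsWithin τ (Set.Iio τ), 0 < s := nhdsWithin_le_nhds (lt_mem_nhds hτ)
    have e3 : ∀ᶠ s in nhdsWithin τ (Set.Iio τ), s < τ := self_mem_nhdsWithin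
    have e4 : ∀ᶠ s in nhdsWithin τ (Set.Iio τ), ‖z‖ / s < L := nhdsWithin_le_nhds
      ((tendsto_const_nhds.div tendsto_id hτ.ne').eventually (gt_mem_nhds hL))
    obtain ⟨s, h1, h2, h3, h4⟩ := (e1.and (e2.and (e3.and e4))).exists
    exact ⟨s, h2, h3, h1, h4⟩
  obtain ⟨B, hB, hb⟩ := key r hr hrτ
  have hK' : (0 : ℝ) < K := by exact_mod_cast hK
  have hqz := hq0 z hzα
  have hqz' : 0 < ‖q.eval z‖ := norm_pos_iff.2 hqz
  refine limsup_root (fun n => norm_nonneg _) (b := ‖z‖ / r) (A := B * K / ‖q.eval z‖)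
    (by positivity) (by positivity) hrL ?_
  filter_upwards [hlow] with n hn
  have hQz' : 0 < ‖(Q n).eval z‖ := by
    have := hcpos n
    by_contra h
    have : ‖(Q n).eval z‖ = 0 := le_antisymm (not_lt.1 h) (norm_nonneg _)
    rw [this] at hn
    linarith
  have hQz : (Q n).eval z ≠ 0 := norm_pos_iff.1 hQz'
  have e : f z - (P n).eval z / (Q n).eval z =
      ((Q n).eval z * g z - q.eval z * (P n).eval z) / (q.eval z * (Q n).eval z) := by
    rw [hf z (by simpa using hz) hzα, ← hqe]
    field_simp
  rw [e, norm_div, norm_mul, div_le_iff₀ (by positivity)]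
  calc _ ≤ B * ‖c n‖ * (‖z‖ / r) ^ n := hb n z hzr
    _ ≤ B * (K * ‖(Q n).eval z‖) * (‖z‖ / r) ^ n := by gcongr
    _ = _ := by field_simp
end
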